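/- Fix ρ > 0 and δ ∈ (0,1). Then for all x ≥ 2 and all integers ℓ ≥ 2, one has ∑_{p ≤ x} |S_ℓ(p)|⁶ ≪_{ρ,δ} (x ℓ³)^ρ · (x + ℓ³) · ℓ^{3+δ}, where the sum is over odd primes p ≤ x. -/

import Mathlib

open Finset Filter

noncomputable section

/-- `S ℓ p = ∑_{n ≤ ℓ} (n/p)`, the quadratic character sum (Legendre symbol for odd prime `p`). -/
def S (ℓ p : ℕ) : ℤ := ∑ n ∈ Finset.Icc 1 ℓ, jacobiSym (n : ℤ) p

/-- the first-passage time `f_ε(p) = min {ℓ ≥ 1 : S_ℓ(p) < ε ℓ}`. -/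
def fpt (ε : ℝ) (p : ℕ) : ℕ := sInf {ℓ : ℕ | 1 ≤ ℓ ∧ ((S ℓ p : ℝ)) < ε * ℓ}

/-- the odd primes up to a real number `x`. -/
def oddPrimesUpTo (x : ℝ) : Finset ℕ :=
  (Finset.range (⌊x⌋₊ + 1)).filter (fun p => p.Prime ∧ p ≠ 2)

/-- `π_odd(x)`, the number of odd primes up to `x`. -/
def piOdd (x : ℝ) : ℕ := (oddPrimesUpTo x).card

/-- `P_ℓ(x)`, the density of odd primes `p ≤ x` with `S_ℓ(p) ≥ ε ℓ`. -/
def Pdens (ε : ℝ) (ℓ : ℕ) (x : ℝ) : ℝ :=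
  (((oddPrimesUpTo x).filter (fun p => ε * ℓ ≤ (S ℓ p : ℝ))).card : ℝ) / (piOdd x : ℝ)

/-- `a_m(x) = N_m(x)/π_odd(x)`, the proportion of odd primes `p ≤ x` with `f_ε(p) > m`. -/
def aCoef (ε : ℝ) (m : ℕ) (x : ℝ) : ℝ :=
  (((oddPrimesUpTo x).filter (fun p => m < fpt ε p)).card : ℝ) / (piOdd x : ℝ)

/-- `c_u(ℓ)`, the number of triples `(a,b,c) ∈ {1,…,ℓ}³` with `abc = u`. -/
def cCoef (ℓ u : ℕ) : ℕ :=
  ((Finset.Icc 1 ℓ ×ˢ Finset.Icc 1 ℓ ×ˢ Finset.Icc 1 ℓ).filter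
    (fun t => t.1 * t.2.1 * t.2.2 = u)).card

/-- `C_3(ℓ) = ∑_{u,v ≤ ℓ³, uv = □} c_u(ℓ) c_v(ℓ)`. -/
def C3 (ℓ : ℕ) : ℕ :=
  ∑ q ∈ (Finset.Icc 1 (ℓ ^ 3) ×ˢ Finset.Icc 1 (ℓ ^ 3)).filter (fun q => IsSquare (q.1 * q.2)),
    cCoef ℓ q.1 * cCoef ℓ q.2

namespace HB

open Complex in
/-- quadratic Gauss sum -/
def Gs (n : ℕ) (k : ℤ) : ℂ :=
  ∑ a ∈ range n, (jacobiSym a n : ℂ) * cexp (2 * Real.pi * I * (a * k / n))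

lemma jac_mod {n : ℕ} {a b : ℤ} (h : a ≡ b [ZMOD n]) : jacobiSym a n = jacobiSym b n :=
  jacobiSym.mod_left' h

open Complex in
lemma cexp_mod {n : ℕ} (hn : n ≠ 0) {a b : ℤ} (h : a ≡ b [ZMOD n]) :
    cexp (2 * Real.pi * I * (a / n)) = cexp (2 * Real.pi * I * (b / n)) := by
  obtain ⟨c, hc⟩ := h.dvd
  rw [Complex.exp_eq_exp_iff_exists_int]
  refine ⟨-c, ?_⟩
  have : (b : ℂ) = a + n * c := by
    have : b = a + n * c := by linarith
    rw [this]; push_cast; ring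
  have hn' : (n : ℂ) ≠ 0 := by exact_mod_cast hn
  rw [this]; push_cast; field_simp; ring

open Complex in
lemma Gs_mul {m n : ℕ} (hm : m ≠ 0) (hn : n ≠ 0) (h : Nat.Coprime m n) (k : ℤ) :
    Gs (m * n) k = (jacobiSym n m : ℂ) * jacobiSym m n * Gs m k * Gs n k := by
  have hm0 : (m : ℂ) ≠ 0 := by exact_mod_cast hm
  have hn0 : (n : ℂ) ≠ 0 := by exact_mod_cast hn
  have : Gs (m * n) k = ∑ x ∈ range m ×ˢ range n,
      ((jacobiSym n m : ℂ) * jacobiSym m n) * (((jacobiSym x.1 m : ℂ) * cexp (2 * Real.pi * I * (x.1 * k / m)))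
        * ((jacobiSym x.2 n : ℂ) * cexp (2 * Real.pi * I * (x.2 * k / n)))) := by
    unfold Gs
    symm
    refine Finset.sum_nbij (fun x => (x.1 * n + x.2 * m) % (m * n)) ?_ ?_ ?_ ?_
    · intro x hx
      simp only [mem_range]
      exact Nat.mod_lt _ (by positivity)
    · rintro ⟨a, b⟩ hx ⟨a', b'⟩ hx' hab
      simp only [coe_product, coe_range, Set.mem_prod, Set.mem_Iio] at hx hx'
      have hab : a * n + b * m ≡ a' * n + b' * m [MOD m * n] := hab
      have h1 : a * n + b * m ≡ a' * n + b' * m [MOD m] := hab.of_mul_right n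
      have h2 : a * n + b * m ≡ a' * n + b' * m [MOD n] := hab.of_mul_left m
      have h1' : a * n ≡ a' * n [MOD m] := by
        simpa [Nat.ModEq] using h1
      have h2' : b * m ≡ b' * m [MOD n] := by
        simpa [Nat.ModEq] using h2
      have e1 : a ≡ a' [MOD m] := Nat.ModEq.cancel_right_of_coprime h h1'
      have e2 : b ≡ b' [MOD n] := Nat.ModEq.cancel_right_of_coprime h.symm h2'
      have := Nat.ModEq.eq_of_lt_of_lt e1 hx.1 hx'.1
      have := Nat.ModEq.eq_of_lt_of_lt e2 hx.2 hx'.2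
      simp [*]
    · apply Finset.surjOn_of_injOn_of_card_le
      · intro x hx
        simp only [coe_range, Set.mem_Iio]
        exact Nat.mod_lt _ (by positivity)
      · rintro ⟨a, b⟩ hx ⟨a', b'⟩ hx' hab
        simp only [coe_product, coe_range, Set.mem_prod, Set.mem_Iio] at hx hx'
        have hab : a * n + b * m ≡ a' * n + b' * m [MOD m * n] := hab
        have h1 : a * n + b * m ≡ a' * n + b' * m [MOD m] := hab.of_mul_right n
        have h2 : a * n + b * m ≡ a' * n + b' * m [MOD n] := hab.of_mul_left m
        have h1' : a * n ≡ a' * n [MOD m] := by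
          simpa [Nat.ModEq] using h1
        have h2' : b * m ≡ b' * m [MOD n] := by
          simpa [Nat.ModEq] using h2
        have e1 : a ≡ a' [MOD m] := Nat.ModEq.cancel_right_of_coprime h h1'
        have e2 : b ≡ b' [MOD n] := Nat.ModEq.cancel_right_of_coprime h.symm h2'
        have := Nat.ModEq.eq_of_lt_of_lt e1 hx.1 hx'.1
        have := Nat.ModEq.eq_of_lt_of_lt e2 hx.2 hx'.2
        simp [*]
      · simp
    · rintro ⟨a, b⟩ hx
      simp only
      have hz : (((a * n + b * m) % (m * n) : ℕ) : ℤ) ≡ a * n + b * m [ZMOD (m * n : ℕ)] := by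
        push_cast
        exact Int.mod_modEq _ _
      have hz2 : (((a * n + b * m) % (m * n) : ℕ) : ℤ) * k ≡ (a * n + b * m) * k [ZMOD (m * n : ℕ)] :=
        hz.mul_right k
      have hE := cexp_mod (Nat.mul_ne_zero hm hn) hz2
      have hJ : jacobiSym (((a * n + b * m) % (m * n) : ℕ) : ℤ) (m * n) =
          (jacobiSym a m * jacobiSym n m) * (jacobiSym b n * jacobiSym m n) := by
        rw [jac_mod hz, jacobiSym.mul_right' _ hm hn]
        congr 1
        · rw [← jacobiSym.mul_left]
          apply jac_mod
          simp [Int.ModEq]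
        · rw [← jacobiSym.mul_left]
          apply jac_mod
          simp [Int.ModEq]
      rw [hJ]
      have hE' : cexp (2 * Real.pi * I * ((((a * n + b * m) % (m * n) : ℕ) : ℂ) * k / ((m * n : ℕ) : ℂ))) =
          cexp (2 * Real.pi * I * (a * k / m)) * cexp (2 * Real.pi * I * (b * k / n)) := by
        rw [Int.cast_mul, Int.cast_natCast] at hE
        rw [hE, ← Complex.exp_add]
        congr 1
        push_cast
        field_simp
      rw [hE']
      push_cast
      ring
  rw [this, ← Finset.mul_sum, Finset.sum_product, Gs, Gs, mul_assoc (_ * _), Finset.sum_mul_sum]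


def qc (p : ℕ) [Fact p.Prime] : MulChar (ZMod p) ℂ :=
  (quadraticChar (ZMod p)).ringHomComp (Int.castRingHom ℂ)

lemma qc_apply {p : ℕ} [Fact p.Prime] (a : ℤ) : qc p (a : ZMod p) = (jacobiSym a p : ℂ) := by
  rw [← jacobiSym.legendreSym.to_jacobiSym, legendreSym]
  simp [qc]

lemma Gs_prime_eq {p : ℕ} [hp : Fact p.Prime] (k : ℤ) :
    Gs p k = gaussSum (qc p) (AddChar.mulShift ZMod.stdAddChar (k : ZMod p)) := by
  unfold Gs gaussSum
  refine Finset.sum_bij' (fun a _ => (a : ZMod p)) (fun a _ => a.val) (by simp) ?_ ?_ (by simp) ?_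
  · intro a _; simp [ZMod.val_lt]
  · intro a ha; simp only [mem_range] at ha; exact ZMod.val_cast_of_lt ha
  · intro a _
    have h1 := qc_apply (p := p) (a : ℤ)
    have h2 := ZMod.stdAddChar_coe (N := p) (a * k : ℤ)
    simp only [Int.cast_natCast, Int.cast_mul] at h1 h2
    rw [h1, AddChar.mulShift_apply, mul_comm (k : ZMod p), h2]
    congr 2
    ring

lemma qc_ne_one {p : ℕ} [hp : Fact p.Prime] (h2 : p ≠ 2) : qc p ≠ 1 := by
  have h : ringChar (ZMod p) ≠ 2 := by rw [ZMod.ringChar_zmod_n]; exact h2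
  intro h1
  obtain ⟨a, ha⟩ := quadraticChar_exists_neg_one' h
  have := congrArg (fun χ : MulChar (ZMod p) ℂ => χ a) h1
  simp [qc, ha] at this
  norm_num at this

lemma qc_quad {p : ℕ} [hp : Fact p.Prime] : (qc p).IsQuadratic :=
  show MulChar.IsQuadratic ((quadraticChar (ZMod p)).ringHomComp (Int.castRingHom ℂ)) from
  (quadraticChar_isQuadratic (ZMod p)).comp _

lemma Gs_prime_sq {p : ℕ} [hp : Fact p.Prime] (h2 : p ≠ 2) :
    Gs p 1 ^ 2 = jacobiSym (-1) p * p := by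
  rw [Gs_prime_eq]
  have := gaussSum_sq (χ := qc p) (qc_ne_one h2) (qc_quad (p := p)) (ZMod.isPrimitive_stdAddChar p)
  simp only [Int.cast_one, AddChar.mulShift_one]
  rw [this, ← qc_apply]
  simp

lemma Gs_prime_shift {p : ℕ} [hp : Fact p.Prime] (h2 : p ≠ 2) (k : ℤ) :
    Gs p k = jacobiSym k p * Gs p 1 := by
  rw [Gs_prime_eq, Gs_prime_eq, ← qc_apply]
  simp only [Int.cast_one, AddChar.mulShift_one]
  by_cases hk : (k : ZMod p) = 0
  · rw [hk, AddChar.mulShift_zero, gaussSum_one_right (qc_ne_one h2), MulChar.map_nonunit _ (by simp), zero_mul]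
  · have := gaussSum_mulShift_eq (qc p) ZMod.stdAddChar (Units.mk0 _ hk)
    rw [Units.val_mk0] at this
    rw [this, qc_quad.inv]

lemma Gs_one (k : ℤ) : Gs 1 k = 1 := by
  simp [Gs]

lemma Gs_sqf {n : ℕ} (hn : Odd n) (hs : Squarefree n) :
    (∀ k, Gs n k = jacobiSym k n * Gs n 1) ∧ Gs n 1 ^ 2 = jacobiSym (-1) n * n := by
  induction n using Nat.recOnMul with
  | zero => simp at hs
  | one => simp [Gs_one]
  | prime p hp =>
    have := Fact.mk hp
    have h2 : p ≠ 2 := by rintro rfl; exact absurd hn (by decide)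
    exact ⟨Gs_prime_shift h2, Gs_prime_sq h2⟩
  | mul a b iha ihb =>
    have hc : Nat.Coprime a b := Nat.coprime_of_squarefree_mul hs
    have ha0 : a ≠ 0 := by rintro rfl; simp at hs
    have hb0 : b ≠ 0 := by rintro rfl; simp at hs
    obtain ⟨a1, a2⟩ := iha (Nat.Odd.of_mul_left hn) hs.of_mul_left
    obtain ⟨b1, b2⟩ := ihb (Nat.Odd.of_mul_right hn) hs.of_mul_right
    constructor
    · intro k
      rw [Gs_mul ha0 hb0 hc, Gs_mul ha0 hb0 hc, a1, b1, jacobiSym.mul_right' _ ha0 hb0]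
      push_cast; ring
    · rw [Gs_mul ha0 hb0 hc, jacobiSym.mul_right' _ ha0 hb0]
      have e1 : (jacobiSym b a : ℂ) ^ 2 = 1 := by
        have : (jacobiSym b a)^2 = 1 := jacobiSym.sq_one (by simpa using hc.symm)
        exact_mod_cast this
      have e2 : (jacobiSym a b : ℂ) ^ 2 = 1 := by
        have : (jacobiSym a b)^2 = 1 := jacobiSym.sq_one (by simpa using hc)
        exact_mod_cast this
      rw [mul_pow, mul_pow, mul_pow, e1, e2, a2, b2]
      push_cast; ring

lemma jac_neg_one {n : ℕ} (hn : Odd n) :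
    (n % 4 = 1 ∧ jacobiSym (-1) n = 1) ∨ (n % 4 = 3 ∧ jacobiSym (-1) n = -1) := by
  rw [jacobiSym.at_neg_one hn]
  have : n % 4 = 1 ∨ n % 4 = 3 := Nat.odd_mod_four_iff.mp (Nat.odd_iff.mp hn)
  rcases this with h | h
  · left; exact ⟨h, ZMod.χ₄_nat_one_mod_four h⟩
  · right; exact ⟨h, ZMod.χ₄_nat_three_mod_four h⟩

lemma recip {m n : ℕ} (hm : Odd m) (hn : Odd n) (h : Nat.Coprime m n) :
    jacobiSym n m * jacobiSym m n = if m % 4 = 3 ∧ n % 4 = 3 then -1 else 1 := by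
  have e1 : (jacobiSym n m) ^ 2 = 1 := jacobiSym.sq_one (by simpa using h.symm)
  have hm4 : m % 4 = 1 ∨ m % 4 = 3 := Nat.odd_mod_four_iff.mp (Nat.odd_iff.mp hm)
  have hn4 : n % 4 = 1 ∨ n % 4 = 3 := Nat.odd_mod_four_iff.mp (Nat.odd_iff.mp hn)
  rcases hm4 with a | a
  · rw [jacobiSym.quadratic_reciprocity_one_mod_four a hn, ← sq, e1]; simp [a]
  · rcases hn4 with b | b
    · rw [← jacobiSym.quadratic_reciprocity_one_mod_four b hm, ← sq, e1]; simp [b]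
    · rw [jacobiSym.quadratic_reciprocity_three_mod_four a b]
      simp only [a, b, and_self, if_true]
      linarith

/-- class lemma -/
lemma Gs_class {g a b : ℕ} {γ : ℂ} (hga : Odd (g * a)) (hgb : Odd (g * b)) (hsa : Squarefree (g * a))
    (hsb : Squarefree (g * b)) (hab : Nat.Coprime a b)
    (h1 : Gs (g * a) 1 = γ * (Real.sqrt (g * a : ℕ) : ℂ))
    (h2 : Gs (g * b) 1 = γ * (Real.sqrt (g * b : ℕ) : ℂ)) :
    Gs (a * b) 1 = (Real.sqrt (a * b : ℕ) : ℂ) ∧ jacobiSym (-1) (a * b) = 1 := by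
  have hg : Odd g := Nat.Odd.of_mul_left hga
  have ha : Odd a := Nat.Odd.of_mul_right hga
  have hb : Odd b := Nat.Odd.of_mul_right hgb
  have hg0 : g ≠ 0 := hg.pos.ne'
  have ha0 : a ≠ 0 := ha.pos.ne'
  have hb0 : b ≠ 0 := hb.pos.ne'
  have cga : Nat.Coprime g a := Nat.coprime_of_squarefree_mul hsa
  have cgb : Nat.Coprime g b := Nat.coprime_of_squarefree_mul hsb
  have q1 := (Gs_sqf hga hsa).2
  have q2 := (Gs_sqf hgb hsb).2
  have qg := (Gs_sqf hg hsa.of_mul_left).2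
  have sq1 : ∀ n : ℕ, ((Real.sqrt n : ℝ) : ℂ) ^ 2 = n := by
    intro n
    rw [← Complex.ofReal_pow, Real.sq_sqrt (by positivity)]; simp
  rw [h1, mul_pow, sq1] at q1
  rw [h2, mul_pow, sq1] at q2
  have k1 : γ ^ 2 = jacobiSym (-1) (g * a) :=
    mul_right_cancel₀ (by exact_mod_cast (Nat.mul_ne_zero hg0 ha0)) q1
  have k2 : γ ^ 2 = jacobiSym (-1) (g * b) :=
    mul_right_cancel₀ (by exact_mod_cast (Nat.mul_ne_zero hg0 hb0)) q2
  have k3 : jacobiSym (-1) (g * a) = jacobiSym (-1) (g * b) := by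
    have := k1.symm.trans k2
    exact_mod_cast this
  rw [jacobiSym.mul_right' _ hg0 ha0, jacobiSym.mul_right' _ hg0 hb0] at k3
  have jg0 : jacobiSym (-1) g ≠ 0 := by
    rcases jac_neg_one hg with h | h <;> rw [h.2] <;> norm_num
  have k4 : jacobiSym (-1) a = jacobiSym (-1) b := mul_left_cancel₀ jg0 k3
  have jaa : jacobiSym (-1) a * jacobiSym (-1) a = 1 := by
    rcases jac_neg_one ha with h | h <;> rw [h.2] <;> norm_num
  have hmod : a % 4 = b % 4 := by
    rcases jac_neg_one ha with h | h <;> rcases jac_neg_one hb with h' | h' <;> 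
      rw [h.2, h'.2] at k4 <;> omega
  have rab : (jacobiSym b a * jacobiSym a b) = jacobiSym (-1) a := by
    rw [recip ha hb hab, ← hmod]
    rcases jac_neg_one ha with h | h <;> rw [h.2] <;> simp [h.1]
  have rg : (jacobiSym a g * jacobiSym g a) = (jacobiSym b g * jacobiSym g b) := by
    rw [recip hg ha cga, recip hg hb cgb, hmod]
  have rg2 : (jacobiSym b g * jacobiSym g b) * (jacobiSym b g * jacobiSym g b) = 1 := by
    rw [recip hg hb cgb]; split_ifs <;> norm_num
  constructor
  · have m1 := Gs_mul hg0 ha0 cga 1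
    have m2 := Gs_mul hg0 hb0 cgb 1
    have m3 := Gs_mul ha0 hb0 hab 1
    have P : Gs (g * a) 1 * Gs (g * b) 1 = jacobiSym (-1) g * g * (Gs a 1 * Gs b 1) := by
      rw [m1, m2, ← qg]
      have r1 : (jacobiSym a g * jacobiSym g a : ℂ) = (jacobiSym b g * jacobiSym g b) := by
        exact_mod_cast rg
      have r2 : (jacobiSym b g * jacobiSym g b : ℂ) * (jacobiSym b g * jacobiSym g b) = 1 := by
        exact_mod_cast rg2
      rw [r1]
      linear_combination (Gs g 1 ^ 2 * Gs a 1 * Gs b 1) * r2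
    have S1 : Real.sqrt (g * a : ℕ) * Real.sqrt (g * b : ℕ) = g * Real.sqrt (a * b : ℕ) := by
      rw [← Real.sqrt_mul (by positivity)]
      have : ((g * a : ℕ) : ℝ) * (g * b : ℕ) = (g : ℝ) ^ 2 * (a * b : ℕ) := by push_cast; ring
      rw [this, Real.sqrt_mul (by positivity), Real.sqrt_sq (by positivity)]
    have S2 : (Real.sqrt (g * a : ℕ) : ℂ) * Real.sqrt (g * b : ℕ) = g * Real.sqrt (a * b : ℕ) := by
      exact_mod_cast S1
    rw [h1, h2] at P
    have k5 : γ ^ 2 = jacobiSym (-1) g * jacobiSym (-1) a := by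
      rw [k1, jacobiSym.mul_right' _ hg0 ha0]; push_cast; ring
    have gn : (jacobiSym (-1) g : ℂ) * g ≠ 0 :=
      mul_ne_zero (by exact_mod_cast jg0) (by exact_mod_cast hg0)
    have P2 : (jacobiSym (-1) a : ℂ) * Real.sqrt (a * b : ℕ) = Gs a 1 * Gs b 1 := by
      apply mul_left_cancel₀ gn
      rw [← P]
      linear_combination (-(g * Real.sqrt (a * b : ℕ) : ℂ)) * k5 - γ ^ 2 * S2
    have rab' : (jacobiSym b a * jacobiSym a b : ℂ) = jacobiSym (-1) a := by exact_mod_cast rab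
    have jaa' : (jacobiSym (-1) a * jacobiSym (-1) a : ℂ) = 1 := by exact_mod_cast jaa
    rw [m3, rab', mul_assoc, ← P2, ← mul_assoc, jaa', one_mul]
  · rw [jacobiSym.mul_right' _ ha0 hb0, ← k4, jaa]

end HB

namespace HB

/-- Gaussian with the value at 0 removed -/
def ff (x : ℝ) : ℝ := if x = 0 then 0 else Real.exp (-Real.pi * x ^ 2)

lemma summ_int {y : ℝ} (hy : y ≠ 0) : Summable (fun m : ℤ => Real.exp (-Real.pi * (m * y) ^ 2)) := by
  have := summable_pow_mul_jacobiTheta₂_term_bound 0 (T := y ^ 2) (by positivity) 0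
  refine this.congr ?_
  intro m
  simp; ring

lemma ff_nonneg (x : ℝ) : 0 ≤ ff x := by unfold ff; split_ifs <;> positivity

lemma ff_le (x : ℝ) : ff x ≤ Real.exp (-Real.pi * x ^ 2) := by
  unfold ff; split_ifs
  · positivity
  · exact le_rfl

lemma ff_zero : ff 0 = 0 := by simp [ff]

lemma ff_le_one (x : ℝ) : ff x ≤ 1 := (ff_le x).trans (by
  rw [Real.exp_le_one_iff]; nlinarith [Real.pi_pos, sq_nonneg x])

lemma ff_summ {y : ℝ} (hy : y ≠ 0) : Summable (fun m : ℕ => ff (m * y)) := by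
  have h := (summ_int hy).comp_injective (Nat.cast_injective (R := ℤ))
  refine Summable.of_nonneg_of_le (fun _ => ff_nonneg _) (fun m => ?_) h
  simpa using ff_le (m * y)

lemma ff_summ_mul {y : ℝ} (hy : y ≠ 0) {c : ℕ → ℝ} (hc : ∀ m, |c m| ≤ 1) :
    Summable (fun m : ℕ => c m * ff (m * y)) := by
  refine Summable.of_norm_bounded (ff_summ hy) (fun m => ?_)
  rw [norm_mul, Real.norm_eq_abs, Real.norm_eq_abs, abs_of_nonneg (ff_nonneg _)]
  exact mul_le_of_le_one_left (ff_nonneg _) (hc m)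

lemma jac_abs (a : ℤ) (n : ℕ) : |(jacobiSym a n : ℝ)| ≤ 1 := by
  rcases jacobiSym.trichotomy a n with h | h | h <;> simp [h]

lemma even_tsum {g : ℤ → ℝ} (hg : Summable g) (he : ∀ m, g (-m) = g m) :
    ∑' m : ℤ, g m = g 0 + 2 * ∑' m : ℕ, (if m = 0 then 0 else g m) := by
  have h1 : Summable (fun m : ℕ => g m) := hg.comp_injective (Nat.cast_injective (R := ℤ))
  have h1' : Summable (fun m : ℕ => g (m + 1)) := by
    have := (summable_nat_add_iff 1).mpr h1
    simpa using this
  have h2 : Summable (fun m : ℕ => g (-(m + 1))) := by simpa only [he] using h1'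
  rw [tsum_of_nat_of_neg_add_one h1 h2]
  have h3 : Summable (fun m : ℕ => if m = 0 then 0 else g m) := by
    refine (summable_nat_add_iff 1).mp ?_
    simpa using h1'
  rw [h1.tsum_eq_zero_add, h3.tsum_eq_zero_add]
  simp only [he]
  simp
  ring

open Complex in
lemma FE_int {n : ℕ} (hn : Odd n) (hs : Squarefree n) (hG : Gs n 1 = (Real.sqrt n : ℂ)) {T : ℝ} (hT : 0 < T) :
    ∑' m : ℤ, (jacobiSym m n : ℝ) * Real.exp (-Real.pi * (m * (1 / T)) ^ 2) =
      T / Real.sqrt n * ∑' m : ℤ, (jacobiSym m n : ℝ) * Real.exp (-Real.pi * (m * (T / n)) ^ 2) := by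
  have hn0 : n ≠ 0 := hn.pos.ne'
  have : NeZero n := ⟨hn0⟩
  have hnR : (n : ℝ) ≠ 0 := by exact_mod_cast hn0
  have hnC : (n : ℂ) ≠ 0 := by exact_mod_cast hn0
  have hTC : (T : ℂ) ≠ 0 := by exact_mod_cast hT.ne'
  have hsq : (Real.sqrt n : ℂ) ≠ 0 := by
    simpa using hn0
  have summ : ∀ y : ℝ, y ≠ 0 → ∀ c : ℤ → ℂ, (∀ m, ‖c m‖ ≤ 1) →
      Summable (fun m : ℤ => c m * cexp (-Real.pi * (m * y) ^ 2)) := by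
    intro y hy c hc
    refine Summable.of_norm_bounded (summ_int hy) (fun m => ?_)
    rw [norm_mul]
    have : cexp (-Real.pi * (m * y) ^ 2) = (Real.exp (-Real.pi * (m * y) ^ 2) : ℝ) := by push_cast; rfl
    rw [this, Complex.norm_real, Real.norm_eq_abs, Real.abs_exp]
    exact mul_le_of_le_one_left (Real.exp_nonneg _) (hc m)
  have jn : ∀ m : ℤ, ‖(jacobiSym m n : ℂ)‖ ≤ 1 := by
    intro m
    rcases jacobiSym.trichotomy m n with h | h | h <;> simp [h]
  have poisson : ∀ a : ℕ, ∑' m : ℤ, cexp (2 * Real.pi * I * (a * m / n)) * cexp (-Real.pi * (m * (1 / T : ℝ)) ^ 2) =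
      T * ∑' k : ℤ, cexp (-Real.pi * ((n * k + a : ℤ) * (T / n : ℝ)) ^ 2) := by
    intro a
    have ha : 0 < (1 / T ^ 2 : ℂ).re := by
      have : (1 / T ^ 2 : ℂ) = ((1 / T ^ 2 : ℝ) : ℂ) := by push_cast; rfl
      rw [this, Complex.ofReal_re]; positivity
    have := Complex.tsum_exp_neg_quadratic ha (I * a / n)
    have h1 : (1 / T ^ 2 : ℂ) ^ (1 / 2 : ℂ) = 1 / T := by
      have : (1 / T ^ 2 : ℂ) = ((1 / T ^ 2 : ℝ) : ℂ) := by push_cast; rfl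
      have h2 : (1 / 2 : ℂ) = ((1 / 2 : ℝ) : ℂ) := by push_cast; rfl
      rw [this, h2, ← Complex.ofReal_cpow (by positivity), ← Real.sqrt_eq_rpow]
      have : (1 / T ^ 2 : ℝ) = (1 / T) ^ 2 := by ring
      rw [this, Real.sqrt_sq (by positivity)]
      push_cast; rfl
    rw [h1] at this
    calc _ = ∑' n_1 : ℤ, cexp (-Real.pi * (1 / T ^ 2 : ℂ) * n_1 ^ 2 + 2 * Real.pi * (I * a / n) * n_1) := by
          refine tsum_congr fun m => ?_
          rw [← Complex.exp_add]; congr 1; push_cast; field_simp; ring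
      _ = _ := this
      _ = T * ∑' k : ℤ, cexp (-Real.pi / (1 / T ^ 2 : ℂ) * (k + I * (I * a / n)) ^ 2) := by
          rw [one_div_one_div]
      _ = _ := by
          congr 1
          rw [← (Equiv.neg ℤ).tsum_eq]
          refine tsum_congr fun m => ?_
          congr 1
          simp only [Equiv.neg_apply]
          push_cast
          field_simp
          have : I ^ 2 = -1 := I_sq
          have h4 : I ^ 4 = 1 := I_pow_four
          ring_nf
          simp only [this, h4]
          ring
  have key : (Real.sqrt n : ℂ) * ∑' m : ℤ, (jacobiSym m n : ℂ) * cexp (-Real.pi * (m * (1 / T : ℝ)) ^ 2) =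
      T * ∑' m : ℤ, (jacobiSym m n : ℂ) * cexp (-Real.pi * (m * (T / n : ℝ)) ^ 2) := by
    calc _ = ∑' m : ℤ, Gs n m * cexp (-Real.pi * (m * (1 / T : ℝ)) ^ 2) := by
          rw [← tsum_mul_left]
          refine tsum_congr fun m => ?_
          rw [(Gs_sqf hn hs).1 m, hG]; ring
      _ = ∑' m : ℤ, ∑ a ∈ range n, (jacobiSym a n : ℂ) * (cexp (2 * Real.pi * I * (a * m / n)) * cexp (-Real.pi * (m * (1 / T : ℝ)) ^ 2)) := by
          refine tsum_congr fun m => ?_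
          rw [Gs, Finset.sum_mul]
          simp only [mul_assoc]
      _ = ∑ a ∈ range n, (jacobiSym a n : ℂ) * ∑' m : ℤ, (cexp (2 * Real.pi * I * (a * m / n)) * cexp (-Real.pi * (m * (1 / T : ℝ)) ^ 2)) := by
          rw [Summable.tsum_finsetSum]
          · simp only [tsum_mul_left]
          · intro a _
            apply Summable.mul_left
            apply summ _ (by positivity)
            intro m
            have : (2 * Real.pi * I * (a * m / n) : ℂ) = ((2 * Real.pi * (a * m / n) : ℝ) : ℂ) * I := by push_cast; ring
            rw [this, Complex.norm_exp_ofReal_mul_I]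
      _ = T * ∑ a ∈ range n, ∑' k : ℤ, (jacobiSym (n * k + a : ℤ) n : ℂ) * cexp (-Real.pi * ((n * k + a : ℤ) * (T / n : ℝ)) ^ 2) := by
          rw [Finset.mul_sum]
          refine Finset.sum_congr rfl fun a _ => ?_
          rw [poisson, mul_left_comm, ← tsum_mul_left]
          congr 1
          refine tsum_congr fun k => ?_
          congr 2
          apply jac_mod
          simp [Int.ModEq]
      _ = _ := by
          congr 1
          have hS := summ (T / n) (by positivity) _ jn
          rw [← (Int.divModEquiv n).symm.tsum_eq]
          have hS2 := (Int.divModEquiv n).symm.summable_iff.mpr hS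
          rw [← (Equiv.prodComm _ _).tsum_eq]
          have hS3 := (Equiv.prodComm (Fin n) ℤ).summable_iff.mpr hS2
          refine Eq.symm ((Summable.tsum_prod hS3).trans ?_)
          rw [tsum_fintype, Finset.sum_range]
          refine Finset.sum_congr rfl fun a _ => ?_
          refine tsum_congr fun k => ?_
          simp [Int.divModEquiv]
          ring_nf
  have key2 : ((Real.sqrt n * ∑' m : ℤ, (jacobiSym m n : ℝ) * Real.exp (-Real.pi * (m * (1 / T)) ^ 2) : ℝ) : ℂ) =
      ((T * ∑' m : ℤ, (jacobiSym m n : ℝ) * Real.exp (-Real.pi * (m * (T / n)) ^ 2) : ℝ) : ℂ) := by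
    push_cast
    push_cast at key
    exact key
  have key3 := Complex.ofReal_injective key2
  have hsR : Real.sqrt n ≠ 0 := by exact_mod_cast hsq
  field_simp
  rw [mul_comm] at key3
  field_simp at key3
  linarith

lemma FE {n : ℕ} (hn : Odd n) (hs : Squarefree n) (hG : Gs n 1 = (Real.sqrt n : ℂ))
    (hJ : jacobiSym (-1) n = 1) {T : ℝ} (hT : 0 < T) :
    ∑' m : ℕ, (jacobiSym m n : ℝ) * ff (m * (1 / T)) =
      T / Real.sqrt n * ∑' m : ℕ, (jacobiSym m n : ℝ) * ff (m * (T / n)) +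
        (if n = 1 then (T - 1) / 2 else 0) := by
  have hn0 : n ≠ 0 := hn.pos.ne'
  have A : ∀ y : ℝ, y ≠ 0 → ∑' m : ℤ, (jacobiSym m n : ℝ) * Real.exp (-Real.pi * (m * y) ^ 2) =
      (if n = 1 then 1 else 0) + 2 * ∑' m : ℕ, (jacobiSym m n : ℝ) * ff (m * y) := by
    intro y hy
    rw [even_tsum]
    · congr 1
      · split_ifs with h
        · subst h; simp
        · have : jacobiSym 0 n = 0 := by
            have : 1 < n := by omega
            exact jacobiSym.zero_left this
          simp [this]
      · congr 1
        refine tsum_congr fun m => ?_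
        by_cases hm : m = 0
        · simp [hm, ff_zero]
        · have : (m * y : ℝ) ≠ 0 := by positivity
          simp [hm, ff, this, hy]
    · refine Summable.of_norm_bounded (summ_int hy) (fun m => ?_)
      rw [norm_mul, Real.norm_eq_abs, Real.norm_eq_abs, Real.abs_exp]
      exact mul_le_of_le_one_left (Real.exp_nonneg _) (jac_abs _ _)
    · intro m
      have : jacobiSym (-m) n = jacobiSym m n := by
        rw [← neg_one_mul, jacobiSym.mul_left, hJ, one_mul]
      rw [this]; simp
  have h := FE_int hn hs hG hT
  rw [A _ (by positivity), A _ (by positivity)] at h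
  split_ifs at h ⊢ with h1
  · subst h1
    simp at h ⊢
    linarith
  · linear_combination h / 2

end HB

namespace HB

section
open MeasureTheory Set
open scoped FourierTransform ContDiff

def Th (u : ℝ) : ℝ := ∑' l : ℕ, ff ((l : ℝ) ^ 2 * u)
def cT : ℝ := ∫ t in Ioi (0 : ℝ), Real.exp (-Real.pi * t ^ 4)
def EE (u : ℝ) : ℝ := Th u - cT / Real.sqrt u

lemma quart_summ {u : ℝ} (hu : 0 < u) :
    Summable (fun l : ℕ => Real.exp (-Real.pi * ((l : ℝ) ^ 2 * u) ^ 2)) := by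
  have h := (summ_int hu.ne').comp_injective (Nat.cast_injective (R := ℤ))
  refine Summable.of_nonneg_of_le (fun _ => Real.exp_nonneg _) (fun m => ?_) h
  simp only [Function.comp_apply, Int.cast_natCast]
  rw [Real.exp_le_exp]
  have : (m : ℝ) * u ≤ (m : ℝ) ^ 2 * u := by
    have : (m : ℝ) ≤ (m : ℝ) ^ 2 := by exact_mod_cast Nat.le_self_pow (by norm_num) m
    gcongr
  have : ((m : ℝ) * u) ^ 2 ≤ ((m : ℝ) ^ 2 * u) ^ 2 := by gcongr
  nlinarith [Real.pi_pos]

lemma th_summ {u : ℝ} (hu : 0 < u) : Summable (fun l : ℕ => ff ((l : ℝ) ^ 2 * u)) :=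
  Summable.of_nonneg_of_le (fun _ => ff_nonneg _) (fun _ => ff_le _) (quart_summ hu)

lemma th_nonneg (u : ℝ) : 0 ≤ Th u := tsum_nonneg fun _ => ff_nonneg _

lemma quart_anti {u : ℝ} (hu : 0 < u) :
    AntitoneOn (fun t : ℝ => Real.exp (-Real.pi * (t ^ 2 * u) ^ 2)) (Ici 0) := by
  intro a ha b hb hab
  simp only [Set.mem_Ici] at ha hb
  simp only
  rw [Real.exp_le_exp]
  have : (a ^ 2 * u) ^ 2 ≤ (b ^ 2 * u) ^ 2 := by gcongr
  nlinarith [Real.pi_pos]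

lemma quart_int {u : ℝ} (hu : 0 < u) :
    ∫ t in Ioi (0 : ℝ), Real.exp (-Real.pi * (t ^ 2 * u) ^ 2) = cT / Real.sqrt u := by
  have := integral_comp_mul_left_Ioi (fun t : ℝ => Real.exp (-Real.pi * t ^ 4)) 0 (Real.sqrt_pos.mpr hu)
  rw [mul_zero, smul_eq_mul] at this
  rw [cT, div_eq_inv_mul, ← this]
  congr 1
  ext t
  congr 2
  have : Real.sqrt u ^ 4 = u ^ 2 := by
    rw [show Real.sqrt u ^ 4 = (Real.sqrt u ^ 2) ^ 2 by ring, Real.sq_sqrt hu.le]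
  rw [mul_pow (Real.sqrt u), this]; ring

lemma quart_tsum {u : ℝ} (hu : 0 < u) :
    Th u = ∑' l : ℕ, Real.exp (-Real.pi * (((l + 1 : ℕ) : ℝ) ^ 2 * u) ^ 2) := by
  rw [Th, (th_summ hu).tsum_eq_zero_add]
  simp only [ff_zero, Nat.cast_zero, ne_eq, OfNat.ofNat_ne_zero, not_false_eq_true, zero_pow, zero_mul, zero_add]
  refine tsum_congr fun l => ?_
  rw [ff, if_neg (by positivity)]

lemma EE_nonpos {u : ℝ} (hu : 0 < u) : EE u ≤ 0 := by
  rw [EE, quart_tsum hu, ← quart_int hu, sub_nonpos]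
  apply (quart_anti hu).tsum_add_one_le_integral
  · have := AntitoneOn.integrableOn_Ioi_of_summable_comp_add (N := 0)
      (f := fun t : ℝ => Real.exp (-Real.pi * (t ^ 2 * u) ^ 2))
    simp only [Nat.cast_zero, Nat.add_zero] at this
    exact this (quart_anti hu) (quart_summ hu) (fun _ _ => Real.exp_nonneg _)
  · intro _ _; positivity

lemma EE_ge {u : ℝ} (hu : 0 < u) : -1 ≤ EE u := by
  have h1 := (quart_anti hu).integral_le_tsum (quart_summ hu) (fun _ _ => Real.exp_nonneg _)
  rw [(quart_summ hu).tsum_eq_zero_add, ← quart_tsum hu, quart_int hu] at h1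
  simp at h1
  rw [EE]; linarith

lemma EE_ge' {u : ℝ} : -(cT / Real.sqrt u) ≤ EE u := by
  rw [EE]; linarith [th_nonneg u]

lemma EE_abs {u : ℝ} (hu : 0 < u) : |EE u| ≤ 1 := by
  rw [abs_le]; exact ⟨EE_ge hu, (EE_nonpos hu).trans zero_le_one⟩

lemma EE_abs' {u : ℝ} (hu : 0 < u) : |EE u| ≤ cT / Real.sqrt u := by
  rw [abs_of_nonpos (EE_nonpos hu)]; linarith [EE_ge' (u := u)]

lemma Th_anti : Antitone (fun t : ℝ => Th (Real.exp t)) := by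
  intro a b hab
  simp only
  rw [quart_tsum (Real.exp_pos _), quart_tsum (Real.exp_pos _)]
  refine Summable.tsum_le_tsum (fun l => ?_) ?_ ?_
  · rw [Real.exp_le_exp]
    have : (((l + 1 : ℕ) : ℝ) ^ 2 * Real.exp a) ^ 2 ≤ (((l + 1 : ℕ) : ℝ) ^ 2 * Real.exp b) ^ 2 := by
      gcongr
    nlinarith [Real.pi_pos]
  · exact (summable_nat_add_iff 1).mpr (quart_summ (Real.exp_pos b))
  · exact (summable_nat_add_iff 1).mpr (quart_summ (Real.exp_pos a))

lemma EE_meas : Measurable (fun t : ℝ => EE (Real.exp t)) := by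
  have h1 : Measurable (fun t : ℝ => Th (Real.exp t)) := Th_anti.measurable
  have h2 : Measurable (fun t : ℝ => cT / Real.sqrt (Real.exp t)) := by fun_prop
  exact h1.sub h2

lemma EE_integrable {σ : ℝ} (h0 : 0 < σ) (h1 : σ < 1 / 2) :
    Integrable (fun t : ℝ => ((EE (Real.exp t) * Real.exp (σ * t) : ℝ) : ℂ)) := by
  apply Integrable.ofReal
  have hm : AEStronglyMeasurable (fun t : ℝ => EE (Real.exp t) * Real.exp (σ * t)) volume := by
    apply Measurable.aestronglyMeasurable
    exact EE_meas.mul (by fun_prop)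
  have i1 : IntegrableOn (fun t : ℝ => EE (Real.exp t) * Real.exp (σ * t)) (Iic 0) := by
    refine Integrable.mono' (integrableOn_exp_mul_Iic h0 0) hm.restrict ?_
    refine Filter.Eventually.of_forall fun t => ?_
    rw [norm_mul, Real.norm_eq_abs, Real.norm_eq_abs, Real.abs_exp]
    exact mul_le_of_le_one_left (Real.exp_nonneg _) (EE_abs (Real.exp_pos _))
  have i2 : IntegrableOn (fun t : ℝ => EE (Real.exp t) * Real.exp (σ * t)) (Ioi 0) := by
    refine Integrable.mono' ((integrableOn_exp_mul_Ioi (a := σ - 1 / 2) (by linarith) 0).const_mul cT) hm.restrict ?_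
    refine Filter.Eventually.of_forall fun t => ?_
    rw [norm_mul, Real.norm_eq_abs, Real.norm_eq_abs, Real.abs_exp]
    calc _ ≤ cT / Real.sqrt (Real.exp t) * Real.exp (σ * t) := by
          gcongr; exact EE_abs' (Real.exp_pos _)
      _ = _ := by
          rw [Real.sqrt_eq_rpow, ← Real.exp_mul, div_mul_eq_mul_div, mul_div_assoc, ← Real.exp_sub]
          congr 2; ring
  have := i1.union i2
  rwa [Iic_union_Ioi, integrableOn_univ] at this

open Complex in
lemma conv_rep {W : ℝ → ℂ} (hW : ContDiff ℝ ∞ W) (hc : HasCompactSupport W) {h : ℝ → ℂ} (hh : Integrable h) :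
    ∃ φ : ℝ → ℂ, Integrable φ ∧ ∀ t : ℝ, ∫ s, W s * h (t - s) = ∫ τ, φ τ * cexp (2 * Real.pi * I * τ * t) := by
  set S := hc.toSchwartzMap hW with hS
  set F : ℝ → ℂ := fun τ => (𝓕 S) τ with hF
  have hFi : Integrable F := (𝓕 S).integrable
  have hinv : ∀ s, W s = ∫ τ, F τ * cexp (2 * Real.pi * I * τ * s) := by
    intro s
    have h1 : 𝓕⁻ (𝓕 S) = S := FourierTransform.fourierInv_fourier_eq S
    have h2 : (𝓕⁻ (𝓕 S)) s = W s := by rw [h1]; rfl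
    rw [← h2, SchwartzMap.fourierInv_coe, Real.fourierInv_eq']
    congr 1
    ext τ
    rw [smul_eq_mul, mul_comm]
    congr 2
    simp
    ring
  have hG : ∀ t : ℝ, Integrable (Function.uncurry fun (τ s : ℝ) => F τ * h (t - s) * cexp (2 * Real.pi * I * τ * s)) (volume.prod volume) := by
    intro t
    have h1 : Integrable (fun p : ℝ × ℝ => F p.1 * h (t - p.2)) (volume.prod volume) :=
      hFi.mul_prod (hh.comp_sub_left t)
    refine Integrable.mono h1 ?_ ?_
    · refine AEStronglyMeasurable.mul h1.1 ?_
      apply Continuous.aestronglyMeasurable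
      fun_prop
    · refine Filter.Eventually.of_forall fun p => ?_
      simp only [Function.uncurry]
      rw [norm_mul]
      have : (2 * Real.pi * I * p.1 * p.2 : ℂ) = ((2 * Real.pi * p.1 * p.2 : ℝ) : ℂ) * I := by push_cast; ring
      rw [this, Complex.norm_exp_ofReal_mul_I, mul_one]
  refine ⟨fun τ => ∫ s, F τ * h (0 - s) * cexp (2 * Real.pi * I * τ * s), (hG 0).integral_prod_left, ?_⟩
  intro t
  calc ∫ s, W s * h (t - s) = ∫ s, ∫ τ, F τ * h (t - s) * cexp (2 * Real.pi * I * τ * s) := by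
        congr 1; ext s
        rw [hinv s, ← integral_mul_const]
        congr 1; ext τ; ring
    _ = ∫ τ, ∫ s, F τ * h (t - s) * cexp (2 * Real.pi * I * τ * s) := by
        rw [integral_integral_swap (hG t)]
    _ = _ := by
        congr 1; ext τ
        rw [← integral_add_left_eq_self _ t, ← integral_mul_const]
        congr 1; ext s
        rw [mul_assoc (F τ * h (0 - s)), ← Complex.exp_add]
        congr 2
        · rw [show t - (t + s) = 0 - s by ring]
        · push_cast; ring

open Complex in
lemma mellin_E {w : ℝ → ℝ} (hw : ContDiff ℝ ∞ w) (hc : HasCompactSupport w) {σ : ℝ} (h0 : 0 < σ) (h1 : σ < 1 / 2) :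
    ∃ φ : ℝ → ℂ, Integrable φ ∧ ∀ v : ℝ, 0 < v → ((∫ s, w s * EE (v * Real.exp (-s)) : ℝ) : ℂ) =
      ∫ τ, φ τ * cexp ((-σ + 2 * Real.pi * I * τ) * Real.log v) := by
  have hW : ContDiff ℝ ∞ (fun s : ℝ => ((w s * Real.exp (σ * s) : ℝ) : ℂ)) := by
    have : ContDiff ℝ ∞ (fun s : ℝ => w s * Real.exp (σ * s)) := hw.mul (by fun_prop)
    exact Complex.ofRealCLM.contDiff.comp this
  have hcW : HasCompactSupport (fun s : ℝ => ((w s * Real.exp (σ * s) : ℝ) : ℂ)) := by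
    have : HasCompactSupport (fun s : ℝ => w s * Real.exp (σ * s)) := hc.mul_right
    exact this.comp_left (g := fun x : ℝ => (x : ℂ)) (by simp)
  obtain ⟨φ, hφ, h⟩ := conv_rep hW hcW (EE_integrable h0 h1)
  refine ⟨φ, hφ, fun v hv => ?_⟩
  have h2 := h (Real.log v)
  have e1 : ∀ s : ℝ, Real.exp (Real.log v - s) = v * Real.exp (-s) := by
    intro s; rw [sub_eq_add_neg, Real.exp_add, Real.exp_log hv]
  have : ((∫ s, w s * EE (v * Real.exp (-s)) : ℝ) : ℂ) = cexp (-σ * Real.log v) *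
      ∫ s, ((w s * Real.exp (σ * s) : ℝ) : ℂ) * ((EE (Real.exp (Real.log v - s)) * Real.exp (σ * (Real.log v - s)) : ℝ) : ℂ) := by
    rw [← integral_const_mul, ← integral_complex_ofReal]
    congr 1; ext s
    rw [e1]
    push_cast
    have : cexp (-σ * Real.log v) * cexp (σ * s) * cexp (σ * (Real.log v - s)) = 1 := by
      rw [← Complex.exp_add, ← Complex.exp_add, ← Complex.exp_zero]; congr 1; ring
    linear_combination (-((w s : ℂ) * (EE (v * Real.exp (-s)) : ℂ))) * this
  rw [this, h2, ← integral_const_mul]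
  congr 1; ext τ
  rw [mul_left_comm, ← Complex.exp_add]
  congr 2; ring

open Complex in
lemma mellin_E2 {w : ℝ → ℝ} (hw : ContDiff ℝ ∞ w) (hc : HasCompactSupport w) {σ : ℝ} (h0 : 0 < σ) (h1 : σ < 1 / 2) :
    ∃ φ : ℝ → ℂ, Integrable φ ∧ ∀ v : ℝ, 0 < v → ((∫ s, w s * (Real.exp s * EE (v * Real.exp s)) : ℝ) : ℂ) =
      ∫ τ, φ τ * cexp ((-σ + 2 * Real.pi * I * τ) * Real.log v) := by
  have hw' : ContDiff ℝ ∞ (fun s => w (-s) * Real.exp (-s)) := (hw.comp contDiff_neg).mul (by fun_prop)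
  have hc' : HasCompactSupport (fun s => w (-s) * Real.exp (-s)) := by
    have : HasCompactSupport (fun s => w (-s)) := hc.comp_homeomorph (Homeomorph.neg ℝ)
    exact this.mul_right
  obtain ⟨φ, hφ, h⟩ := mellin_E hw' hc' h0 h1
  refine ⟨φ, hφ, fun v hv => ?_⟩
  rw [← h v hv, ← integral_neg_eq_self]
  congr 2; ext s
  ring

lemma exists_bump : ∃ w : ℝ → ℝ, ContDiff ℝ ∞ w ∧ HasCompactSupport w ∧ (∀ s, 0 ≤ w s) ∧
    (∀ s, w s ≠ 0 → s ∈ Icc (0 : ℝ) 1) ∧ ∫ s, w s = 1 ∧ Integrable w := by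
  let c : ContDiffBump (1 / 2 : ℝ) := ⟨1 / 4, 1 / 2, by norm_num, by norm_num⟩
  refine ⟨c.normed volume, c.contDiff_normed, c.hasCompactSupport_normed, fun s => c.nonneg_normed s, ?_, c.integral_normed,
    c.integrable_normed⟩
  intro s hs
  have : s ∈ Function.support (c.normed volume) := hs
  rw [c.support_normed_eq, Real.ball_eq_Ioo] at this
  simp only [c, Set.mem_Ioo] at this
  constructor <;> linarith [this.1, this.2]

end
end HB

namespace HB

def jj (m n : ℕ) : ℝ := (jacobiSym m n : ℝ)
def mob (e : ℕ) : ℝ := (ArithmeticFunction.moebius e : ℝ)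
def sq (K : ℕ) : Finset ℕ := (Icc 1 K).filter Squarefree
def inB (K m : ℕ) : Prop := ∃ j ∈ sq K, ∃ l, m = j * l ^ 2

lemma jj_abs (m n : ℕ) : |jj m n| ≤ 1 := jac_abs _ _

lemma jj_mul_left (a b n : ℕ) : jj (a * b) n = jj a n * jj b n := by
  unfold jj; push_cast; rw [jacobiSym.mul_left]; push_cast; rfl

lemma jj_mul_right (m : ℕ) {a b : ℕ} (ha : a ≠ 0) (hb : b ≠ 0) : jj m (a * b) = jj m a * jj m b := by
  unfold jj; rw [jacobiSym.mul_right' _ ha hb]; push_cast; rfl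

lemma jj_sq (m : ℕ) {n : ℕ} (hn : n ≠ 0) : jj m n ^ 2 = if Nat.Coprime m n then 1 else 0 := by
  have : NeZero n := ⟨hn⟩
  unfold jj
  split_ifs with h
  · have : (jacobiSym m n) ^ 2 = 1 := jacobiSym.sq_one (by simpa using h)
    exact_mod_cast this
  · have : jacobiSym m n = 0 := jacobiSym.eq_zero_iff_not_coprime.mpr (by simpa using h)
    simp [this]

lemma mob_abs (e : ℕ) : |mob e| ≤ 1 := by
  unfold mob
  have := ArithmeticFunction.abs_moebius_le_one (n := e)
  exact_mod_cast this

lemma mob_sum (l : ℕ) {n : ℕ} (hn : n ≠ 0) :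
    ∑ e ∈ n.divisors, (if e ∣ l then mob e else 0) = if Nat.Coprime l n then 1 else 0 := by
  rw [← Finset.sum_filter]
  have : n.divisors.filter (· ∣ l) = (Nat.gcd l n).divisors := by
    ext e
    simp only [mem_filter, Nat.mem_divisors, Nat.dvd_gcd_iff, ne_eq, Nat.gcd_eq_zero_iff]
    tauto
  rw [this]
  have h := ArithmeticFunction.coe_mul_zeta_apply (f := (ArithmeticFunction.moebius)) (x := Nat.gcd l n)
  rw [ArithmeticFunction.moebius_mul_coe_zeta] at h
  unfold mob
  rw [← Int.cast_sum, ← h, ArithmeticFunction.one_apply]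
  by_cases hc : Nat.gcd l n = 1
  · simp [hc, Nat.Coprime]
  · simp [hc, Nat.Coprime]

lemma tsum_dvd {e : ℕ} (he : e ≠ 0) (h : ℕ → ℝ) :
    ∑' l, (if e ∣ l then h l else 0) = ∑' l, h (e * l) := by
  have hi : Function.Injective (fun l : ℕ => e * l) := fun a b hab => Nat.eq_of_mul_eq_mul_left (Nat.pos_of_ne_zero he) hab
  rw [← hi.tsum_eq]
  · simp
  · intro l hl
    simp only [Function.mem_support] at hl
    have : e ∣ l := by by_contra h'; simp [h'] at hl
    obtain ⟨c, rfl⟩ := this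
    exact ⟨c, rfl⟩

lemma sqf_unique {j j' l l' : ℕ} (hj : Squarefree j) (hj' : Squarefree j') (hl : l ≠ 0) (hl' : l' ≠ 0)
    (h : j * l ^ 2 = j' * l' ^ 2) : j = j' := by
  apply Nat.eq_of_factorization_eq hj.ne_zero hj'.ne_zero
  intro p
  have h1 := hj.natFactorization_le_one p
  have h2 := hj'.natFactorization_le_one p
  have := congrArg (fun x => x.factorization p) h
  rw [Nat.factorization_mul hj.ne_zero (by positivity), Nat.factorization_mul hj'.ne_zero (by positivity),
    Nat.factorization_pow, Nat.factorization_pow] at this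
  simp at this
  omega

open Classical in
lemma sum_B (K : ℕ) {c : ℕ → ℝ} (hc : Summable c) (h0 : c 0 = 0) :
    ∑' m, (if inB K m then c m else 0) = ∑ j ∈ sq K, ∑' l, c (j * l ^ 2) := by
  have h1 : ∀ m, (if inB K m then c m else 0) = ∑ j ∈ sq K, (if ∃ l, m = j * l ^ 2 then c m else 0) := by
    intro m
    by_cases hm : m = 0
    · subst hm; simp [h0]
    split_ifs with h
    · obtain ⟨j, hj, l, rfl⟩ := h
      have hjs : Squarefree j := (mem_filter.mp hj).2
      have hl : l ≠ 0 := by rintro rfl; simp at hm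
      rw [Finset.sum_eq_single j]
      · rw [if_pos ⟨l, rfl⟩]
      · intro j' hj' hne
        rw [if_neg]
        rintro ⟨l', hl'⟩
        have hjs' : Squarefree j' := (mem_filter.mp hj').2
        have hl0 : l' ≠ 0 := by rintro rfl; simp [hl] at hl'; exact hjs.ne_zero hl'
        exact hne (sqf_unique hjs' hjs hl0 hl hl'.symm)
      · intro h; exact absurd hj h
    · symm
      apply Finset.sum_eq_zero
      intro j hj
      rw [if_neg]
      rintro ⟨l, hl⟩
      exact h ⟨j, hj, l, hl⟩
  simp_rw [h1]
  rw [Summable.tsum_finsetSum]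
  · refine Finset.sum_congr rfl fun j hj => ?_
    have hjs : Squarefree j := (mem_filter.mp hj).2
    have hi : Function.Injective (fun l : ℕ => j * l ^ 2) := by
      intro a b hab
      have := Nat.eq_of_mul_eq_mul_left (Nat.pos_of_ne_zero hjs.ne_zero) hab
      exact Nat.pow_left_injective (by norm_num) this
    rw [← hi.tsum_eq]
    · refine tsum_congr fun l => ?_
      rw [if_pos ⟨l, rfl⟩]
    · intro m hm
      simp only [Function.mem_support] at hm
      by_contra h'
      apply hm
      rw [if_neg]
      rintro ⟨l, rfl⟩
      exact h' ⟨l, rfl⟩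
  · intro j _
    refine Summable.of_norm_bounded hc.norm (fun m => ?_)
    split_ifs
    · exact le_rfl
    · simp

lemma dvd_sq_iff {d j l : ℕ} (hd : Squarefree d) : d ∣ j * l ^ 2 ↔ d / Nat.gcd d j ∣ l := by
  set q := Nat.gcd d j with hq
  have hq0 : 0 < q := Nat.gcd_pos_of_pos_left _ (Nat.pos_of_ne_zero hd.ne_zero)
  obtain ⟨r, hr⟩ := Nat.gcd_dvd_left d j
  obtain ⟨i, hi⟩ := Nat.gcd_dvd_right d j
  rw [← hq] at hr hi
  have hco : Nat.Coprime r i := by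
    have := Nat.coprime_div_gcd_div_gcd (m := d) (n := j) hq0
    rw [← hq] at this
    rwa [Nat.div_eq_of_eq_mul_right hq0 hr, Nat.div_eq_of_eq_mul_right hq0 hi] at this
  rw [Nat.div_eq_of_eq_mul_right hq0 hr]
  have hrs : Squarefree r := by rw [hr] at hd; exact hd.of_mul_right
  conv_lhs => rw [hr, hi]
  rw [mul_assoc, Nat.mul_dvd_mul_iff_left hq0]
  constructor
  · intro h
    have := hco.dvd_of_dvd_mul_left h
    exact (hrs.dvd_pow_iff_dvd (by norm_num)).mp this
  · intro h
    exact Dvd.dvd.mul_left (h.trans (dvd_pow_self _ (by norm_num))) _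

/-- the sum over multiples of d -/
def cf (d n : ℕ) (y : ℝ) (m : ℕ) : ℝ := if d ∣ m then jj m n * ff (m * y) else 0

lemma cf_summ (d n : ℕ) {y : ℝ} (hy : y ≠ 0) : Summable (cf d n y) := by
  refine Summable.of_norm_bounded (ff_summ hy) (fun m => ?_)
  unfold cf
  split_ifs
  · rw [norm_mul, Real.norm_eq_abs, Real.norm_eq_abs, abs_of_nonneg (ff_nonneg _)]
    exact mul_le_of_le_one_left (ff_nonneg _) (jj_abs _ _)
  · simpa using ff_nonneg _

lemma cf_zero (d n : ℕ) (y : ℝ) : cf d n y 0 = 0 := by simp [cf, ff_zero]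

lemma piece {d n : ℕ} (hd : Squarefree d) (hn : n ≠ 0) (hdn : Nat.Coprime d n) {j : ℕ} (hj : j ≠ 0) {y : ℝ} (hy : 0 < y) :
    ∑' l : ℕ, cf d n y (j * l ^ 2) =
      jj j n * ∑ e ∈ n.divisors, mob e * Th ((e : ℝ) ^ 2 * j * ((d / Nat.gcd d j : ℕ) : ℝ) ^ 2 * y) := by
  set r := d / Nat.gcd d j with hr
  have hrd : r ∣ d := Nat.div_dvd_of_dvd (Nat.gcd_dvd_left _ _)
  have hr0 : r ≠ 0 := ne_zero_of_dvd_ne_zero hd.ne_zero hrd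
  have hrn : Nat.Coprime r n := Nat.Coprime.coprime_dvd_left hrd hdn
  calc ∑' l : ℕ, cf d n y (j * l ^ 2)
      = ∑' l : ℕ, (if r ∣ l then jj j n * jj l n ^ 2 * ff ((l : ℝ) ^ 2 * (j * y)) else 0) := by
        refine tsum_congr fun l => ?_
        unfold cf
        simp only [dvd_sq_iff hd, ← hr]
        split_ifs
        · rw [jj_mul_left, pow_two, jj_mul_left]; push_cast
          ring_nf
        · rfl
    _ = ∑' l : ℕ, (jj j n * jj (r * l) n ^ 2 * ff (((r * l : ℕ) : ℝ) ^ 2 * (j * y))) := tsum_dvd hr0 _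
    _ = ∑' l : ℕ, ∑ e ∈ n.divisors, jj j n * (if e ∣ l then mob e * ff ((l : ℝ) ^ 2 * (j * (r : ℝ) ^ 2 * y)) else 0) := by
        refine tsum_congr fun l => ?_
        rw [← Finset.mul_sum]
        have h1 : jj (r * l) n ^ 2 = ∑ e ∈ n.divisors, (if e ∣ l then mob e else 0) := by
          rw [mob_sum _ hn, jj_sq _ hn]
          have : Nat.Coprime (r * l) n ↔ Nat.Coprime l n := by
            rw [Nat.coprime_mul_iff_left]; tauto
          simp [this]
        rw [h1, mul_assoc, Finset.sum_mul]
        congr 1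
        refine Finset.sum_congr rfl fun e _ => ?_
        split_ifs
        · congr 2; push_cast; ring
        · simp
    _ = ∑ e ∈ n.divisors, jj j n * ∑' l : ℕ, (if e ∣ l then mob e * ff ((l : ℝ) ^ 2 * (j * (r : ℝ) ^ 2 * y)) else 0) := by
        rw [Summable.tsum_finsetSum]
        · simp only [tsum_mul_left]
        · intro e _
          apply Summable.mul_left
          refine Summable.of_norm_bounded (th_summ (u := j * (r : ℝ) ^ 2 * y) (by positivity)) (fun m => ?_)
          split_ifs
          · rw [norm_mul, Real.norm_eq_abs, Real.norm_eq_abs, abs_of_nonneg (ff_nonneg _)]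
            exact mul_le_of_le_one_left (ff_nonneg _) (mob_abs _)
          · simpa using ff_nonneg _
    _ = _ := by
        rw [Finset.mul_sum]
        refine Finset.sum_congr rfl fun e he => ?_
        have he0 : e ≠ 0 := ne_zero_of_dvd_ne_zero hn (Nat.dvd_of_mem_divisors he)
        rw [tsum_dvd he0, tsum_mul_left, Th]
        congr 2
        refine tsum_congr fun l => ?_
        congr 1; push_cast; ring

open Classical in
/-- part outside B_K -/
def AN (K d n : ℕ) (y : ℝ) : ℝ := ∑' m, (if inB K m then 0 else cf d n y m)

open Classical in
lemma A_split (K : ℕ) {d n : ℕ} (hd : Squarefree d) (hn : n ≠ 0) (hdn : Nat.Coprime d n) {y : ℝ} (hy : 0 < y) :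
    ∑' m, cf d n y m = AN K d n y + ∑ j ∈ sq K, jj j n * ∑ e ∈ n.divisors,
      mob e * Th ((e : ℝ) ^ 2 * j * ((d / Nat.gcd d j : ℕ) : ℝ) ^ 2 * y) := by
  have hs := cf_summ d n hy.ne'
  have h1 := sum_B K hs (cf_zero d n y)
  have h2 : ∑ j ∈ sq K, ∑' l, cf d n y (j * l ^ 2) = ∑ j ∈ sq K, jj j n * ∑ e ∈ n.divisors,
      mob e * Th ((e : ℝ) ^ 2 * j * ((d / Nat.gcd d j : ℕ) : ℝ) ^ 2 * y) := by
    refine Finset.sum_congr rfl fun j hj => ?_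
    exact piece hd hn hdn (Squarefree.ne_zero (mem_filter.mp hj).2) hy
  rw [← h2, ← h1, AN, ← Summable.tsum_add]
  · refine tsum_congr fun m => ?_
    split_ifs <;> simp
  · refine Summable.of_norm_bounded hs.norm (fun m => ?_)
    split_ifs <;> simp
  · refine Summable.of_norm_bounded hs.norm (fun m => ?_)
    split_ifs <;> simp

lemma A_FE {d n : ℕ} (hd : d ≠ 0) (hn : Odd n) (hs : Squarefree n) (hG : Gs n 1 = (Real.sqrt n : ℂ))
    (hJ : jacobiSym (-1) n = 1) {T : ℝ} (hT : 0 < T) :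
    ∑' m, cf d n (1 / T) m = T / (d * Real.sqrt n) * ∑' m, cf d n (T / (n * d ^ 2)) m +
      (if n = 1 then (T / d - 1) / 2 else 0) := by
  have hdR : (0 : ℝ) < d := by exact_mod_cast Nat.pos_of_ne_zero hd
  have hnR : (0 : ℝ) < n := by exact_mod_cast hn.pos
  have h1 : ∀ y, ∑' m, cf d n y m = jj d n * ∑' m : ℕ, (jacobiSym m n : ℝ) * ff (m * (d * y)) := by
    intro y
    unfold cf
    rw [tsum_dvd hd, ← tsum_mul_left]
    refine tsum_congr fun l => ?_
    rw [jj_mul_left, ← mul_assoc]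
    congr 1
    push_cast; ring_nf
  have h2 := FE hn hs hG hJ (T := T / d) (by positivity)
  rw [h1, h1, show d * (1 / T) = 1 / (T / d) by field_simp, h2,
    show d * (T / (n * d ^ 2)) = T / d / n by field_simp, mul_add]
  congr 1
  · field_simp
  · split_ifs with h
    · subst h; simp [jj]
    · simp

/-- the key identity -/
lemma AN_eq (K : ℕ) {d n : ℕ} (hd : Squarefree d) (hn : Odd n) (hs : Squarefree n) (hdn : Nat.Coprime d n)
    (hG : Gs n 1 = (Real.sqrt n : ℂ)) (hJ : jacobiSym (-1) n = 1) {T : ℝ} (hT : 0 < T) :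
    AN K d n (1 / T) = (if n = 1 then (T / d - 1) / 2 else 0) + T / (d * Real.sqrt n) * AN K d n (T / (n * d ^ 2))
      - ∑ j ∈ sq K, jj j n * ∑ e ∈ n.divisors, mob e *
          EE ((e : ℝ) ^ 2 * j * ((d / Nat.gcd d j : ℕ) : ℝ) ^ 2 * (1 / T))
      + T / (d * Real.sqrt n) * ∑ j ∈ sq K, jj j n * ∑ e ∈ n.divisors, mob e *
          EE ((e : ℝ) ^ 2 * j * ((d / Nat.gcd d j : ℕ) : ℝ) ^ 2 * (T / (n * d ^ 2))) := by
  have hd0 : d ≠ 0 := hd.ne_zero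
  have hdR : (0 : ℝ) < d := by exact_mod_cast Nat.pos_of_ne_zero hd0
  have hnR : (0 : ℝ) < n := by exact_mod_cast hn.pos
  have h0 := A_FE hd0 hn hs hG hJ hT
  have h1 := A_split K hd hn.pos.ne' hdn (y := 1 / T) (by positivity)
  have h2 := A_split K hd hn.pos.ne' hdn (y := T / (n * d ^ 2)) (by positivity)
  rw [h1, h2] at h0
  have key : ∑ j ∈ sq K, jj j n * ∑ e ∈ n.divisors, mob e * Th ((e : ℝ) ^ 2 * j * ((d / Nat.gcd d j : ℕ) : ℝ) ^ 2 * (1 / T))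
      - T / (d * Real.sqrt n) * ∑ j ∈ sq K, jj j n * ∑ e ∈ n.divisors, mob e *
          Th ((e : ℝ) ^ 2 * j * ((d / Nat.gcd d j : ℕ) : ℝ) ^ 2 * (T / (n * d ^ 2))) =
      ∑ j ∈ sq K, jj j n * ∑ e ∈ n.divisors, mob e *
          EE ((e : ℝ) ^ 2 * j * ((d / Nat.gcd d j : ℕ) : ℝ) ^ 2 * (1 / T))
      - T / (d * Real.sqrt n) * ∑ j ∈ sq K, jj j n * ∑ e ∈ n.divisors, mob e *
          EE ((e : ℝ) ^ 2 * j * ((d / Nat.gcd d j : ℕ) : ℝ) ^ 2 * (T / (n * d ^ 2))) := by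
    simp only [Finset.mul_sum]
    rw [← Finset.sum_sub_distrib, ← Finset.sum_sub_distrib]
    refine Finset.sum_congr rfl fun j hj => ?_
    rw [← Finset.sum_sub_distrib, ← Finset.sum_sub_distrib]
    refine Finset.sum_congr rfl fun e he => ?_
    set q : ℝ := (e : ℝ) ^ 2 * j * ((d / Nat.gcd d j : ℕ) : ℝ) ^ 2 with hq
    have hj0 : j ≠ 0 := Squarefree.ne_zero (mem_filter.mp hj).2
    have hq0 : 0 ≤ q := by positivity
    have hm : cT / Real.sqrt (q * (1 / T)) = T / (d * Real.sqrt n) * (cT / Real.sqrt (q * (T / (n * d ^ 2)))) := by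
      rw [Real.sqrt_mul hq0, Real.sqrt_mul hq0, Real.sqrt_div zero_le_one, Real.sqrt_div hT.le,
        Real.sqrt_mul hnR.le, Real.sqrt_sq hdR.le, Real.sqrt_one]
      have hTs : Real.sqrt T * Real.sqrt T = T := Real.mul_self_sqrt hT.le
      have hT0 : Real.sqrt T ≠ 0 := (Real.sqrt_pos.mpr hT).ne'
      have hn0 : Real.sqrt n ≠ 0 := (Real.sqrt_pos.mpr hnR).ne'
      by_cases hz : Real.sqrt q = 0
      · simp [hz]
      · field_simp
        linear_combination cT * hTs
    simp only [EE]
    linear_combination (jj j n * mob e) * hm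
  linarith

end HB

namespace HB

open Classical in
lemma F_eq (K : ℕ) {g a b : ℕ} (hg : g ≠ 0) (ha : a ≠ 0) (hb : b ≠ 0) {y : ℝ} (hy : y ≠ 0) :
    ∑' m, (if inB K m then 0 else jj m (g * a) * jj m (g * b) * ff (m * y)) =
      ∑ d ∈ g.divisors, mob d * AN K d (a * b) y := by
  unfold AN
  simp_rw [← tsum_mul_left]
  rw [← Summable.tsum_finsetSum]
  · refine tsum_congr fun m => ?_
    split_ifs with h
    · simp
    · have h1 : jj m (g * a) * jj m (g * b) = jj m g ^ 2 * jj m (a * b) := by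
        rw [jj_mul_right m hg ha, jj_mul_right m hg hb, jj_mul_right m ha hb]; ring
      rw [h1, jj_sq m hg, ← mob_sum m hg, Finset.sum_mul, Finset.sum_mul]
      refine Finset.sum_congr rfl fun d _ => ?_
      unfold cf
      split_ifs <;> ring
  · intro d _
    apply Summable.mul_left
    refine Summable.of_norm_bounded (cf_summ d (a * b) hy).norm (fun m => ?_)
    split_ifs <;> simp

/-! large sieve statements -/
def osq (N : ℕ) : Finset ℕ := (Icc 1 N).filter (fun n => Odd n ∧ Squarefree n)

def LSs (P A : Finset ℕ) (B : ℝ) : Prop :=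
  ∀ a : ℕ → ℝ, ∑ m ∈ P, (∑ n ∈ A, a n * jj m n) ^ 2 ≤ B * ∑ n ∈ A, a n ^ 2

lemma mem_sq {K m : ℕ} : m ∈ sq K ↔ 1 ≤ m ∧ m ≤ K ∧ Squarefree m := by
  simp [sq, and_assoc]
lemma mem_osq {K m : ℕ} : m ∈ osq K ↔ 1 ≤ m ∧ m ≤ K ∧ Odd m ∧ Squarefree m := by
  simp [osq, and_assoc]
lemma sq_mono {K L : ℕ} (h : K ≤ L) : sq K ⊆ sq L := by
  intro m; simp only [mem_sq]; rintro ⟨a, b, c⟩; exact ⟨a, b.trans h, c⟩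
lemma osq_mono {K L : ℕ} (h : K ≤ L) : osq K ⊆ osq L := by
  intro m; simp only [mem_osq]; rintro ⟨a, b, c⟩; exact ⟨a, b.trans h, c⟩

lemma LSs.mono {P A P' A' : Finset ℕ} {B B' : ℝ} (h : LSs P A B) (hP : P' ⊆ P) (hA : A' ⊆ A) (hB : B ≤ B') :
    LSs P' A' B' := by
  intro a
  have h1 := h (fun n => if n ∈ A' then a n else 0)
  have e1 : ∀ m, ∑ n ∈ A, (if n ∈ A' then a n else 0) * jj m n = ∑ n ∈ A', a n * jj m n := by
    intro m
    simp only [ite_mul, zero_mul]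
    rw [← Finset.sum_filter]
    congr 1
    ext n; simp only [mem_filter]; exact ⟨fun h => h.2, fun h => ⟨hA h, h⟩⟩
  have e2 : ∑ n ∈ A, (if n ∈ A' then a n else 0) ^ 2 = ∑ n ∈ A', a n ^ 2 := by
    simp only [ite_pow]
    rw [show (0 : ℝ) ^ 2 = 0 by norm_num, ← Finset.sum_filter]
    congr 1
    ext n; simp only [mem_filter]; exact ⟨fun h => h.2, fun h => ⟨hA h, h⟩⟩
  simp only [e1, e2] at h1
  calc ∑ m ∈ P', (∑ n ∈ A', a n * jj m n) ^ 2 ≤ ∑ m ∈ P, (∑ n ∈ A', a n * jj m n) ^ 2 :=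
        Finset.sum_le_sum_of_subset_of_nonneg hP (fun _ _ _ => sq_nonneg _)
    _ ≤ _ := h1
    _ ≤ _ := by gcongr

lemma LSs.nonneg_of {P A : Finset ℕ} {B : ℝ} (h : LSs P A B) (hA : A.Nonempty) : 0 ≤ B := by
  have h1 := h (fun _ => 1)
  have h2 : (0 : ℝ) ≤ ∑ m ∈ P, (∑ n ∈ A, 1 * jj m n) ^ 2 := Finset.sum_nonneg fun _ _ => sq_nonneg _
  have h3 : (0 : ℝ) < ∑ n ∈ A, (1 : ℝ) ^ 2 := by simp [hA.card_pos]
  by_contra hB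
  push Not at hB
  nlinarith

lemma dual {P A : Finset ℕ} {B : ℝ} (hB : 0 ≤ B) (h : LSs P A B) (b : ℕ → ℝ) :
    ∑ n ∈ A, (∑ m ∈ P, b m * jj m n) ^ 2 ≤ B * ∑ m ∈ P, b m ^ 2 := by
  set X := ∑ n ∈ A, (∑ m ∈ P, b m * jj m n) ^ 2 with hX
  set c : ℕ → ℝ := fun n => ∑ m ∈ P, b m * jj m n with hc
  have h1 : X = ∑ m ∈ P, b m * ∑ n ∈ A, c n * jj m n := by
    calc X = ∑ n ∈ A, c n * ∑ m ∈ P, b m * jj m n := Finset.sum_congr rfl fun n _ => by rw [pow_two]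
      _ = ∑ n ∈ A, ∑ m ∈ P, b m * (c n * jj m n) := by
        refine Finset.sum_congr rfl fun n _ => ?_
        rw [Finset.mul_sum]; exact Finset.sum_congr rfl fun m _ => by ring
      _ = _ := by
        rw [Finset.sum_comm]; simp only [Finset.mul_sum]
  have h2 : X ^ 2 ≤ (∑ m ∈ P, b m ^ 2) * ∑ m ∈ P, (∑ n ∈ A, c n * jj m n) ^ 2 := by
    rw [h1]; exact Finset.sum_mul_sq_le_sq_mul_sq _ _ _
  have h3 := h c
  have h4 : ∑ n ∈ A, c n ^ 2 = X := rfl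
  rw [h4] at h3
  have hb : 0 ≤ ∑ m ∈ P, b m ^ 2 := Finset.sum_nonneg fun _ _ => sq_nonneg _
  have hX0 : 0 ≤ X := Finset.sum_nonneg fun _ _ => sq_nonneg _
  have h5 : X ^ 2 ≤ (∑ m ∈ P, b m ^ 2) * (B * X) := h2.trans (mul_le_mul_of_nonneg_left h3 hb)
  by_cases hz : X = 0
  · rw [hz]; positivity
  · have : 0 < X := lt_of_le_of_ne hX0 (Ne.symm hz)
    nlinarith

lemma LSs.partition {P A : Finset ℕ} {B : ℝ} {ι : Type*} [DecidableEq ι] (I : Finset ι) (col : ℕ → ι)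
    (hcol : ∀ n ∈ A, col n ∈ I) (h : ∀ i ∈ I, LSs P (A.filter (fun n => col n = i)) B) :
    LSs P A (I.card * B) := by
  intro a
  calc ∑ m ∈ P, (∑ n ∈ A, a n * jj m n) ^ 2
      = ∑ m ∈ P, (∑ i ∈ I, ∑ n ∈ A with col n = i, a n * jj m n) ^ 2 := by
        refine Finset.sum_congr rfl fun m _ => ?_
        rw [Finset.sum_fiberwise_of_maps_to hcol]
    _ ≤ ∑ m ∈ P, I.card * ∑ i ∈ I, (∑ n ∈ A with col n = i, a n * jj m n) ^ 2 :=
        Finset.sum_le_sum fun m _ => sq_sum_le_card_mul_sum_sq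
    _ = I.card * ∑ i ∈ I, ∑ m ∈ P, (∑ n ∈ A with col n = i, a n * jj m n) ^ 2 := by
        rw [← Finset.mul_sum, Finset.sum_comm]
    _ ≤ I.card * ∑ i ∈ I, B * ∑ n ∈ A with col n = i, a n ^ 2 := by
        gcongr with i hi
        exact h i hi a
    _ = I.card * B * ∑ n ∈ A, a n ^ 2 := by
        rw [← Finset.mul_sum, Finset.sum_fiberwise_of_maps_to hcol, mul_assoc]

def LS (M N : ℕ) (B : ℝ) : Prop := LSs (sq M) (osq N) B

lemma jj_recip {m n : ℕ} (hm : Odd m) (hn : Odd n) :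
    jj m n = (if m % 4 = 3 ∧ n % 4 = 3 then -1 else 1) * jj n m := by
  by_cases hc : Nat.Coprime m n
  · have h := recip hm hn hc
    have h2 := jj_sq n hm.pos.ne'
    rw [if_pos hc.symm] at h2
    have h' : jj n m * jj m n = (if m % 4 = 3 ∧ n % 4 = 3 then -1 else 1) := by
      unfold jj
      exact_mod_cast h
    rw [← h']
    linear_combination (- jj m n) * h2
  · have h2 := jj_sq n hm.pos.ne'
    have h1 := jj_sq m hn.pos.ne'
    rw [if_neg hc] at h1
    rw [if_neg (fun h => hc h.symm)] at h2
    rw [pow_eq_zero_iff (by norm_num)] at h1 h2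
    rw [h1, h2]; simp

lemma LS.recip {M N : ℕ} {B : ℝ} (hB : 0 ≤ B) (h : LS N M B) : LS M N (4 * B) := by
  intro a
  have hd : ∀ b : ℕ → ℝ, ∑ m ∈ osq M, (∑ n ∈ osq N, b n * jj n m) ^ 2 ≤ B * ∑ n ∈ osq N, b n ^ 2 := by
    have h' : LSs (osq N) (osq M) B := LSs.mono h (by
      intro n; simp only [mem_osq, mem_sq]; tauto) (subset_refl _) le_rfl
    exact dual hB h'
  set χ : ℕ → ℝ := fun n => if n % 4 = 3 then -1 else 1 with hχ
  have hχ2 : ∀ n, χ n ^ 2 = 1 := by intro n; simp only [hχ]; split_ifs <;> norm_num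
  -- odd part
  have hodd : ∀ a : ℕ → ℝ, ∑ m ∈ osq M, (∑ n ∈ osq N, a n * jj m n) ^ 2 ≤ 2 * B * ∑ n ∈ osq N, a n ^ 2 := by
    intro a
    have h1 := hd a
    have h2 := hd (fun n => a n * χ n)
    have e : ∑ n ∈ osq N, (a n * χ n) ^ 2 = ∑ n ∈ osq N, a n ^ 2 :=
      Finset.sum_congr rfl fun n _ => by rw [mul_pow, hχ2, mul_one]
    rw [e] at h2
    calc ∑ m ∈ osq M, (∑ n ∈ osq N, a n * jj m n) ^ 2
        ≤ ∑ m ∈ osq M, ((∑ n ∈ osq N, a n * jj n m) ^ 2 + (∑ n ∈ osq N, a n * χ n * jj n m) ^ 2) := by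
          refine Finset.sum_le_sum fun m hm => ?_
          by_cases hm4 : m % 4 = 3
          · have : ∑ n ∈ osq N, a n * jj m n = ∑ n ∈ osq N, a n * χ n * jj n m := by
              refine Finset.sum_congr rfl fun n hn => ?_
              rw [jj_recip (mem_osq.mp hm).2.2.1 (mem_osq.mp hn).2.2.1]
              simp only [hm4, true_and, hχ]
              ring
            rw [this]; nlinarith [sq_nonneg (∑ n ∈ osq N, a n * jj n m)]
          · have : ∑ n ∈ osq N, a n * jj m n = ∑ n ∈ osq N, a n * jj n m := by
              refine Finset.sum_congr rfl fun n hn => ?_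
              rw [jj_recip (mem_osq.mp hm).2.2.1 (mem_osq.mp hn).2.2.1]
              simp [hm4]
            rw [this]; nlinarith [sq_nonneg (∑ n ∈ osq N, a n * χ n * jj n m)]
      _ ≤ _ := by rw [Finset.sum_add_distrib]; linarith
  have hsub : sq M ⊆ osq M ∪ (osq M).image (fun m => 2 * m) := by
    intro m hm
    obtain ⟨h1, h2, h3⟩ := mem_sq.mp hm
    rw [mem_union, mem_image]
    rcases Nat.even_or_odd m with he | ho
    · right
      obtain ⟨k, hk⟩ := he.two_dvd
      subst hk
      refine ⟨k, mem_osq.mpr ⟨by omega, by omega, ?_, h3.of_mul_right⟩, rfl⟩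
      by_contra hk
      rw [Nat.not_odd_iff_even] at hk
      obtain ⟨l, rfl⟩ := hk.two_dvd
      have := h3 2 ⟨l, by ring⟩
      simp at this
    · left; exact mem_osq.mpr ⟨h1, h2, ho, h3⟩
  have hnn : ∀ m : ℕ, 0 ≤ (∑ n ∈ osq N, a n * jj m n) ^ 2 := fun _ => sq_nonneg _
  have h3 := hodd a
  have h4 := hodd (fun n => a n * jj 2 n)
  calc ∑ m ∈ sq M, (∑ n ∈ osq N, a n * jj m n) ^ 2
      ≤ ∑ m ∈ osq M ∪ (osq M).image (fun m => 2 * m), (∑ n ∈ osq N, a n * jj m n) ^ 2 :=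
        Finset.sum_le_sum_of_subset_of_nonneg hsub (fun _ _ _ => hnn _)
    _ ≤ ∑ m ∈ osq M, (∑ n ∈ osq N, a n * jj m n) ^ 2 + ∑ m ∈ (osq M).image (fun m => 2 * m), (∑ n ∈ osq N, a n * jj m n) ^ 2 := by
        rw [← Finset.sum_union_inter]
        have : 0 ≤ ∑ m ∈ osq M ∩ (osq M).image (fun m => 2 * m), (∑ n ∈ osq N, a n * jj m n) ^ 2 :=
          Finset.sum_nonneg fun _ _ => hnn _
        linarith
    _ = ∑ m ∈ osq M, (∑ n ∈ osq N, a n * jj m n) ^ 2 + ∑ m ∈ osq M, (∑ n ∈ osq N, a n * jj 2 n * jj m n) ^ 2 := by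
        rw [Finset.sum_image (fun x _ y _ hxy => by simpa using hxy)]
        simp only [jj_mul_left, mul_assoc]
    _ ≤ 2 * B * ∑ n ∈ osq N, a n ^ 2 + 2 * B * ∑ n ∈ osq N, a n ^ 2 := by
        refine add_le_add h3 (h4.trans ?_)
        refine mul_le_mul_of_nonneg_left (Finset.sum_le_sum fun n hn => ?_) (by positivity)
        rw [mul_pow]
        have := jj_abs 2 n
        have : jj 2 n ^ 2 ≤ 1 := by rw [← sq_abs]; exact pow_le_one₀ (abs_nonneg _) this
        exact mul_le_of_le_one_right (sq_nonneg _) this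
    _ = _ := by ring

end HB

namespace HB

section core
open Complex

lemma sum_div_mul {m n : ℕ} (h : Nat.Coprime m n) (f : ℕ → ℂ) :
    ∑ e ∈ (m * n).divisors, f e = ∑ e1 ∈ m.divisors, ∑ e2 ∈ n.divisors, f (e1 * e2) := by
  rw [Nat.divisors_mul, Finset.mul_def, Finset.sum_image h.mul_injOn_divisors, Finset.sum_product]

def Ez (z : ℂ) (x : ℝ) : ℂ := cexp (z * Real.log x)

lemma Ez_mul (z : ℂ) {x y : ℝ} (hx : x ≠ 0) (hy : y ≠ 0) : Ez z (x * y) = Ez z x * Ez z y := by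
  unfold Ez
  rw [Real.log_mul hx hy, ← Complex.exp_add]
  push_cast; ring_nf

lemma Ez_norm (z : ℂ) {x : ℝ} (hx : 0 < x) : ‖Ez z x‖ = x ^ z.re := by
  unfold Ez
  rw [Complex.norm_exp, Complex.re_mul_ofReal, Real.rpow_def_of_pos hx, mul_comm]

def psi (z : ℂ) (n : ℕ) : ℂ := ∑ e ∈ n.divisors, mob e * Ez z e ^ 2

lemma psi_norm {z : ℂ} (hz : z.re ≤ 0) (n : ℕ) : ‖psi z n‖ ≤ n.divisors.card := by
  unfold psi
  refine (norm_sum_le _ _).trans ?_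
  rw [Finset.card_eq_sum_ones]; push_cast
  refine Finset.sum_le_sum fun e he => ?_
  have he0 : 0 < e := Nat.pos_of_mem_divisors he
  have he1 : (1 : ℝ) ≤ e := by exact_mod_cast he0
  rw [norm_mul, norm_pow, Ez_norm z (by linarith)]
  have h1 : ‖(mob e : ℂ)‖ ≤ 1 := by rw [Complex.norm_real]; exact mob_abs e
  have h2 : (e : ℝ) ^ z.re ≤ 1 := Real.rpow_le_one_of_one_le_of_nonpos he1 hz
  have h3 : 0 ≤ (e : ℝ) ^ z.re := by positivity
  exact mul_le_one₀ h1 (by positivity) (pow_le_one₀ h3 h2)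

lemma psi_mul {z : ℂ} {m n : ℕ} (h : Nat.Coprime m n) :
    ∑ e ∈ (m * n).divisors, (mob e : ℂ) * Ez z e ^ 2 = psi z m * psi z n := by
  rw [sum_div_mul h, psi, psi, Finset.sum_mul_sum]
  refine Finset.sum_congr rfl fun e he => Finset.sum_congr rfl fun f hf => ?_
  have he0 : (e : ℝ) ≠ 0 := by exact_mod_cast (Nat.pos_of_mem_divisors he).ne'
  have hf0 : (f : ℝ) ≠ 0 := by exact_mod_cast (Nat.pos_of_mem_divisors hf).ne'
  have hc : Nat.Coprime e f := Nat.Coprime.coprime_dvd_left (Nat.dvd_of_mem_divisors he)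
    (Nat.Coprime.coprime_dvd_right (Nat.dvd_of_mem_divisors hf) h)
  have : mob (e * f) = mob e * mob f := by
    unfold mob
    rw [ArithmeticFunction.isMultiplicative_moebius.map_mul_of_coprime hc]; push_cast; rfl
  rw [this]; push_cast
  rw [Ez_mul z he0 hf0]; ring

def Bil (A Js : Finset ℕ) (b lam v ν : ℕ → ℝ) (E : ℝ → ℂ) : ℂ :=
  ∑ n1 ∈ A, ∑ n2 ∈ A, if Nat.Coprime n1 n2 then (b n1 : ℂ) * b n2 * ∑ j ∈ Js, lam j * jj j (n1 * n2) *
    ∑ e ∈ (n1 * n2).divisors, mob e * E ((e : ℝ) ^ 2 * v j * (ν n1 * ν n2)) else 0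

lemma cop_ind {m n N : ℕ} (hm : m ≠ 0) (hmN : m ≤ N) :
    (if Nat.Coprime m n then (1 : ℂ) else 0) = ∑ t ∈ Icc 1 N, (mob t : ℂ) * ((if t ∣ m then 1 else 0) * (if t ∣ n then 1 else 0)) := by
  have h := mob_sum n hm
  have h2 : (if Nat.Coprime m n then (1 : ℂ) else 0) = ((if Nat.Coprime n m then (1 : ℝ) else 0 : ℝ) : ℂ) := by
    by_cases hc : Nat.Coprime m n
    · rw [if_pos hc, if_pos hc.symm]; simp
    · rw [if_neg hc, if_neg (fun h => hc h.symm)]; simp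
  rw [h2, ← h]
  have h3 : m.divisors = (Icc 1 N).filter (· ∣ m) := by
    ext t; simp only [Nat.mem_divisors, mem_filter, mem_Icc]
    constructor
    · rintro ⟨h1, _⟩
      exact ⟨⟨Nat.pos_of_dvd_of_pos h1 (Nat.pos_of_ne_zero hm), (Nat.le_of_dvd (Nat.pos_of_ne_zero hm) h1).trans hmN⟩, h1⟩
    · rintro ⟨_, h⟩; exact ⟨h, hm⟩
  rw [h3, Finset.sum_filter]
  push_cast
  refine Finset.sum_congr rfl fun t _ => ?_
  split_ifs <;> simp

lemma core_tau {A Js : Finset ℕ} {b lam v ν : ℕ → ℝ} {z : ℂ} (hz : z.re ≤ 0) {Tm B : ℝ} (hB : 0 ≤ B)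
    (hA : ∀ n ∈ A, n ≠ 0) (hT : ∀ n ∈ A, (n.divisors.card : ℝ) ≤ Tm)
    (hlam : ∀ j ∈ Js, 0 ≤ lam j) (hv : ∀ j ∈ Js, 0 < v j) (hν : ∀ n ∈ A, 0 < ν n)
    (hLS : ∀ c : ℕ → ℂ, ∑ j ∈ Js, lam j * (v j) ^ z.re * ‖∑ n ∈ A, c n * jj j n‖ ^ 2 ≤ B * ∑ n ∈ A, ‖c n‖ ^ 2) :
    ‖Bil A Js b lam v ν (Ez z)‖ ≤ B * Tm ^ 3 * ∑ n ∈ A, b n ^ 2 * (ν n ^ z.re) ^ 2 := by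
  set β : ℕ → ℂ := fun n => b n * Ez z (ν n) * psi z n with hβ
  set N := A.sup id with hN
  have hAN : ∀ n ∈ A, n ≤ N := fun n hn => Finset.le_sup (f := id) hn
  have key : Bil A Js b lam v ν (Ez z) = ∑ t ∈ Icc 1 N, mob t * ∑ j ∈ Js, (lam j * Ez z (v j)) *
      (∑ n ∈ A, (if t ∣ n then β n else 0) * jj j n) ^ 2 := by
    have s1 : Bil A Js b lam v ν (Ez z) = ∑ n1 ∈ A, ∑ n2 ∈ A, ∑ t ∈ Icc 1 N, ∑ j ∈ Js,
        mob t * ((lam j * Ez z (v j)) * (((if t ∣ n1 then β n1 else 0) * jj j n1) * ((if t ∣ n2 then β n2 else 0) * jj j n2))) := by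
      unfold Bil
      refine Finset.sum_congr rfl fun n1 h1 => Finset.sum_congr rfl fun n2 h2 => ?_
      have e1 : ∀ P : ℂ, (if Nat.Coprime n1 n2 then P else 0) = (if Nat.Coprime n1 n2 then (1 : ℂ) else 0) * (if Nat.Coprime n1 n2 then P else 0) := by
        intro P; split_ifs <;> simp
      have e2 : (if Nat.Coprime n1 n2 then ((b n1 : ℂ) * b n2 * ∑ j ∈ Js, lam j * jj j (n1 * n2) *
          ∑ e ∈ (n1 * n2).divisors, mob e * Ez z ((e : ℝ) ^ 2 * v j * (ν n1 * ν n2))) else 0) =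
          (if Nat.Coprime n1 n2 then (1 : ℂ) else 0) * (∑ j ∈ Js, (lam j * Ez z (v j)) * ((β n1 * jj j n1) * (β n2 * jj j n2))) := by
        by_cases hc : Nat.Coprime n1 n2
        · rw [if_pos hc, if_pos hc, one_mul, Finset.mul_sum]
          refine Finset.sum_congr rfl fun j hj => ?_
          have e3 : ∑ e ∈ (n1 * n2).divisors, mob e * Ez z ((e : ℝ) ^ 2 * v j * (ν n1 * ν n2)) =
              (psi z n1 * psi z n2) * (Ez z (v j) * (Ez z (ν n1) * Ez z (ν n2))) := by
            rw [← psi_mul hc, Finset.sum_mul]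
            refine Finset.sum_congr rfl fun e he => ?_
            have he0 : (e : ℝ) ≠ 0 := by exact_mod_cast (Nat.pos_of_mem_divisors he).ne'
            rw [pow_two, Ez_mul z (mul_ne_zero (mul_ne_zero he0 he0) (hv j hj).ne') (mul_ne_zero (hν n1 h1).ne' (hν n2 h2).ne'),
              Ez_mul z (mul_ne_zero he0 he0) (hv j hj).ne', Ez_mul z he0 he0, Ez_mul z (hν n1 h1).ne' (hν n2 h2).ne']
            ring
          rw [e3, jj_mul_right j (hA _ h1) (hA _ h2)]
          simp only [hβ]; push_cast; ring
        · rw [if_neg hc, if_neg hc, zero_mul]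
      rw [e2, cop_ind (hA n1 h1) (hAN n1 h1), Finset.sum_mul]
      refine Finset.sum_congr rfl fun t _ => ?_
      rw [Finset.mul_sum]
      refine Finset.sum_congr rfl fun j _ => ?_
      split_ifs <;> ring
    rw [s1]
    simp_rw [pow_two (∑ n ∈ A, _ : ℂ), Finset.sum_mul_sum, Finset.mul_sum]
    calc _ = ∑ n1 ∈ A, ∑ t ∈ Icc 1 N, ∑ n2 ∈ A, ∑ j ∈ Js, _ := Finset.sum_congr rfl fun _ _ => Finset.sum_comm
      _ = ∑ t ∈ Icc 1 N, ∑ n1 ∈ A, ∑ n2 ∈ A, ∑ j ∈ Js, _ := Finset.sum_comm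
      _ = ∑ t ∈ Icc 1 N, ∑ n1 ∈ A, ∑ j ∈ Js, ∑ n2 ∈ A, _ :=
        Finset.sum_congr rfl fun _ _ => Finset.sum_congr rfl fun _ _ => Finset.sum_comm
      _ = _ := Finset.sum_congr rfl fun _ _ => Finset.sum_comm
  have hβn : ∀ n ∈ A, ‖β n‖ ^ 2 ≤ Tm ^ 2 * (b n ^ 2 * (ν n ^ z.re) ^ 2) := by
    intro n hn
    simp only [hβ]
    rw [norm_mul, norm_mul, Ez_norm z (hν n hn), Complex.norm_real, Real.norm_eq_abs, mul_pow, mul_pow, sq_abs, mul_comm]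
    have := (psi_norm hz n).trans (hT n hn)
    gcongr
  rw [key]
  calc ‖∑ t ∈ Icc 1 N, mob t * ∑ j ∈ Js, (lam j * Ez z (v j)) * (∑ n ∈ A, (if t ∣ n then β n else 0) * jj j n) ^ 2‖
      ≤ ∑ t ∈ Icc 1 N, B * ∑ n ∈ A, ‖(if t ∣ n then β n else 0)‖ ^ 2 := by
        refine (norm_sum_le _ _).trans (Finset.sum_le_sum fun t _ => ?_)
        rw [norm_mul]
        have h1 : ‖(mob t : ℂ)‖ ≤ 1 := by rw [Complex.norm_real]; exact mob_abs t
        refine (mul_le_of_le_one_left (norm_nonneg _) h1).trans ?_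
        refine (norm_sum_le _ _).trans (le_trans (Finset.sum_le_sum fun j hj => ?_) (hLS _))
        rw [norm_mul, norm_mul, norm_pow, Ez_norm z (hv j hj), Complex.norm_real, Real.norm_eq_abs, abs_of_nonneg (hlam j hj)]
    _ = B * ∑ n ∈ A, ‖β n‖ ^ 2 * ∑ t ∈ Icc 1 N, (if t ∣ n then 1 else 0) := by
        rw [← Finset.mul_sum, Finset.sum_comm]
        congr 1
        refine Finset.sum_congr rfl fun n _ => ?_
        rw [Finset.mul_sum]
        refine Finset.sum_congr rfl fun t _ => ?_
        split_ifs <;> simp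
    _ ≤ B * ∑ n ∈ A, (Tm ^ 2 * (b n ^ 2 * (ν n ^ z.re) ^ 2)) * Tm := by
        gcongr with n hn
        · exact hβn n hn
        · refine le_trans ?_ (hT n hn)
          rw [← Finset.sum_filter, Finset.sum_const, nsmul_eq_mul, mul_one]
          exact_mod_cast Finset.card_le_card (by
            intro t ht
            rw [mem_filter] at ht
            exact Nat.mem_divisors.mpr ⟨ht.2, hA n hn⟩)
    _ = _ := by
        rw [Finset.mul_sum, Finset.mul_sum]
        exact Finset.sum_congr rfl fun n _ => by ring

open MeasureTheory in
lemma core {A Js : Finset ℕ} {b lam v ν : ℕ → ℝ} {σ : ℝ} (hσ : 0 ≤ σ) {Tm B : ℝ} (hB : 0 ≤ B)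
    (hA : ∀ n ∈ A, n ≠ 0) (hT : ∀ n ∈ A, (n.divisors.card : ℝ) ≤ Tm)
    (hlam : ∀ j ∈ Js, 0 ≤ lam j) (hv : ∀ j ∈ Js, 0 < v j) (hν : ∀ n ∈ A, 0 < ν n)
    (hLS : ∀ c : ℕ → ℂ, ∑ j ∈ Js, lam j * (v j) ^ (-σ) * ‖∑ n ∈ A, c n * jj j n‖ ^ 2 ≤ B * ∑ n ∈ A, ‖c n‖ ^ 2)
    {φ : ℝ → ℂ} (hφ : Integrable φ) {E : ℝ → ℂ}
    (hE : ∀ x : ℝ, 0 < x → E x = ∫ τ, φ τ * cexp ((-σ + 2 * Real.pi * I * τ) * Real.log x)) :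
    ‖Bil A Js b lam v ν E‖ ≤ (∫ τ, ‖φ τ‖) * (B * Tm ^ 3 * ∑ n ∈ A, b n ^ 2 * (ν n ^ (-σ)) ^ 2) := by
  have hre : ∀ τ : ℝ, ((-σ + 2 * Real.pi * I * τ : ℂ)).re = -σ := by intro τ; simp
  have hint : ∀ x : ℝ, 0 < x → Integrable (fun τ : ℝ => φ τ * Ez (-σ + 2 * Real.pi * I * τ) x) := by
    intro x hx
    refine hφ.mul_bdd (c := x ^ (-σ)) ?_ ?_
    · apply Continuous.aestronglyMeasurable
      unfold Ez; fun_prop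
    · refine Filter.Eventually.of_forall fun τ => ?_
      rw [Ez_norm _ hx, hre]
  have key : Bil A Js b lam v ν E = ∫ τ : ℝ, φ τ * Bil A Js b lam v ν (Ez (-σ + 2 * Real.pi * I * τ)) := by
    have i1 : ∀ n1 ∈ A, ∀ n2 ∈ A, ∀ j ∈ Js, ∀ e ∈ (n1 * n2).divisors,
        Integrable (fun τ : ℝ => φ τ * Ez (-σ + 2 * Real.pi * I * τ) ((e : ℝ) ^ 2 * v j * (ν n1 * ν n2))) := by
      intro n1 h1 n2 h2 j hj e he
      apply hint
      have he0 : (0 : ℝ) < e := by exact_mod_cast (Nat.pos_of_mem_divisors he)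
      have := hv j hj; have := hν n1 h1; have := hν n2 h2
      positivity
    have e1 : ∀ τ : ℝ, φ τ * Bil A Js b lam v ν (Ez (-σ + 2 * Real.pi * I * τ)) =
        ∑ n1 ∈ A, ∑ n2 ∈ A, ∑ j ∈ Js, ∑ e ∈ (n1 * n2).divisors,
          (if Nat.Coprime n1 n2 then (b n1 : ℂ) * b n2 * (lam j * jj j (n1 * n2)) * mob e else 0) *
          (φ τ * Ez (-σ + 2 * Real.pi * I * τ) ((e : ℝ) ^ 2 * v j * (ν n1 * ν n2))) := by
      intro τ
      unfold Bil
      rw [Finset.mul_sum]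
      refine Finset.sum_congr rfl fun n1 _ => ?_
      rw [Finset.mul_sum]
      refine Finset.sum_congr rfl fun n2 _ => ?_
      split_ifs
      · simp only [Finset.mul_sum]
        refine Finset.sum_congr rfl fun j _ => Finset.sum_congr rfl fun e _ => by ring
      · simp
    simp_rw [e1]
    rw [integral_finsetSum]
    · unfold Bil
      refine Finset.sum_congr rfl fun n1 h1 => ?_
      rw [integral_finsetSum]
      · refine Finset.sum_congr rfl fun n2 h2 => ?_
        rw [integral_finsetSum]
        · have : ∀ j ∈ Js, (∫ τ : ℝ, ∑ e ∈ (n1 * n2).divisors,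
              (if Nat.Coprime n1 n2 then (b n1 : ℂ) * b n2 * (lam j * jj j (n1 * n2)) * mob e else 0) *
              (φ τ * Ez (-σ + 2 * Real.pi * I * τ) ((e : ℝ) ^ 2 * v j * (ν n1 * ν n2)))) =
              ∑ e ∈ (n1 * n2).divisors, (if Nat.Coprime n1 n2 then (b n1 : ℂ) * b n2 * (lam j * jj j (n1 * n2)) * mob e else 0) *
                E ((e : ℝ) ^ 2 * v j * (ν n1 * ν n2)) := by
            intro j hj
            rw [integral_finsetSum]
            · refine Finset.sum_congr rfl fun e he => ?_
              rw [integral_const_mul, hE]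
              · rfl
              · have he0 : (0 : ℝ) < e := by exact_mod_cast (Nat.pos_of_mem_divisors he)
                have := hv j hj; have := hν n1 h1; have := hν n2 h2
                positivity
            · intro e he
              exact (i1 n1 h1 n2 h2 j hj e he).const_mul _
          rw [Finset.sum_congr rfl this]
          split_ifs
          · simp only [Finset.mul_sum]
            refine Finset.sum_congr rfl fun j _ => Finset.sum_congr rfl fun e _ => by ring
          · simp
        · intro j hj
          exact integrable_finsetSum _ fun e he => (i1 n1 h1 n2 h2 j hj e he).const_mul _
      · intro n2 h2
        exact integrable_finsetSum _ fun j hj => integrable_finsetSum _ fun e he => (i1 n1 h1 n2 h2 j hj e he).const_mul _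
    · intro n1 h1
      exact integrable_finsetSum _ fun n2 h2 => integrable_finsetSum _ fun j hj => integrable_finsetSum _ fun e he => (i1 n1 h1 n2 h2 j hj e he).const_mul _
  rw [key, ← integral_mul_const]
  refine norm_integral_le_of_norm_le (hφ.norm.mul_const _) (Filter.Eventually.of_forall fun τ => ?_)
  rw [norm_mul]
  gcongr
  have h := core_tau (b := b) (z := (-σ + 2 * Real.pi * I * τ : ℂ)) (by rw [hre]; linarith) hB hA hT hlam hv hν (by rw [hre]; exact hLS)
  rwa [hre] at h

end core

lemma LSs.complex {P A : Finset ℕ} {B : ℝ} (h : LSs P A B) (c : ℕ → ℂ) :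
    ∑ m ∈ P, ‖∑ n ∈ A, c n * jj m n‖ ^ 2 ≤ B * ∑ n ∈ A, ‖c n‖ ^ 2 := by
  have h1 := h (fun n => (c n).re)
  have h2 := h (fun n => (c n).im)
  have e1 : ∀ z : ℂ, ‖z‖ ^ 2 = z.re ^ 2 + z.im ^ 2 := by
    intro z; rw [← Complex.normSq_eq_norm_sq, Complex.normSq_apply]; ring
  simp only [e1, Complex.re_sum, Complex.im_sum, Complex.re_mul_ofReal, Complex.im_mul_ofReal, Finset.sum_add_distrib]
  linarith

end HB

namespace HB

lemma lin_le {η : ℝ} (hη : 0 < η) : ∃ C : ℝ, 0 < C ∧ ∀ L : ℕ, (L + 1 : ℝ) ≤ C * ((2 : ℝ) ^ L) ^ η := by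
  set a := (2 : ℝ) ^ η - 1 with ha
  have ha0 : 0 < a := by
    have := Real.one_lt_rpow (x := 2) (by norm_num) hη
    linarith
  refine ⟨1 / a + 1, by positivity, fun L => ?_⟩
  have h1 : ((2 : ℝ) ^ L) ^ η = (1 + a) ^ L := by
    rw [ha, ← Real.rpow_natCast, ← Real.rpow_mul (by norm_num), mul_comm, Real.rpow_mul (by norm_num), Real.rpow_natCast]
    congr 1; ring
  have h2 := one_add_mul_le_pow (a := a) (by linarith) L
  rw [h1]
  have h3 : (1 / a + 1) * (1 + L * a) ≤ (1 / a + 1) * (1 + a) ^ L := by gcongr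
  refine le_trans ?_ h3
  have : (1 / a + 1) * (1 + L * a) = 1 / a + L + 1 + L * a := by field_simp; ring
  rw [this]
  have : 0 ≤ (L : ℝ) * a := by positivity
  have : 0 < 1 / a := by positivity
  linarith

lemma blk_aux {M N K ρ J J1 ξ : ℝ} (hM : 1 ≤ M) (hN : 1 ≤ N) (hρ : 1 ≤ ρ) (hJ : 1 ≤ J) (hJ1 : 1 ≤ J1)
    (hJJ : J1 ≤ 2 * J) (hJK : J1 ≤ K) (hK : N ^ 2 ≤ 2 * K * M) (hξ : 1 ≤ ξ) (hX : J * M * ρ ^ 2 / N ^ 2 ≤ 1) :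
    ρ * J1 ^ ξ ≤ 4 ^ ξ * K ^ ξ := by
  have hK1 : 1 ≤ K := hJ1.trans hJK
  rw [div_le_one (by positivity)] at hX
  have h1 : ρ * J1 ≤ 4 * K := by
    have h2 : J * ρ ^ 2 * M ≤ 2 * K * M := by nlinarith
    have h3 : J * ρ ^ 2 ≤ 2 * K := le_of_mul_le_mul_right h2 (by linarith)
    have h4 : J * ρ ≤ J * ρ ^ 2 := by
      have : ρ ≤ ρ ^ 2 := by nlinarith
      exact mul_le_mul_of_nonneg_left this (by linarith)
    nlinarith
  calc ρ * J1 ^ ξ ≤ ρ ^ ξ * J1 ^ ξ := by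
        gcongr
        exact Real.self_le_rpow_of_one_le hρ hξ
    _ = (ρ * J1) ^ ξ := by rw [Real.mul_rpow (by linarith) (by linarith)]
    _ ≤ (4 * K) ^ ξ := by gcongr
    _ = _ := by rw [Real.mul_rpow (by norm_num) (by linarith)]

lemma blk_aux2 {M N K ρ J J1 ξ : ℝ} (hM : 1 ≤ M) (hN : 1 ≤ N) (hρ : 1 ≤ ρ) (hJ : 1 ≤ J) (hJ1 : 1 ≤ J1)
    (hJJ : J1 ≤ 2 * J) (hJK : J1 ≤ K) (hK : N ^ 2 ≤ 2 * K * M) (hξ : 1 ≤ ξ) :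
    ρ * J1 ^ ξ * (J * M * ρ ^ 2 / N ^ 2) ^ (-(1 / 2 : ℝ)) ≤ 2 * K ^ ξ := by
  have hK1 : 1 ≤ K := hJ1.trans hJK
  have hX0 : 0 < J * M * ρ ^ 2 / N ^ 2 := by positivity
  rw [Real.rpow_neg hX0.le, ← Real.sqrt_eq_rpow, ← div_eq_mul_inv, div_le_iff₀ (Real.sqrt_pos.mpr hX0)]
  have e : Real.sqrt (J * M * ρ ^ 2 / N ^ 2) = Real.sqrt (J * M) * ρ / N := by
    rw [Real.sqrt_div (by positivity), Real.sqrt_mul (by positivity), Real.sqrt_sq (by linarith), Real.sqrt_sq (by linarith)]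
  rw [e]
  have h1 : J1 ^ ξ ≤ K ^ ξ * Real.sqrt (J1 / K) := by
    have : (J1 / K) ^ ξ ≤ (J1 / K) ^ (1 / 2 : ℝ) :=
      Real.rpow_le_rpow_of_exponent_ge (by positivity) ((div_le_one (by linarith)).mpr hJK) (by linarith)
    rw [Real.div_rpow (by linarith) (by linarith), div_le_iff₀ (by positivity), ← Real.sqrt_eq_rpow] at this
    linarith
  have h2 : N * Real.sqrt (J1 / K) ≤ 2 * Real.sqrt (J * M) := by
    have : N * Real.sqrt (J1 / K) = Real.sqrt (N ^ 2 * (J1 / K)) := by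
      rw [Real.sqrt_mul (by positivity), Real.sqrt_sq (by linarith)]
    rw [this]
    apply Real.sqrt_le_iff.mpr
    refine ⟨by positivity, ?_⟩
    rw [mul_pow, Real.sq_sqrt (by positivity), ← mul_div_assoc, div_le_iff₀ (by linarith)]
    calc N ^ 2 * J1 ≤ (2 * K * M) * (2 * J) := by gcongr
      _ = _ := by ring
  rw [← mul_div_assoc, le_div_iff₀ (by linarith)]
  calc ρ * J1 ^ ξ * N ≤ ρ * (K ^ ξ * Real.sqrt (J1 / K)) * N := by gcongr
    _ = ρ * K ^ ξ * (N * Real.sqrt (J1 / K)) := by ring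
    _ ≤ ρ * K ^ ξ * (2 * Real.sqrt (J * M)) := by gcongr
    _ = _ := by ring

lemma blk {M N K ρ d J J1 ξ η σ : ℝ} (hM : 1 ≤ M) (hN : 1 ≤ N) (hρ : 1 ≤ ρ) (hρN : ρ ≤ N) (hd : 1 ≤ d) (hJ : 1 ≤ J) (hJ1 : 1 ≤ J1)
    (hJJ : J1 ≤ 2 * J) (hJK : J1 ≤ K) (hJK' : J ≤ K) (hK : N ^ 2 ≤ 2 * K * M) (hK3 : K ≤ (M * N) ^ 3) (hξ : 1 ≤ ξ)
    (hη : 0 < η)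
    (hσ : σ = if J * M * ρ ^ 2 / N ^ 2 ≤ 1 then η else 1 / 2 - η) :
    (M / d + (M / N) * (ρ * J1 ^ ξ)) * (J * M * ρ ^ 2 / N ^ 2) ^ (-σ) ≤
      4 ^ ξ * (M * N) ^ (4 * η) * (M + (M / N) * K ^ ξ) := by
  have hK1 : 1 ≤ K := hJ1.trans hJK
  set X := J * M * ρ ^ 2 / N ^ 2 with hX
  have hX0 : 0 < X := by positivity
  have h4 : (4 : ℝ) ≤ 4 ^ ξ := Real.self_le_rpow_of_one_le (by norm_num) hξ
  have hMN : 1 ≤ M * N := by nlinarith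
  have e4 : (M * N) ^ (4 * η) = ((M * N) ^ 4) ^ η := by
    rw [Real.rpow_mul (by linarith)]; norm_cast
  have hMd : M / d ≤ M := div_le_self (by linarith) hd
  have hKξ : 0 ≤ (M / N) * K ^ ξ := by positivity
  have hW : 0 ≤ (M * N) ^ (4 * η) := by positivity
  by_cases hX1 : X ≤ 1
  · rw [if_pos hX1] at hσ
    subst hσ
    have h1 : X ^ (-σ) ≤ (M * N) ^ (4 * σ) := by
      rw [e4, Real.rpow_neg hX0.le, ← Real.inv_rpow hX0.le]
      apply Real.rpow_le_rpow (by positivity) _ hη.le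
      rw [hX, inv_div, div_le_iff₀ (by positivity)]
      calc N ^ 2 = N ^ 2 * (1 * 1 * 1 ^ 2) := by ring
        _ ≤ (M * N) ^ 4 * (J * M * ρ ^ 2) := by
          gcongr
          calc N ^ 2 ≤ N ^ 4 := pow_le_pow_right₀ hN (by norm_num)
            _ ≤ (M * N) ^ 4 := by gcongr; nlinarith
    have h2 := blk_aux hM hN hρ hJ hJ1 hJJ hJK hK hξ hX1
    calc (M / d + (M / N) * (ρ * J1 ^ ξ)) * X ^ (-σ) ≤ (4 ^ ξ * M + (M / N) * (4 ^ ξ * K ^ ξ)) * (M * N) ^ (4 * σ) := by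
          gcongr
          nlinarith
      _ = _ := by ring
  · rw [if_neg hX1] at hσ
    push Not at hX1
    have h1 : X ^ (-σ) = X ^ η * X ^ (-(1 / 2 : ℝ)) := by
      rw [← Real.rpow_add hX0, hσ]; ring_nf
    have h2 : X ^ η ≤ (M * N) ^ (4 * η) := by
      rw [e4]
      apply Real.rpow_le_rpow hX0.le _ hη.le
      rw [hX, div_le_iff₀ (by positivity)]
      calc J * M * ρ ^ 2 ≤ (M * N) ^ 3 * (M * N) * N ^ 2 := by
            gcongr
            · exact hJK'.trans hK3
            · nlinarith
        _ = _ := by ring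
    have h3 : X ^ (-(1 / 2 : ℝ)) ≤ 1 := Real.rpow_le_one_of_one_le_of_nonpos hX1.le (by norm_num)
    have h5 := blk_aux2 hM hN hρ hJ hJ1 hJJ hJK hK hξ
    rw [← hX] at h5
    rw [h1]
    calc (M / d + (M / N) * (ρ * J1 ^ ξ)) * (X ^ η * X ^ (-(1 / 2 : ℝ)))
        = X ^ η * (M / d * X ^ (-(1 / 2 : ℝ)) + (M / N) * (ρ * J1 ^ ξ * X ^ (-(1 / 2 : ℝ)))) := by ring
      _ ≤ (M * N) ^ (4 * η) * (M * 1 + (M / N) * (2 * K ^ ξ)) := by gcongr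
      _ ≤ (M * N) ^ (4 * η) * (4 ^ ξ * M + (M / N) * (4 ^ ξ * K ^ ξ)) := by
          refine mul_le_mul_of_nonneg_left (add_le_add (by nlinarith) ?_) hW
          gcongr
          linarith
      _ = _ := by ring

def w0 : ℝ → ℝ := exists_bump.choose
def Eb1 (v : ℝ) : ℝ := ∫ s, w0 s * EE (v * Real.exp (-s))
def Eb2 (v : ℝ) : ℝ := ∫ s, w0 s * (Real.exp s * EE (v * Real.exp s))

lemma Bil_T1 {σ : ℝ} (h0 : 0 < σ) (h1 : σ < 1 / 2) : ∃ C : ℝ, 0 ≤ C ∧ ∀ (M K N0 d : ℕ) (Tm B : ℝ) (b : ℕ → ℝ),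
    1 ≤ M → 1 ≤ d → 0 ≤ B → LS K N0 B → (∀ n ∈ osq N0, (n.divisors.card : ℝ) ≤ Tm) →
    ‖Bil (osq N0) (sq K) b (fun _ => 1) (fun j => (j : ℝ) * ((d / Nat.gcd d j : ℕ) : ℝ) ^ 2 / M) (fun _ => 1) (fun v => (Eb1 v : ℂ))‖
      ≤ C * (M : ℝ) ^ σ * B * Tm ^ 3 * ∑ n ∈ osq N0, b n ^ 2 := by
  obtain ⟨hw1, hw2, -⟩ := exists_bump.choose_spec
  obtain ⟨φ, hφ, hE⟩ := mellin_E hw1 hw2 h0 h1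
  refine ⟨∫ τ, ‖φ τ‖, MeasureTheory.integral_nonneg fun _ => norm_nonneg _, ?_⟩
  intro M K N0 d Tm B b hM hd hB hLS hT
  have hMR : (1 : ℝ) ≤ M := by exact_mod_cast hM
  have hv : ∀ j ∈ sq K, (1 : ℝ) / M ≤ (j : ℝ) * ((d / Nat.gcd d j : ℕ) : ℝ) ^ 2 / M := by
    intro j hj
    have hj1 : (1 : ℝ) ≤ j := by exact_mod_cast (mem_sq.mp hj).1
    have hr : 1 ≤ d / Nat.gcd d j := Nat.div_pos (Nat.gcd_le_left _ hd) (Nat.gcd_pos_of_pos_left _ hd)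
    have hr1 : (1 : ℝ) ≤ ((d / Nat.gcd d j : ℕ) : ℝ) := by exact_mod_cast hr
    gcongr
    nlinarith
  have := core (A := osq N0) (Js := sq K) (b := b) (lam := fun _ => 1)
    (v := fun j => (j : ℝ) * ((d / Nat.gcd d j : ℕ) : ℝ) ^ 2 / M) (ν := fun _ => 1) (σ := σ) h0.le (Tm := Tm)
    (B := (M : ℝ) ^ σ * B) (by positivity) (fun n hn => by have := (mem_osq.mp hn).1; omega) hT
    (fun _ _ => zero_le_one) (fun j hj => lt_of_lt_of_le (by positivity) (hv j hj)) (fun _ _ => one_pos) ?_ hφ (E := fun v => (Eb1 v : ℂ)) hE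
  · refine this.trans (le_of_eq ?_)
    simp only [Real.one_rpow, one_pow, mul_one]; ring
  · intro c
    have h := LSs.complex hLS c
    calc _ ≤ ∑ j ∈ sq K, (M : ℝ) ^ σ * ‖∑ n ∈ osq N0, c n * jj j n‖ ^ 2 := by
          refine Finset.sum_le_sum fun j hj => ?_
          rw [one_mul]
          gcongr
          calc _ ≤ ((1 : ℝ) / M) ^ (-σ) := Real.rpow_le_rpow_of_nonpos (by positivity) (hv j hj) (by linarith)
            _ = _ := by rw [one_div, Real.inv_rpow (by linarith), Real.rpow_neg (by linarith), inv_inv]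
      _ ≤ _ := by rw [← Finset.mul_sum, mul_assoc]; gcongr

end HB

namespace HB

lemma Bil_fiber {A Js : Finset ℕ} {b lam v ν : ℕ → ℝ} {E : ℝ → ℂ} (I : Finset ℕ) (col : ℕ → ℕ) (hcol : ∀ j ∈ Js, col j ∈ I) :
    Bil A Js b lam v ν E = ∑ i ∈ I, Bil A (Js.filter (fun j => col j = i)) b lam v ν E := by
  unfold Bil
  rw [Finset.sum_comm (s := I)]
  refine Finset.sum_congr rfl fun n1 _ => ?_
  rw [Finset.sum_comm (s := I)]
  refine Finset.sum_congr rfl fun n2 _ => ?_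
  split_ifs
  · rw [← Finset.mul_sum, Finset.sum_fiberwise_of_maps_to hcol]
  · simp

set_option maxHeartbeats 1600000 in
lemma Bil_T2 {η ξ : ℝ} (h0 : 0 < η) (h1 : η < 1 / 2) (hξ : 1 ≤ ξ) : ∃ C : ℝ, 0 ≤ C ∧ ∀ (M N K g d : ℕ) (Tm D : ℝ) (b : ℕ → ℝ),
    1 ≤ M → 1 ≤ g → g ≤ N → d ∣ g → 0 ≤ D → 0 ≤ Tm →
    N ^ 2 ≤ (K + 1) * M → K ≤ (M * N) ^ 3 →
    (∀ J, 1 ≤ J → J ≤ K → LS J (N / g) (D * ((N / g : ℕ) + (J : ℝ) ^ ξ))) →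
    (∀ n ∈ osq (N / g), (n.divisors.card : ℝ) ≤ Tm) → (∀ n, b n ≠ 0 → N ≤ 2 * (g * n)) →
    ‖Bil (osq (N / g)) (sq K) (fun n => b n / Real.sqrt n) (fun _ => (M : ℝ) / d)
      (fun j => (j : ℝ) * ((d / Nat.gcd d j : ℕ) : ℝ) ^ 2 * (M / (d : ℝ) ^ 2)) (fun n => (1 : ℝ) / n) (fun v => (Eb2 v : ℂ))‖
      ≤ C * ((M : ℝ) * N) ^ (7 * η) * D * Tm ^ 3 * (M + (M / N) * (K : ℝ) ^ ξ) * ∑ n ∈ osq (N / g), b n ^ 2 := by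
  obtain ⟨hw1, hw2, -⟩ := exists_bump.choose_spec
  have hch : ∃ C : ℝ, 0 ≤ C ∧ ∀ σ, (σ = η ∨ σ = 1 / 2 - η) → ∃ φ : ℝ → ℂ, MeasureTheory.Integrable φ ∧ (∫ τ, ‖φ τ‖) ≤ C ∧
      ∀ v : ℝ, 0 < v → (Eb2 v : ℂ) = ∫ τ, φ τ * Complex.exp ((-σ + 2 * Real.pi * Complex.I * τ) * Real.log v) := by
    obtain ⟨φ1, hφ1, hE1⟩ := mellin_E2 hw1 hw2 h0 h1
    obtain ⟨φ2, hφ2, hE2⟩ := mellin_E2 hw1 hw2 (σ := 1 / 2 - η) (by linarith) (by linarith)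
    refine ⟨max (∫ τ, ‖φ1 τ‖) (∫ τ, ‖φ2 τ‖), le_max_of_le_left (MeasureTheory.integral_nonneg fun _ => norm_nonneg _), ?_⟩
    rintro σ (rfl | rfl)
    · exact ⟨φ1, hφ1, le_max_left _ _, hE1⟩
    · exact ⟨φ2, hφ2, le_max_right _ _, hE2⟩
  obtain ⟨C0, hC0, hφs⟩ := hch
  obtain ⟨CL, hCL, hL⟩ := lin_le h0
  refine ⟨CL * (C0 * 2 * 4 ^ ξ), by positivity, ?_⟩
  intro M N K g d Tm D b hM hg hgN hdg hD hTm hKN hK3 hLS hT hb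
  have hd : 1 ≤ d := Nat.pos_of_dvd_of_pos hdg hg
  have hN : 1 ≤ N := hg.trans hgN
  have hMR : (1 : ℝ) ≤ M := by exact_mod_cast hM
  have hNR : (1 : ℝ) ≤ N := by exact_mod_cast hN
  have hgR : (1 : ℝ) ≤ g := by exact_mod_cast hg
  have hdR : (1 : ℝ) ≤ d := by exact_mod_cast hd
  have hMN : (1 : ℝ) ≤ M * N := by nlinarith
  set SS := ∑ n ∈ osq (N / g), b n ^ 2 with hSS
  have hSS0 : 0 ≤ SS := Finset.sum_nonneg fun _ _ => sq_nonneg _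
  rcases Nat.eq_zero_or_pos K with hK0 | hK1
  · have : sq K = ∅ := by
      rw [Finset.eq_empty_iff_forall_notMem]; intro j hj; have := mem_sq.mp hj; omega
    rw [this]
    simp only [Bil, Finset.sum_empty, mul_zero, ite_self, Finset.sum_const_zero, norm_zero]
    positivity
  have hKR : (1 : ℝ) ≤ K := by exact_mod_cast hK1
  have hKN' : (N : ℝ) ^ 2 ≤ 2 * K * M := by
    have : N ^ 2 ≤ 2 * K * M := hKN.trans (Nat.mul_le_mul_right _ (by omega))
    exact_mod_cast this
  have hK3' : (K : ℝ) ≤ (M * N) ^ 3 := by exact_mod_cast hK3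
  rw [Bil_fiber (range (Nat.log 2 K + 1)) (Nat.log 2) (fun j hj => by
    rw [Finset.mem_range]; have := Nat.log_mono_right (b := 2) (mem_sq.mp hj).2.1; omega)]
  have hblock : ∀ i ∈ range (Nat.log 2 K + 1), ‖Bil (osq (N / g)) ((sq K).filter (fun j => Nat.log 2 j = i)) (fun n => b n / Real.sqrt n) (fun _ => (M : ℝ) / d)
      (fun j => (j : ℝ) * ((d / Nat.gcd d j : ℕ) : ℝ) ^ 2 * (M / (d : ℝ) ^ 2)) (fun n => (1 : ℝ) / n) (fun v => (Eb2 v : ℂ))‖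
      ≤ (C0 * 2 * 4 ^ ξ) * ((M : ℝ) * N) ^ (4 * η) * D * Tm ^ 3 * (M + (M / N) * (K : ℝ) ^ ξ) * SS := by
    intro i hi
    have hi' : i ≤ Nat.log 2 K := by rw [Finset.mem_range] at hi; omega
    have hJK : 2 ^ i ≤ K := (Nat.pow_le_pow_right (by norm_num) hi').trans (Nat.pow_log_le_self 2 (by omega))
    set J : ℝ := 2 ^ i with hJ
    have hJ1 : 1 ≤ J := one_le_pow₀ (by norm_num)
    set J1 : ℕ := min (2 ^ (i + 1)) K with hJ1d
    have hJ11 : 1 ≤ J1 := le_min (Nat.one_le_two_pow) hK1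
    have hJ1R : (1 : ℝ) ≤ J1 := by exact_mod_cast hJ11
    have hJ1K : J1 ≤ K := min_le_right _ _
    have hJ12 : (J1 : ℝ) ≤ 2 * J := by
      have : J1 ≤ 2 ^ (i + 1) := min_le_left _ _
      have h2 : (J1 : ℝ) ≤ 2 ^ (i + 1) := by exact_mod_cast this
      rw [pow_succ] at h2; linarith
    set ρ : ℝ := (g : ℝ) / d with hρ
    have hρ1 : 1 ≤ ρ := by
      rw [hρ, le_div_iff₀ (by linarith), one_mul]; exact_mod_cast Nat.le_of_dvd hg hdg
    have hρN : ρ ≤ N := (div_le_self (by linarith) hdR).trans (by exact_mod_cast hgN)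
    set X : ℝ := J * M * ρ ^ 2 / N ^ 2 with hX
    set σ : ℝ := if X ≤ 1 then η else 1 / 2 - η with hσ
    have hσ2 : σ = η ∨ σ = 1 / 2 - η := by rw [hσ]; split_ifs <;> simp
    have hσ0 : 0 < σ := by rcases hσ2 with h | h <;> rw [h] <;> linarith
    obtain ⟨φ, hφ, hφC, hE⟩ := hφs σ hσ2
    have hbl := blk hMR hNR hρ1 hρN hdR hJ1 hJ1R hJ12 (by exact_mod_cast hJ1K) (by rw [hJ]; exact_mod_cast hJK) hKN' hK3' hξ h0 hσ
    have hN0 : ((N / g : ℕ) : ℝ) ≤ N / g := Nat.cast_div_le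
    have hLS1 := hLS J1 hJ11 hJ1K
    have hB0 : 0 ≤ D * ((N / g : ℕ) + (J1 : ℝ) ^ ξ) := by positivity
    have hJM : 0 < J * (M / (d : ℝ) ^ 2) := by positivity
    have hv : ∀ j ∈ (sq K).filter (fun j => Nat.log 2 j = i), J * (M / (d : ℝ) ^ 2) ≤ (j : ℝ) * ((d / Nat.gcd d j : ℕ) : ℝ) ^ 2 * (M / (d : ℝ) ^ 2) := by
      intro j hj
      rw [mem_filter] at hj
      have hj1 := (mem_sq.mp hj.1).1
      have hr : 1 ≤ d / Nat.gcd d j := Nat.div_pos (Nat.gcd_le_left _ hd) (Nat.gcd_pos_of_pos_left _ hd)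
      have hr1 : (1 : ℝ) ≤ ((d / Nat.gcd d j : ℕ) : ℝ) := by exact_mod_cast hr
      have hjJ : J ≤ j := by
        have := Nat.pow_log_le_self 2 (x := j) (by omega)
        rw [hj.2] at this
        rw [hJ]; exact_mod_cast this
      gcongr
      have : (1 : ℝ) ≤ ((d / Nat.gcd d j : ℕ) : ℝ) ^ 2 := one_le_pow₀ hr1
      nlinarith
    have hmain := core (A := osq (N / g)) (Js := (sq K).filter (fun j => Nat.log 2 j = i)) (b := fun n => b n / Real.sqrt n)
      (lam := fun _ => (M : ℝ) / d) (v := fun j => (j : ℝ) * ((d / Nat.gcd d j : ℕ) : ℝ) ^ 2 * (M / (d : ℝ) ^ 2))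
      (ν := fun n => (1 : ℝ) / n) (σ := σ) hσ0.le (Tm := Tm)
      (B := (M / d) * (J * (M / (d : ℝ) ^ 2)) ^ (-σ) * (D * ((N / g : ℕ) + (J1 : ℝ) ^ ξ))) (by positivity)
      (fun n hn => by have := (mem_osq.mp hn).1; omega) hT (fun _ _ => by positivity)
      (fun j hj => lt_of_lt_of_le hJM (hv j hj))
      (fun n hn => by
        have : (0 : ℝ) < n := by exact_mod_cast (mem_osq.mp hn).1
        positivity) ?_ hφ (E := fun v => (Eb2 v : ℂ)) hE
    · have hsum : ∑ n ∈ osq (N / g), (b n / Real.sqrt n) ^ 2 * (((1 : ℝ) / n) ^ (-σ)) ^ 2 ≤ (2 * g / N) * ((N / g : ℝ) ^ 2) ^ σ * SS := by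
        rw [hSS, Finset.mul_sum]
        refine Finset.sum_le_sum fun n hn => ?_
        have hn1 : (1 : ℝ) ≤ n := by exact_mod_cast (mem_osq.mp hn).1
        by_cases hbn : b n = 0
        · rw [hbn]; simp
        have hnb : (N : ℝ) ≤ 2 * (g * n) := by exact_mod_cast hb n hbn
        have hnN : (n : ℝ) ≤ N / g := le_trans (by exact_mod_cast (mem_osq.mp hn).2.1) hN0
        rw [div_pow, Real.sq_sqrt (by linarith)]
        have e1 : (((1 : ℝ) / n) ^ (-σ)) ^ 2 = ((n : ℝ) ^ 2) ^ σ := by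
          rw [one_div, Real.inv_rpow (by linarith), Real.rpow_neg (by linarith), inv_inv, ← Real.rpow_natCast, ← Real.rpow_natCast,
            ← Real.rpow_mul (by linarith), ← Real.rpow_mul (by linarith), mul_comm]
        rw [e1]
        have e2 : b n ^ 2 / n ≤ b n ^ 2 * (2 * g / N) := by
          rw [div_eq_mul_inv]
          gcongr
          rw [inv_eq_one_div, div_le_div_iff₀ (by linarith) (by linarith)]
          linarith
        calc b n ^ 2 / n * ((n : ℝ) ^ 2) ^ σ ≤ b n ^ 2 * (2 * g / N) * ((N / g : ℝ) ^ 2) ^ σ := by gcongr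
          _ = _ := by ring
      have hXe : (J * (M / (d : ℝ) ^ 2)) ^ (-σ) * ((N / g : ℝ) ^ 2) ^ σ = X ^ (-σ) := by
        have : ((N / g : ℝ) ^ 2) ^ σ = (((N / g : ℝ) ^ 2)⁻¹) ^ (-σ) := by
          rw [Real.inv_rpow (by positivity), Real.rpow_neg (by positivity), inv_inv]
        rw [this, ← Real.mul_rpow (by positivity) (by positivity)]
        congr 1
        rw [hX, hρ]; field_simp
      calc _ ≤ _ := hmain
        _ ≤ C0 * ((M / d) * (J * (M / (d : ℝ) ^ 2)) ^ (-σ) * (D * (N / g + (J1 : ℝ) ^ ξ)) * Tm ^ 3 * ((2 * g / N) * ((N / g : ℝ) ^ 2) ^ σ * SS)) := by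
          gcongr
        _ = C0 * D * Tm ^ 3 * SS * 2 * ((M / d + (M / N) * (ρ * (J1 : ℝ) ^ ξ)) * ((J * (M / (d : ℝ) ^ 2)) ^ (-σ) * ((N / g : ℝ) ^ 2) ^ σ)) := by
          rw [hρ]; field_simp
        _ ≤ C0 * D * Tm ^ 3 * SS * 2 * (4 ^ ξ * ((M : ℝ) * N) ^ (4 * η) * (M + (M / N) * (K : ℝ) ^ ξ)) := by
          rw [hXe]; gcongr
        _ = _ := by ring
    · intro c
      have h := LSs.complex (LSs.mono hLS1 (P' := (sq K).filter (fun j => Nat.log 2 j = i)) (by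
        intro j hj
        rw [mem_filter] at hj
        obtain ⟨a1, a2, a3⟩ := mem_sq.mp hj.1
        refine mem_sq.mpr ⟨a1, le_min ?_ a2, a3⟩
        rw [← hj.2]; exact (Nat.lt_pow_succ_log_self (by norm_num) j).le) (subset_refl _) le_rfl) c
      calc _ ≤ ∑ j ∈ (sq K).filter (fun j => Nat.log 2 j = i), (M / d) * (J * (M / (d : ℝ) ^ 2)) ^ (-σ) * ‖∑ n ∈ osq (N / g), c n * jj j n‖ ^ 2 := by
            refine Finset.sum_le_sum fun j hj => ?_
            gcongr ?_ * ?_ * ?_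
            exact Real.rpow_le_rpow_of_nonpos hJM (hv j hj) (by linarith)
        _ ≤ _ := by rw [← Finset.mul_sum, mul_assoc ((M : ℝ) / d * _)]; gcongr
  refine (norm_sum_le _ _).trans ((Finset.sum_le_sum hblock).trans ?_)
  rw [Finset.sum_const, Finset.card_range, nsmul_eq_mul]
  have hcard : ((Nat.log 2 K + 1 : ℕ) : ℝ) ≤ CL * ((M : ℝ) * N) ^ (3 * η) := by
    push_cast
    refine (hL _).trans ?_
    have e : ((M : ℝ) * N) ^ (3 * η) = (((M : ℝ) * N) ^ 3) ^ η := by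
      rw [Real.rpow_mul (by linarith)]; norm_cast
    rw [e]
    gcongr
    refine le_trans ?_ hK3'
    exact_mod_cast Nat.pow_log_le_self 2 (by omega)
  have e7 : ((M : ℝ) * N) ^ (7 * η) = ((M : ℝ) * N) ^ (3 * η) * ((M : ℝ) * N) ^ (4 * η) := by
    rw [← Real.rpow_add (by linarith)]; ring_nf
  rw [e7]
  calc _ ≤ CL * ((M : ℝ) * N) ^ (3 * η) * ((C0 * 2 * 4 ^ ξ) * ((M : ℝ) * N) ^ (4 * η) * D * Tm ^ 3 * (M + (M / N) * (K : ℝ) ^ ξ) * SS) := by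
        gcongr
    _ = _ := by ring

end HB

namespace HB

lemma w0_spec : ContDiff ℝ ((⊤ : ℕ∞) : WithTop ℕ∞) w0 ∧ HasCompactSupport w0 ∧ (∀ s, 0 ≤ w0 s) ∧
    (∀ s, w0 s ≠ 0 → s ∈ Set.Icc (0 : ℝ) 1) ∧ ∫ s, w0 s = 1 ∧ MeasureTheory.Integrable w0 := exists_bump.choose_spec

lemma w0_int1 {c : ℝ} (hc : 0 < c) : MeasureTheory.Integrable (fun s => w0 s * EE (c * Real.exp (-s))) := by
  have h := w0_spec.2.2.2.2.2
  refine h.mul_bdd (c := 1) ?_ ?_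
  · apply Measurable.aestronglyMeasurable
    have : (fun s => EE (c * Real.exp (-s))) = fun s => (fun t => EE (Real.exp t)) (Real.log c - s) := by
      ext s; simp only [sub_eq_add_neg, Real.exp_add, Real.exp_log hc]
    rw [this]
    exact EE_meas.comp (by fun_prop)
  · exact Filter.Eventually.of_forall fun s => EE_abs (by positivity)

lemma w0_int2 {c : ℝ} (hc : 0 < c) : MeasureTheory.Integrable (fun s => w0 s * (Real.exp s * EE (c * Real.exp s))) := by
  have h : MeasureTheory.Integrable (fun s => w0 s * Real.exp s) := by
    apply Continuous.integrable_of_hasCompactSupport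
    · exact w0_spec.1.continuous.mul Real.continuous_exp
    · exact w0_spec.2.1.mul_right
  have h2 := h.mul_bdd (c := 1) (g := fun s => EE (c * Real.exp s)) ?_ ?_
  · simpa only [mul_assoc] using h2
  · apply Measurable.aestronglyMeasurable
    have : (fun s => EE (c * Real.exp s)) = fun s => (fun t => EE (Real.exp t)) (Real.log c + s) := by
      ext s; simp only [Real.exp_add, Real.exp_log hc]
    rw [this]
    exact EE_meas.comp (by fun_prop)
  · exact Filter.Eventually.of_forall fun s => EE_abs (by positivity)

def BilR (A Js : Finset ℕ) (b lam v ν : ℕ → ℝ) (E : ℝ → ℝ) : ℝ :=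
  ∑ n1 ∈ A, ∑ n2 ∈ A, if Nat.Coprime n1 n2 then b n1 * b n2 * ∑ j ∈ Js, lam j * jj j (n1 * n2) *
    ∑ e ∈ (n1 * n2).divisors, mob e * E ((e : ℝ) ^ 2 * v j * (ν n1 * ν n2)) else 0

lemma BilR_cast (A Js : Finset ℕ) (b lam v ν : ℕ → ℝ) (E : ℝ → ℝ) :
    ((BilR A Js b lam v ν E : ℝ) : ℂ) = Bil A Js b lam v ν (fun x => (E x : ℂ)) := by
  unfold BilR Bil
  push_cast
  refine Finset.sum_congr rfl fun n1 _ => Finset.sum_congr rfl fun n2 _ => ?_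
  split_ifs
  · push_cast; rfl
  · rfl

lemma BilR_abs (A Js : Finset ℕ) (b lam v ν : ℕ → ℝ) (E : ℝ → ℝ) :
    |BilR A Js b lam v ν E| = ‖Bil A Js b lam v ν (fun x => (E x : ℂ))‖ := by
  rw [← BilR_cast, Complex.norm_real, Real.norm_eq_abs]

open MeasureTheory in
lemma BilR_int {A Js : Finset ℕ} {b lam v ν : ℕ → ℝ} (hv : ∀ j ∈ Js, 0 < v j) (hν : ∀ n ∈ A, 0 < ν n) {E : ℝ → ℝ → ℝ} 
    (hE : ∀ x, 0 < x → Integrable (fun s => w0 s * E s x)) :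
    Integrable (fun s => w0 s * BilR A Js b lam v ν (E s)) ∧
    ∫ s, w0 s * BilR A Js b lam v ν (E s) = BilR A Js b lam v ν (fun x => ∫ s, w0 s * E s x) := by
  have hpos : ∀ n1 ∈ A, ∀ n2 ∈ A, ∀ j ∈ Js, ∀ e ∈ (n1 * n2).divisors, 0 < (e : ℝ) ^ 2 * v j * (ν n1 * ν n2) := by
    intro n1 h1 n2 h2 j hj e he
    have he0 : (0 : ℝ) < e := by exact_mod_cast (Nat.pos_of_mem_divisors he)
    have := hv j hj; have := hν n1 h1; have := hν n2 h2
    positivity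
  have e1 : ∀ s : ℝ, w0 s * BilR A Js b lam v ν (E s) =
      ∑ n1 ∈ A, ∑ n2 ∈ A, ∑ j ∈ Js, ∑ e ∈ (n1 * n2).divisors,
        (if Nat.Coprime n1 n2 then b n1 * b n2 * (lam j * jj j (n1 * n2)) * mob e else 0) *
        (w0 s * E s ((e : ℝ) ^ 2 * v j * (ν n1 * ν n2))) := by
    intro τ
    unfold BilR
    rw [Finset.mul_sum]
    refine Finset.sum_congr rfl fun n1 _ => ?_
    rw [Finset.mul_sum]
    refine Finset.sum_congr rfl fun n2 _ => ?_
    split_ifs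
    · simp only [Finset.mul_sum]
      refine Finset.sum_congr rfl fun j _ => Finset.sum_congr rfl fun e _ => by ring
    · simp
  have i4 : ∀ n1 ∈ A, ∀ n2 ∈ A, ∀ j ∈ Js, ∀ e ∈ (n1 * n2).divisors, Integrable (fun s =>
        (if Nat.Coprime n1 n2 then b n1 * b n2 * (lam j * jj j (n1 * n2)) * mob e else 0) *
        (w0 s * E s ((e : ℝ) ^ 2 * v j * (ν n1 * ν n2)))) := fun n1 h1 n2 h2 j hj e he => (hE _ (hpos n1 h1 n2 h2 j hj e he)).const_mul _
  have i3 := fun n1 h1 n2 h2 j hj => integrable_finsetSum _ (i4 n1 h1 n2 h2 j hj)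
  have i2 := fun n1 h1 n2 h2 => integrable_finsetSum _ (i3 n1 h1 n2 h2)
  have i1 := fun n1 h1 => integrable_finsetSum _ (i2 n1 h1)
  simp_rw [e1]
  refine ⟨integrable_finsetSum _ i1, ?_⟩
  rw [integral_finsetSum _ i1]
  unfold BilR
  refine Finset.sum_congr rfl fun n1 h1 => ?_
  rw [integral_finsetSum _ (i2 n1 h1)]
  refine Finset.sum_congr rfl fun n2 h2 => ?_
  rw [integral_finsetSum _ (i3 n1 h1 n2 h2)]
  have : ∀ j ∈ Js, (∫ s, ∑ e ∈ (n1 * n2).divisors,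
        (if Nat.Coprime n1 n2 then b n1 * b n2 * (lam j * jj j (n1 * n2)) * mob e else 0) *
        (w0 s * E s ((e : ℝ) ^ 2 * v j * (ν n1 * ν n2)))) = ∑ e ∈ (n1 * n2).divisors,
        (if Nat.Coprime n1 n2 then b n1 * b n2 * (lam j * jj j (n1 * n2)) * mob e else 0) *
        ∫ s, w0 s * E s ((e : ℝ) ^ 2 * v j * (ν n1 * ν n2)) := by
    intro j hj
    rw [integral_finsetSum _ (i4 n1 h1 n2 h2 j hj)]
    exact Finset.sum_congr rfl fun e he => by rw [integral_const_mul]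
  rw [Finset.sum_congr rfl this]
  split_ifs
  · simp only [Finset.mul_sum]
    refine Finset.sum_congr rfl fun j _ => Finset.sum_congr rfl fun e _ => by ring
  · simp

/-- tail bound -/
lemma AN_tail {K d n : ℕ} {y y0 Z : ℝ} (hy0 : 0 < y0) (hy : y0 ≤ y) (hZ : 1 ≤ Z) (hK : Z ≤ (K + 1) * y0) :
    |AN K d n y| ≤ Real.exp (-Z / 2) * (1 + 2 / y0) := by
  classical
  set q := Real.exp (-y0 / 2) with hq
  have hq0 : 0 ≤ q := (Real.exp_pos _).le
  have hq1 : q < 1 := by rw [hq, Real.exp_lt_one_iff]; linarith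
  have hterm : ∀ m, ‖(if inB K m then 0 else cf d n y m)‖ ≤ Real.exp (-Z / 2) * q ^ m := by
    intro m
    split_ifs with h
    · simp; positivity
    · by_cases hm : m = 0
      · subst hm; rw [cf_zero]; simp; positivity
      have hmK : K + 1 ≤ m := by
        by_contra hlt
        push Not at hlt
        apply h
        obtain ⟨a, b, hab, ha⟩ := Nat.sq_mul_squarefree m
        refine ⟨a, mem_sq.mpr ⟨Nat.pos_of_ne_zero ha.ne_zero, ?_, ha⟩, b, by rw [← hab]; ring⟩
        have : a ≤ m := Nat.le_of_dvd (Nat.pos_of_ne_zero hm) ⟨b ^ 2, by rw [← hab]; ring⟩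
        omega
      have hmR : (K + 1 : ℝ) ≤ m := by exact_mod_cast hmK
      have h1 : Z ≤ m * y0 := hK.trans (by gcongr)
      have h2 : (m : ℝ) * y0 ≤ m * y := by gcongr
      have h3 : ‖cf d n y m‖ ≤ ff (m * y) := by
        unfold cf
        split_ifs
        · rw [norm_mul, Real.norm_eq_abs, Real.norm_eq_abs, abs_of_nonneg (ff_nonneg _)]
          exact mul_le_of_le_one_left (ff_nonneg _) (jj_abs _ _)
        · simpa using ff_nonneg _
      refine h3.trans ((ff_le _).trans ?_)
      rw [hq, ← Real.exp_nat_mul, ← Real.exp_add, Real.exp_le_exp]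
      have hpi := Real.pi_gt_three
      have h4 : 1 ≤ (m : ℝ) * y := by linarith
      have h5 : (m : ℝ) * y ≤ Real.pi * (m * y) ^ 2 := by nlinarith
      nlinarith
  have hs : Summable (fun m : ℕ => Real.exp (-Z / 2) * q ^ m) := (summable_geometric_of_lt_one hq0 hq1).mul_left _
  have h1 : ‖AN K d n y‖ ≤ ∑' m : ℕ, Real.exp (-Z / 2) * q ^ m := by
    unfold AN
    exact tsum_of_norm_bounded hs.hasSum hterm
  rw [Real.norm_eq_abs] at h1
  refine h1.trans ?_
  rw [tsum_mul_left, tsum_geometric_of_lt_one hq0 hq1]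
  gcongr
  have h2 : q * (1 + y0 / 2) ≤ 1 := by
    have := Real.add_one_le_exp (y0 / 2)
    have h3 : q * Real.exp (y0 / 2) = 1 := by rw [hq, ← Real.exp_add]; simp; ring
    nlinarith
  rw [inv_le_comm₀ (by linarith) (by positivity)]
  have : (1 + 2 / y0)⁻¹ = 1 - 1 / (1 + y0 / 2) := by field_simp; ring
  rw [this]
  have : q ≤ 1 / (1 + y0 / 2) := by rw [le_div_iff₀ (by positivity)]; exact h2
  linarith

open Classical in
lemma Q_le {M K : ℕ} {A : Finset ℕ} (a : ℕ → ℝ) {T : ℝ} (hT : (M : ℝ) ≤ T) (hT0 : 0 < T) :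
    ∑ m ∈ (sq M).filter (fun m => K < m), (∑ n ∈ A, a n * jj m n) ^ 2 ≤
      Real.exp Real.pi * ∑ n1 ∈ A, ∑ n2 ∈ A, a n1 * a n2 *
        ∑' m, (if inB K m then 0 else jj m n1 * jj m n2 * ff (m * (1 / T))) := by
  have hy : (1 / T : ℝ) ≠ 0 := by positivity
  have hs : ∀ n1 n2, Summable (fun m => if inB K m then 0 else jj m n1 * jj m n2 * ff (m * (1 / T))) := by
    intro n1 n2
    refine Summable.of_norm_bounded (ff_summ hy) (fun m => ?_)
    split_ifs
    · simpa using ff_nonneg _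
    · rw [norm_mul, norm_mul, Real.norm_eq_abs, Real.norm_eq_abs, Real.norm_eq_abs, abs_of_nonneg (ff_nonneg _)]
      exact mul_le_of_le_one_left (ff_nonneg _) (mul_le_one₀ (jj_abs _ _) (abs_nonneg _) (jj_abs _ _))
  have e : ∑ n1 ∈ A, ∑ n2 ∈ A, a n1 * a n2 * ∑' m, (if inB K m then 0 else jj m n1 * jj m n2 * ff (m * (1 / T))) =
      ∑' m, ∑ n1 ∈ A, ∑ n2 ∈ A, a n1 * a n2 * (if inB K m then 0 else jj m n1 * jj m n2 * ff (m * (1 / T))) := by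
    rw [Summable.tsum_finsetSum]
    · refine Finset.sum_congr rfl fun n1 _ => ?_
      rw [Summable.tsum_finsetSum]
      · exact Finset.sum_congr rfl fun n2 _ => by rw [tsum_mul_left]
      · intro n2 _; exact (hs n1 n2).mul_left _
    · intro n1 _; exact summable_sum fun n2 _ => (hs n1 n2).mul_left _
  have e2 : ∀ m, ∑ n1 ∈ A, ∑ n2 ∈ A, a n1 * a n2 * (if inB K m then 0 else jj m n1 * jj m n2 * ff (m * (1 / T))) =
      if inB K m then 0 else (∑ n ∈ A, a n * jj m n) ^ 2 * ff (m * (1 / T)) := by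
    intro m
    split_ifs
    · simp
    · rw [pow_two, Finset.sum_mul_sum, Finset.sum_mul]
      refine Finset.sum_congr rfl fun n1 _ => ?_
      rw [Finset.sum_mul]
      exact Finset.sum_congr rfl fun n2 _ => by ring
  have hsum : Summable (fun m => if inB K m then 0 else (∑ n ∈ A, a n * jj m n) ^ 2 * ff (m * (1 / T))) := by
    simp_rw [← e2]
    exact summable_sum fun n1 _ => summable_sum fun n2 _ => (hs n1 n2).mul_left _
  rw [e]
  simp_rw [e2]
  have h1 := hsum.sum_le_tsum ((sq M).filter (fun m => K < m)) (fun m _ => by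
    split_ifs
    · exact le_rfl
    · exact mul_nonneg (sq_nonneg _) (ff_nonneg _))
  refine le_trans ?_ (mul_le_mul_of_nonneg_left h1 (Real.exp_pos _).le)
  rw [Finset.mul_sum]
  refine Finset.sum_le_sum fun m hm => ?_
  rw [mem_filter] at hm
  obtain ⟨h2, h3, h4⟩ := mem_sq.mp hm.1
  rw [if_neg]
  · have hm1 : (1 : ℝ) ≤ m := by exact_mod_cast h2
    have hmM : (m : ℝ) ≤ M := by exact_mod_cast h3
    have hx : (m : ℝ) * (1 / T) ≤ 1 := by rw [mul_one_div, div_le_one hT0]; linarith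
    have hx0 : 0 < (m : ℝ) * (1 / T) := by positivity
    have h5 : 1 ≤ Real.exp Real.pi * ff (m * (1 / T)) := by
      rw [ff, if_neg hx0.ne', ← Real.exp_add]
      apply Real.one_le_exp
      have : ((m : ℝ) * (1 / T)) ^ 2 ≤ 1 := pow_le_one₀ hx0.le hx
      nlinarith [Real.pi_pos]
    nlinarith [sq_nonneg (∑ n ∈ A, a n * jj m n)]
  · rintro ⟨j, hj, l, rfl⟩
    have hl : IsUnit l := h4 l ⟨j, by ring⟩
    rw [Nat.isUnit_iff] at hl
    subst hl
    have := (mem_sq.mp hj).2.1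
    omega

lemma gcd_reorg {N : ℕ} {A : Finset ℕ} (hA : A ⊆ osq N) (f : ℕ → ℕ → ℝ) :
    ∑ n1 ∈ A, ∑ n2 ∈ A, f n1 n2 = ∑ g ∈ Icc 1 N, ∑ n1 ∈ osq (N / g), ∑ n2 ∈ osq (N / g),
      if Nat.Coprime n1 n2 then (if g * n1 ∈ A ∧ g * n2 ∈ A then f (g * n1) (g * n2) else 0) else 0 := by
  rw [← Finset.sum_product' A A f, ← Finset.sum_fiberwise_of_maps_to (t := Icc 1 N) (g := fun p : ℕ × ℕ => Nat.gcd p.1 p.2)]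
  · refine Finset.sum_congr rfl fun g hg => ?_
    have hg1 : 1 ≤ g := (mem_Icc.mp hg).1
    rw [← Finset.sum_product', ← Finset.sum_filter, ← Finset.sum_filter]
    refine Finset.sum_nbij' (fun p => (p.1 / g, p.2 / g)) (fun p => (g * p.1, g * p.2)) ?_ ?_ ?_ ?_ ?_
    · rintro ⟨p1, p2⟩ hp
      simp only [mem_filter, mem_product] at hp ⊢
      obtain ⟨⟨h1, h2⟩, h3⟩ := hp
      have d1 : g ∣ p1 := h3 ▸ Nat.gcd_dvd_left _ _
      have d2 : g ∣ p2 := h3 ▸ Nat.gcd_dvd_right _ _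
      have key : ∀ p, p ∈ A → g ∣ p → p / g ∈ osq (N / g) := by
        intro p hp hd
        obtain ⟨k, rfl⟩ := hd
        obtain ⟨a1, a2, a3, a4⟩ := mem_osq.mp (hA hp)
        rw [Nat.mul_div_cancel_left k hg1]
        refine mem_osq.mpr ⟨?_, ?_, Nat.Odd.of_mul_right a3, a4.of_mul_right⟩
        · rcases Nat.eq_zero_or_pos k with h | h
          · subst h; simp at a1
          · exact h
        · rw [Nat.le_div_iff_mul_le hg1, mul_comm]; exact a2
      refine ⟨⟨⟨key _ h1 d1, key _ h2 d2⟩, ?_⟩, ?_⟩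
      · rw [← h3]; exact Nat.coprime_div_gcd_div_gcd (by rw [h3]; exact hg1)
      · rw [Nat.mul_div_cancel' d1, Nat.mul_div_cancel' d2]; exact ⟨h1, h2⟩
    · rintro ⟨p1, p2⟩ hp
      simp only [mem_filter, mem_product] at hp ⊢
      obtain ⟨⟨_, h2⟩, h3⟩ := hp
      refine ⟨h3, ?_⟩
      rw [Nat.gcd_mul_left, h2, mul_one]
    · rintro ⟨p1, p2⟩ hp
      simp only [mem_filter, mem_product] at hp
      have d1 : g ∣ p1 := hp.2 ▸ Nat.gcd_dvd_left _ _
      have d2 : g ∣ p2 := hp.2 ▸ Nat.gcd_dvd_right _ _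
      simp only [Nat.mul_div_cancel' d1, Nat.mul_div_cancel' d2]
    · rintro ⟨p1, p2⟩ hp
      simp only [Nat.mul_div_cancel_left _ hg1]
    · rintro ⟨p1, p2⟩ hp
      simp only [mem_filter, mem_product] at hp
      have d1 : g ∣ p1 := hp.2 ▸ Nat.gcd_dvd_left _ _
      have d2 : g ∣ p2 := hp.2 ▸ Nat.gcd_dvd_right _ _
      simp only [Nat.mul_div_cancel' d1, Nat.mul_div_cancel' d2]
  · rintro ⟨p1, p2⟩ hp
    rw [mem_product] at hp
    obtain ⟨a1, a2, a3, a4⟩ := mem_osq.mp (hA hp.1)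
    exact mem_Icc.mpr ⟨Nat.gcd_pos_of_pos_left _ a1, (Nat.gcd_le_left _ a1).trans a2⟩

end HB

namespace HB

lemma exp_decay {ε : ℝ} (hε : 0 < ε) : ∃ C : ℝ, 0 ≤ C ∧ ∀ X : ℝ, 1 ≤ X → Real.exp (-(X ^ ε) / 2) * X ^ 3 ≤ C := by
  obtain ⟨k, hk⟩ := exists_nat_ge (3 / ε)
  refine ⟨k.factorial * 2 ^ k, by positivity, fun X hX => ?_⟩
  have hX0 : 0 < X := by linarith
  have h1 := Real.pow_div_factorial_le_exp (X ^ ε / 2) (by positivity) k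
  have h2 : X ^ 3 ≤ (X ^ ε) ^ k := by
    rw [← Real.rpow_natCast (X ^ ε), ← Real.rpow_mul hX0.le, ← Real.rpow_natCast X 3]
    apply Real.rpow_le_rpow_of_exponent_le hX
    rw [div_le_iff₀ hε] at hk
    push_cast; linarith
  have h3 : X ^ 3 ≤ k.factorial * 2 ^ k * Real.exp (X ^ ε / 2) := by
    refine h2.trans ?_
    rw [div_le_iff₀ (by positivity), div_pow, div_le_iff₀ (by positivity)] at h1
    linarith
  have h4 : Real.exp (-(X ^ ε) / 2) = (Real.exp (X ^ ε / 2))⁻¹ := by rw [← Real.exp_neg]; ring_nf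
  rw [h4, inv_mul_le_iff₀ (Real.exp_pos _)]
  linarith

lemma AN_pt {K d n M N : ℕ} (hM : 1 ≤ M) (hN : 1 ≤ N) (hd : Squarefree d) (hn : Odd n) (hs : Squarefree n) (hdn : Nat.Coprime d n)
    (hG : Gs n 1 = (Real.sqrt n : ℂ)) (hJ : jacobiSym (-1) n = 1) (hnd : n * d ^ 2 ≤ N ^ 2)
    {Z s : ℝ} (hZ : 1 ≤ Z) (hZK : Z ≤ (K + 1) * ((M : ℝ) / N ^ 2)) (h0 : 0 ≤ s) (h1 : s ≤ 1) :
    |AN K d n (1 / (M * Real.exp s)) + ∑ j ∈ sq K, jj j n * ∑ e ∈ n.divisors, mob e *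
          EE ((e : ℝ) ^ 2 * j * ((d / Nat.gcd d j : ℕ) : ℝ) ^ 2 * (1 / (M * Real.exp s)))
      - (M * Real.exp s) / (d * Real.sqrt n) * ∑ j ∈ sq K, jj j n * ∑ e ∈ n.divisors, mob e *
          EE ((e : ℝ) ^ 2 * j * ((d / Nat.gcd d j : ℕ) : ℝ) ^ 2 * ((M * Real.exp s) / (n * d ^ 2)))|
      ≤ (if n = 1 then 3 * (M : ℝ) else 0) + 3 * (Real.exp (-Z / 2) * (M + 2 * N ^ 2)) := by
  have hMR : (1 : ℝ) ≤ M := by exact_mod_cast hM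
  have hNR : (1 : ℝ) ≤ N := by exact_mod_cast hN
  have hd1 : (1 : ℝ) ≤ d := by exact_mod_cast Nat.pos_of_ne_zero hd.ne_zero
  have hn1 : (1 : ℝ) ≤ n := by exact_mod_cast hn.pos
  have hes : Real.exp s ≤ 3 := (Real.exp_le_exp.mpr h1).trans (by have := Real.exp_one_lt_d9; linarith)
  have hes1 : 1 ≤ Real.exp s := Real.one_le_exp h0
  set T := (M : ℝ) * Real.exp s with hT
  have hT0 : 0 < T := by positivity
  have hT3 : T ≤ 3 * M := by nlinarith
  have hTM : M ≤ T := by nlinarith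
  rw [AN_eq K hd hn hs hdn hG hJ hT0]
  have hndR : (n : ℝ) * d ^ 2 ≤ N ^ 2 := by exact_mod_cast hnd
  have htail := AN_tail (K := K) (d := d) (n := n) (y := T / (n * d ^ 2)) (y0 := M / N ^ 2) (Z := Z) (by positivity)
    (div_le_div₀ hT0.le hTM (by positivity) hndR) hZ hZK
  have hfac : T / (d * Real.sqrt n) ≤ 3 * M := by
    refine (div_le_self hT0.le ?_).trans hT3
    have : 1 ≤ Real.sqrt n := Real.one_le_sqrt.mpr hn1
    nlinarith
  have hι : |(if n = 1 then (T / d - 1) / 2 else 0)| ≤ (if n = 1 then 3 * (M : ℝ) else 0) := by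
    split_ifs
    · have h2 : T / d ≤ T := div_le_self hT0.le hd1
      have h3 : 0 < T / d := by positivity
      rw [abs_le]; constructor <;> linarith
    · simp
  have e : ∀ a b c d : ℝ, a + b - c + d + c - d = a + b := by intros; ring
  rw [e]
  refine (abs_add_le _ _).trans (add_le_add hι ?_)
  rw [abs_mul, abs_of_nonneg (by positivity : 0 ≤ T / (d * Real.sqrt n))]
  refine (mul_le_mul hfac htail (abs_nonneg _) (by positivity)).trans (le_of_eq ?_)
  field_simp

def bg (A : Finset ℕ) (a : ℕ → ℝ) (g n : ℕ) : ℝ := if g * n ∈ A then a (g * n) else 0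

def Y0 (K N M g d : ℕ) (b : ℕ → ℝ) (s : ℝ) : ℝ :=
  ∑ n1 ∈ osq (N / g), ∑ n2 ∈ osq (N / g), if Nat.Coprime n1 n2 then b n1 * b n2 * AN K d (n1 * n2) (1 / (M * Real.exp s)) else 0
def Y1 (K N M g d : ℕ) (b : ℕ → ℝ) (E : ℝ → ℝ) : ℝ :=
  BilR (osq (N / g)) (sq K) b (fun _ => 1) (fun j => (j : ℝ) * ((d / Nat.gcd d j : ℕ) : ℝ) ^ 2 / M) (fun _ => 1) E
def Y2 (K N M g d : ℕ) (b : ℕ → ℝ) (E : ℝ → ℝ) : ℝ :=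
  BilR (osq (N / g)) (sq K) (fun n => b n / Real.sqrt n) (fun _ => (M : ℝ) / d)
    (fun j => (j : ℝ) * ((d / Nat.gcd d j : ℕ) : ℝ) ^ 2 * (M / (d : ℝ) ^ 2)) (fun n => (1 : ℝ) / n) E

lemma Y_pt {K M N g d : ℕ} {A : Finset ℕ} {γ : ℂ} (a : ℕ → ℝ) (hM : 1 ≤ M) (hN : 1 ≤ N) (hA : A ⊆ osq N)
    (hγ : ∀ n ∈ A, Gs n 1 = γ * (Real.sqrt n : ℂ)) (hg : 1 ≤ g) (hdg : d ∣ g) (hd : Squarefree d)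
    {Z s : ℝ} (hZ : 1 ≤ Z) (hZK : Z ≤ (K + 1) * ((M : ℝ) / N ^ 2)) (h0 : 0 ≤ s) (h1 : s ≤ 1) :
    |Y0 K N M g d (bg A a g) s + Y1 K N M g d (bg A a g) (fun v => EE (v * Real.exp (-s)))
      - Y2 K N M g d (bg A a g) (fun v => Real.exp s * EE (v * Real.exp s))|
      ≤ (3 * M + 3 * (Real.exp (-Z / 2) * (M + 2 * N ^ 2)) * N) * ∑ n ∈ osq (N / g), bg A a g n ^ 2 := by
  have hMR : (1 : ℝ) ≤ M := by exact_mod_cast hM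
  have hNR : (1 : ℝ) ≤ N := by exact_mod_cast hN
  set R := 3 * (Real.exp (-Z / 2) * ((M : ℝ) + 2 * N ^ 2)) with hR
  have hR0 : 0 ≤ R := by positivity
  have hd1 : 1 ≤ d := Nat.pos_of_ne_zero hd.ne_zero
  have hdR : (1 : ℝ) ≤ d := by exact_mod_cast hd1
  have step1 : |Y0 K N M g d (bg A a g) s + Y1 K N M g d (bg A a g) (fun v => EE (v * Real.exp (-s)))
      - Y2 K N M g d (bg A a g) (fun v => Real.exp s * EE (v * Real.exp s))| ≤
      ∑ n1 ∈ osq (N / g), ∑ n2 ∈ osq (N / g), (|bg A a g n1| * |bg A a g n2| * ((if n1 = n2 then 3 * (M : ℝ) else 0) + R)) := by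
    unfold Y0 Y1 Y2 BilR
    rw [← Finset.sum_add_distrib, ← Finset.sum_sub_distrib]
    refine (Finset.abs_sum_le_sum_abs _ _).trans (Finset.sum_le_sum fun n1 hn1 => ?_)
    rw [← Finset.sum_add_distrib, ← Finset.sum_sub_distrib]
    refine (Finset.abs_sum_le_sum_abs _ _).trans (Finset.sum_le_sum fun n2 hn2 => ?_)
    have hnn : 0 ≤ |bg A a g n1| * |bg A a g n2| * ((if n1 = n2 then 3 * (M : ℝ) else 0) + R) := by
      split_ifs <;> positivity
    by_cases hc : Nat.Coprime n1 n2
    swap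
    · rw [if_neg hc, if_neg hc, if_neg hc]; simpa using hnn
    rw [if_pos hc, if_pos hc, if_pos hc]
    by_cases hA1 : g * n1 ∈ A
    swap
    · have : bg A a g n1 = 0 := if_neg hA1
      simp [this]
    by_cases hA2 : g * n2 ∈ A
    swap
    · have : bg A a g n2 = 0 := if_neg hA2
      simp [this]
    obtain ⟨-, hle1, ho1, hs1⟩ := mem_osq.mp (hA hA1)
    obtain ⟨-, hle2, ho2, hs2⟩ := mem_osq.mp (hA hA2)
    obtain ⟨hp1, -, hno1, hns1⟩ := mem_osq.mp hn1
    obtain ⟨hp2, -, hno2, hns2⟩ := mem_osq.mp hn2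
    obtain ⟨hG, hJ⟩ := Gs_class ho1 ho2 hs1 hs2 hc (hγ _ hA1) (hγ _ hA2)
    have hcg1 : Nat.Coprime g n1 := Nat.coprime_of_squarefree_mul hs1
    have hcg2 : Nat.Coprime g n2 := Nat.coprime_of_squarefree_mul hs2
    have hdn : Nat.Coprime d (n1 * n2) := (hcg1.mul_right hcg2).coprime_dvd_left hdg
    have hnd : n1 * n2 * d ^ 2 ≤ N ^ 2 := by
      have hdle : d ≤ g := Nat.le_of_dvd hg hdg
      calc n1 * n2 * d ^ 2 ≤ n1 * n2 * g ^ 2 := by gcongr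
        _ = (g * n1) * (g * n2) := by ring
        _ ≤ N * N := Nat.mul_le_mul hle1 hle2
        _ = N ^ 2 := by ring
    have hpt := AN_pt (K := K) hM hN hd (hno1.mul hno2) ((Nat.squarefree_mul hc).mpr ⟨hns1, hns2⟩) hdn hG hJ hnd hZ hZK h0 h1
    have hR1 : (0 : ℝ) < n1 := by exact_mod_cast hp1
    have hR2 : (0 : ℝ) < n2 := by exact_mod_cast hp2
    have hsq1 : 0 < Real.sqrt n1 := Real.sqrt_pos.mpr hR1
    have hsq2 : 0 < Real.sqrt n2 := Real.sqrt_pos.mpr hR2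
    have es : Real.sqrt ((n1 * n2 : ℕ) : ℝ) = Real.sqrt n1 * Real.sqrt n2 := by
      push_cast; rw [Real.sqrt_mul hR1.le]
    have key : bg A a g n1 * bg A a g n2 * AN K d (n1 * n2) (1 / (↑M * Real.exp s)) +
        bg A a g n1 * bg A a g n2 * ∑ j ∈ sq K, 1 * jj j (n1 * n2) * ∑ e ∈ (n1 * n2).divisors, mob e *
          EE ((e : ℝ) ^ 2 * ((j : ℝ) * ((d / Nat.gcd d j : ℕ) : ℝ) ^ 2 / M) * (1 * 1) * Real.exp (-s)) -
        bg A a g n1 / Real.sqrt n1 * (bg A a g n2 / Real.sqrt n2) * ∑ j ∈ sq K, (M : ℝ) / d * jj j (n1 * n2) * ∑ e ∈ (n1 * n2).divisors,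
          mob e * (Real.exp s * EE ((e : ℝ) ^ 2 * ((j : ℝ) * ((d / Nat.gcd d j : ℕ) : ℝ) ^ 2 * (M / (d : ℝ) ^ 2)) * (1 / (n1 : ℝ) * (1 / (n2 : ℝ))) * Real.exp s))
        = bg A a g n1 * bg A a g n2 * (AN K d (n1 * n2) (1 / (M * Real.exp s)) + ∑ j ∈ sq K, jj j (n1 * n2) * ∑ e ∈ (n1 * n2).divisors, mob e *
          EE ((e : ℝ) ^ 2 * j * ((d / Nat.gcd d j : ℕ) : ℝ) ^ 2 * (1 / (M * Real.exp s)))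
      - (M * Real.exp s) / (d * Real.sqrt ((n1 * n2 : ℕ) : ℝ)) * ∑ j ∈ sq K, jj j (n1 * n2) * ∑ e ∈ (n1 * n2).divisors, mob e *
          EE ((e : ℝ) ^ 2 * j * ((d / Nat.gcd d j : ℕ) : ℝ) ^ 2 * ((M * Real.exp s) / (((n1 * n2 : ℕ) : ℝ) * d ^ 2)))) := by
      rw [es]
      have a1 : ∀ j e : ℕ, (e : ℝ) ^ 2 * ((j : ℝ) * ((d / Nat.gcd d j : ℕ) : ℝ) ^ 2 / M) * (1 * 1) * Real.exp (-s) =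
          (e : ℝ) ^ 2 * j * ((d / Nat.gcd d j : ℕ) : ℝ) ^ 2 * (1 / (M * Real.exp s)) := by
        intro j e; rw [Real.exp_neg]; field_simp
      have a2 : ∀ j e : ℕ, (e : ℝ) ^ 2 * ((j : ℝ) * ((d / Nat.gcd d j : ℕ) : ℝ) ^ 2 * (M / (d : ℝ) ^ 2)) * (1 / (n1 : ℝ) * (1 / (n2 : ℝ))) * Real.exp s =
          (e : ℝ) ^ 2 * j * ((d / Nat.gcd d j : ℕ) : ℝ) ^ 2 * ((M * Real.exp s) / (((n1 * n2 : ℕ) : ℝ) * d ^ 2)) := by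
        intro j e; push_cast; field_simp
      simp_rw [a1, a2]
      have a3 : ∀ F : ℕ → ℕ → ℝ, ∑ j ∈ sq K, (M : ℝ) / d * jj j (n1 * n2) * ∑ e ∈ (n1 * n2).divisors, mob e * (Real.exp s * F j e) =
          (M * Real.exp s) / d * ∑ j ∈ sq K, jj j (n1 * n2) * ∑ e ∈ (n1 * n2).divisors, mob e * F j e := by
        intro F
        simp_rw [Finset.mul_sum]
        refine Finset.sum_congr rfl fun j _ => Finset.sum_congr rfl fun e _ => by ring
      rw [a3]
      simp_rw [one_mul]
      field_simp
    rw [key, abs_mul, abs_mul]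
    refine mul_le_mul_of_nonneg_left (hpt.trans ?_) (by positivity)
    refine add_le_add ?_ le_rfl
    split_ifs with u1 u2 u2
    · exact le_rfl
    · exact absurd ((Nat.eq_one_of_mul_eq_one_right u1).trans (Nat.eq_one_of_mul_eq_one_left u1).symm) u2
    · positivity
    · exact le_rfl
  refine step1.trans ?_
  have step2 : ∑ n1 ∈ osq (N / g), ∑ n2 ∈ osq (N / g), (|bg A a g n1| * |bg A a g n2| * ((if n1 = n2 then 3 * (M : ℝ) else 0) + R))
      = 3 * M * ∑ n ∈ osq (N / g), bg A a g n ^ 2 + R * (∑ n ∈ osq (N / g), |bg A a g n|) ^ 2 := by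
    rw [pow_two (∑ n ∈ osq (N / g), |bg A a g n|), Finset.sum_mul_sum, Finset.mul_sum, Finset.mul_sum, ← Finset.sum_add_distrib]
    refine Finset.sum_congr rfl fun n1 h1 => ?_
    rw [Finset.mul_sum]
    simp_rw [mul_add, Finset.sum_add_distrib, mul_ite, mul_zero]
    rw [Finset.sum_ite_eq, if_pos h1, ← abs_mul, abs_of_nonneg (mul_self_nonneg _)]
    congr 1
    · ring
    · refine Finset.sum_congr rfl fun n2 _ => by ring
  rw [step2, add_mul, mul_assoc R]
  refine add_le_add le_rfl (mul_le_mul_of_nonneg_left ?_ hR0)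
  refine (sq_sum_le_card_mul_sum_sq).trans ?_
  simp_rw [sq_abs]
  refine mul_le_mul_of_nonneg_right ?_ (Finset.sum_nonneg fun _ _ => sq_nonneg _)
  have : (osq (N / g)).card ≤ N := by
    refine (Finset.card_filter_le _ _).trans ?_
    simp only [Nat.card_Icc, Nat.add_sub_cancel]; exact Nat.div_le_self _ _
  exact_mod_cast this

lemma sum_bg {N : ℕ} {A : Finset ℕ} (hA : A ⊆ osq N) {a : ℕ → ℝ} {Tm : ℝ} 
    (hTm : ∀ n, 1 ≤ n → n ≤ N → (n.divisors.card : ℝ) ≤ Tm) :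
    ∑ g ∈ Icc 1 N, ∑ n ∈ osq (N / g), bg A a g n ^ 2 ≤ Tm * ∑ n ∈ A, a n ^ 2 := by
  have h1 : ∀ g ∈ Icc 1 N, ∑ n ∈ osq (N / g), bg A a g n ^ 2 ≤ ∑ m ∈ A, if g ∣ m then a m ^ 2 else 0 := by
    intro g hg
    have hg1 : 1 ≤ g := (mem_Icc.mp hg).1
    have e1 : ∑ n ∈ osq (N / g), bg A a g n ^ 2 = ∑ n ∈ (osq (N / g)).filter (fun n => g * n ∈ A), a (g * n) ^ 2 := by
      rw [Finset.sum_filter]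
      refine Finset.sum_congr rfl fun n _ => ?_
      unfold bg; split_ifs <;> simp
    rw [e1, ← Finset.sum_filter]
    have e2 : ∑ n ∈ (osq (N / g)).filter (fun n => g * n ∈ A), a (g * n) ^ 2 =
       ∑ m ∈ ((osq (N / g)).filter (fun n => g * n ∈ A)).image (fun n => g * n), a m ^ 2 := by
      rw [Finset.sum_image]
      intro x _ y _ h
      exact Nat.eq_of_mul_eq_mul_left hg1 h
    rw [e2]
    refine Finset.sum_le_sum_of_subset_of_nonneg ?_ (fun _ _ _ => sq_nonneg _)
    intro m hm
    obtain ⟨n, hn, rfl⟩ := Finset.mem_image.mp hm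
    exact Finset.mem_filter.mpr ⟨(Finset.mem_filter.mp hn).2, dvd_mul_right _ _⟩
  refine (Finset.sum_le_sum h1).trans ?_
  rw [Finset.sum_comm, Finset.mul_sum]
  refine Finset.sum_le_sum fun m hm => ?_
  obtain ⟨p1, p2, -, -⟩ := mem_osq.mp (hA hm)
  rw [← Finset.sum_filter, Finset.sum_const, nsmul_eq_mul]
  refine mul_le_mul_of_nonneg_right ?_ (sq_nonneg _)
  refine le_trans ?_ (hTm m p1 p2)
  have : (Icc 1 N).filter (· ∣ m) ⊆ m.divisors := by
    intro g hg
    rw [Nat.mem_divisors]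
    exact ⟨(Finset.mem_filter.mp hg).2, by omega⟩
  exact_mod_cast Finset.card_le_card this

end HB

namespace HB

open MeasureTheory in
lemma Y1_int (K N M g d : ℕ) (b : ℕ → ℝ) (hM : 1 ≤ M) (hd : 1 ≤ d) :
    Integrable (fun s => w0 s * Y1 K N M g d b (fun v => EE (v * Real.exp (-s)))) ∧
    ∫ s, w0 s * Y1 K N M g d b (fun v => EE (v * Real.exp (-s))) = Y1 K N M g d b Eb1 := by
  refine BilR_int (E := fun s v => EE (v * Real.exp (-s))) ?_ (fun _ _ => one_pos) (fun x hx => w0_int1 hx)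
  intro j hj
  have hj1 : (0 : ℝ) < j := by exact_mod_cast (mem_sq.mp hj).1
  have h2 : (0 : ℝ) < (d / Nat.gcd d j : ℕ) := by
    exact_mod_cast Nat.div_pos (Nat.gcd_le_left _ hd) (Nat.gcd_pos_of_pos_left _ hd)
  have hM' : (0 : ℝ) < M := by exact_mod_cast hM
  positivity

open MeasureTheory in
lemma Y2_int (K N M g d : ℕ) (b : ℕ → ℝ) (hM : 1 ≤ M) (hd : 1 ≤ d) :
    Integrable (fun s => w0 s * Y2 K N M g d b (fun v => Real.exp s * EE (v * Real.exp s))) ∧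
    ∫ s, w0 s * Y2 K N M g d b (fun v => Real.exp s * EE (v * Real.exp s)) = Y2 K N M g d b Eb2 := by
  refine BilR_int (E := fun s v => Real.exp s * EE (v * Real.exp s)) ?_ ?_ (fun x hx => w0_int2 hx)
  · intro j hj
    have hj1 : (0 : ℝ) < j := by exact_mod_cast (mem_sq.mp hj).1
    have h2 : (0 : ℝ) < (d / Nat.gcd d j : ℕ) := by
      exact_mod_cast Nat.div_pos (Nat.gcd_le_left _ hd) (Nat.gcd_pos_of_pos_left _ hd)
    have hM' : (0 : ℝ) < M := by exact_mod_cast hM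
    have hd' : (0 : ℝ) < d := by exact_mod_cast hd
    positivity
  · intro n hn
    have : (0 : ℝ) < n := by exact_mod_cast (mem_osq.mp hn).1
    positivity

open MeasureTheory in
lemma Q_int {K M N : ℕ} {A : Finset ℕ} {γ : ℂ} (a : ℕ → ℝ) (hM : 1 ≤ M) (hN : 1 ≤ N) (hA : A ⊆ osq N)
    (hγ : ∀ n ∈ A, Gs n 1 = γ * (Real.sqrt n : ℂ))
    {Z : ℝ} (hZ : 1 ≤ Z) (hZK : Z ≤ (K + 1) * ((M : ℝ) / N ^ 2)) {Tm R U1 U2 : ℝ} (hTm0 : 0 ≤ Tm)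
    (hTm : ∀ n, 1 ≤ n → n ≤ N → (n.divisors.card : ℝ) ≤ Tm)
    (hR : 3 * M + 3 * (Real.exp (-Z / 2) * (M + 2 * N ^ 2)) * N ≤ R) (h1 : 0 ≤ U1) (h2 : 0 ≤ U2)
    (hU1 : ∀ g ∈ Icc 1 N, ∀ d ∈ g.divisors, |Y1 K N M g d (bg A a g) Eb1| ≤ U1 * ∑ n ∈ osq (N / g), bg A a g n ^ 2)
    (hU2 : ∀ g ∈ Icc 1 N, ∀ d ∈ g.divisors, |Y2 K N M g d (bg A a g) Eb2| ≤ U2 * ∑ n ∈ osq (N / g), bg A a g n ^ 2) :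
    ∑ m ∈ (sq M).filter (fun m => K < m), (∑ n ∈ A, a n * jj m n) ^ 2 ≤
      Real.exp Real.pi * (Tm ^ 2 * (R + U1 + U2) * ∑ n ∈ A, a n ^ 2) := by
  classical
  have hMR : (1 : ℝ) ≤ M := by exact_mod_cast hM
  have hR0 : 0 ≤ R := le_trans (by positivity) hR
  set Sg : ℕ → ℝ := fun g => ∑ n ∈ osq (N / g), bg A a g n ^ 2 with hSg
  have hSg0 : ∀ g, 0 ≤ Sg g := fun g => Finset.sum_nonneg fun _ _ => sq_nonneg _
  set Q := ∑ m ∈ (sq M).filter (fun m => K < m), (∑ n ∈ A, a n * jj m n) ^ 2 with hQ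
  set G : ℕ → ℕ → ℝ → ℝ := fun g d s => mob d * (Y2 K N M g d (bg A a g) (fun v => Real.exp s * EE (v * Real.exp s))
    - Y1 K N M g d (bg A a g) (fun v => EE (v * Real.exp (-s)))) with hG
  have pw : ∀ s, 0 ≤ s → s ≤ 1 → Q ≤ Real.exp Real.pi * ∑ g ∈ Icc 1 N, ∑ d ∈ g.divisors, (G g d s + R * Sg g) := by
    intro s h0 h1
    have hT : (M : ℝ) ≤ M * Real.exp s := by have := Real.one_le_exp h0; nlinarith
    refine (Q_le (K := K) (A := A) a hT (by positivity)).trans ?_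
    refine mul_le_mul_of_nonneg_left ?_ (Real.exp_pos _).le
    rw [gcd_reorg hA]
    refine Finset.sum_le_sum fun g hg => ?_
    have hg1 := (mem_Icc.mp hg).1
    have e1 : (∑ n1 ∈ osq (N / g), ∑ n2 ∈ osq (N / g),
        if Nat.Coprime n1 n2 then (if g * n1 ∈ A ∧ g * n2 ∈ A then a (g * n1) * a (g * n2) *
          ∑' m, (if inB K m then 0 else jj m (g * n1) * jj m (g * n2) * ff (m * (1 / (M * Real.exp s)))) else 0) else 0) =
        ∑ d ∈ g.divisors, mob d * Y0 K N M g d (bg A a g) s := by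
      unfold Y0
      simp_rw [Finset.mul_sum]
      conv_rhs => rw [Finset.sum_comm]
      refine Finset.sum_congr rfl fun n1 hn1 => ?_
      conv_rhs => rw [Finset.sum_comm]
      refine Finset.sum_congr rfl fun n2 hn2 => ?_
      by_cases hc : Nat.Coprime n1 n2
      swap
      · simp_rw [if_neg hc]; simp
      simp_rw [if_pos hc]
      have hb : (if g * n1 ∈ A ∧ g * n2 ∈ A then a (g * n1) * a (g * n2) *
          ∑' m, (if inB K m then 0 else jj m (g * n1) * jj m (g * n2) * ff (m * (1 / (M * Real.exp s)))) else 0) =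
          bg A a g n1 * bg A a g n2 * ∑' m, (if inB K m then 0 else jj m (g * n1) * jj m (g * n2) * ff (m * (1 / (M * Real.exp s)))) := by
        unfold bg
        by_cases u1 : g * n1 ∈ A <;> by_cases u2 : g * n2 ∈ A <;> simp [u1, u2]
      rw [hb, F_eq K (by omega) (by have := (mem_osq.mp hn1).1; omega) (by have := (mem_osq.mp hn2).1; omega) (by positivity), Finset.mul_sum]
      refine Finset.sum_congr rfl fun d _ => by ring
    rw [e1]
    refine Finset.sum_le_sum fun d hd => ?_
    have hdg := Nat.dvd_of_mem_divisors hd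
    by_cases hsd : Squarefree d
    · have hp := Y_pt (K := K) (A := A) a hM hN hA hγ hg1 hdg hsd hZ hZK h0 h1
      have hp2 : |Y0 K N M g d (bg A a g) s + Y1 K N M g d (bg A a g) (fun v => EE (v * Real.exp (-s)))
          - Y2 K N M g d (bg A a g) (fun v => Real.exp s * EE (v * Real.exp s))| ≤ R * Sg g :=
        hp.trans (mul_le_mul_of_nonneg_right hR (hSg0 g))
      have hp3 : mob d * (Y0 K N M g d (bg A a g) s + Y1 K N M g d (bg A a g) (fun v => EE (v * Real.exp (-s)))
          - Y2 K N M g d (bg A a g) (fun v => Real.exp s * EE (v * Real.exp s))) ≤ R * Sg g := by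
        refine (le_abs_self _).trans ?_
        rw [abs_mul]
        exact (mul_le_of_le_one_left (abs_nonneg _) (mob_abs d)).trans hp2
      simp only [hG]
      linarith
    · have : mob d = 0 := by unfold mob; rw [ArithmeticFunction.moebius_eq_zero_of_not_squarefree hsd]; simp
      simp only [hG, this]
      have := mul_nonneg hR0 (hSg0 g)
      linarith
  have hd1 : ∀ g, ∀ d ∈ Nat.divisors g, 1 ≤ d := fun g d hd => Nat.pos_of_mem_divisors hd
  have iG : ∀ g, ∀ d ∈ g.divisors, Integrable (fun s => w0 s * G g d s) ∧ ∫ s, w0 s * G g d s =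
      mob d * (Y2 K N M g d (bg A a g) Eb2 - Y1 K N M g d (bg A a g) Eb1) := by
    intro g d hd
    have a1 := Y1_int K N M g d (bg A a g) hM (hd1 g d hd)
    have a2 := Y2_int K N M g d (bg A a g) hM (hd1 g d hd)
    have e : (fun s => w0 s * G g d s) = fun s => mob d * (w0 s * Y2 K N M g d (bg A a g) (fun v => Real.exp s * EE (v * Real.exp s))
        - w0 s * Y1 K N M g d (bg A a g) (fun v => EE (v * Real.exp (-s)))) := by
      ext s; simp only [hG]; ring
    rw [e]
    refine ⟨(a2.1.sub a1.1).const_mul _, ?_⟩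
    rw [integral_const_mul, integral_sub a2.1 a1.1, a1.2, a2.2]
  obtain ⟨-, -, hw0, hwI, hw1, hwi⟩ := w0_spec
  have i1 : ∀ g, ∀ d ∈ g.divisors, Integrable (fun s => w0 s * (G g d s + R * Sg g)) ∧ ∫ s, w0 s * (G g d s + R * Sg g) =
      mob d * (Y2 K N M g d (bg A a g) Eb2 - Y1 K N M g d (bg A a g) Eb1) + R * Sg g := by
    intro g d hd
    have e : (fun s => w0 s * (G g d s + R * Sg g)) = fun s => w0 s * G g d s + w0 s * (R * Sg g) := by ext s; ring
    rw [e]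
    refine ⟨(iG g d hd).1.add (hwi.mul_const _), ?_⟩
    rw [integral_add (iG g d hd).1 (hwi.mul_const _), (iG g d hd).2, integral_mul_const, hw1, one_mul]
  have eF : (fun s => w0 s * (Real.exp Real.pi * ∑ g ∈ Icc 1 N, ∑ d ∈ g.divisors, (G g d s + R * Sg g))) =
      fun s => Real.exp Real.pi * ∑ g ∈ Icc 1 N, ∑ d ∈ g.divisors, w0 s * (G g d s + R * Sg g) := by
    ext s
    rw [mul_left_comm, Finset.mul_sum]
    simp_rw [Finset.mul_sum]
  have iin : ∀ g ∈ Icc 1 N, Integrable (fun s => ∑ d ∈ g.divisors, w0 s * (G g d s + R * Sg g)) := fun g _ =>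
    integrable_finsetSum _ fun d hd => (i1 g d hd).1
  have iF : Integrable (fun s => w0 s * (Real.exp Real.pi * ∑ g ∈ Icc 1 N, ∑ d ∈ g.divisors, (G g d s + R * Sg g))) := by
    rw [eF]
    exact (integrable_finsetSum _ iin).const_mul _
  have vF : ∫ s, w0 s * (Real.exp Real.pi * ∑ g ∈ Icc 1 N, ∑ d ∈ g.divisors, (G g d s + R * Sg g)) =
      Real.exp Real.pi * ∑ g ∈ Icc 1 N, ∑ d ∈ g.divisors,
        (mob d * (Y2 K N M g d (bg A a g) Eb2 - Y1 K N M g d (bg A a g) Eb1) + R * Sg g) := by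
    rw [eF, integral_const_mul, integral_finsetSum _ iin]
    congr 1
    refine Finset.sum_congr rfl fun g _ => ?_
    rw [integral_finsetSum _ fun d hd => (i1 g d hd).1]
    exact Finset.sum_congr rfl fun d hd => (i1 g d hd).2
  have hQi : Q = ∫ s, w0 s * Q := by rw [integral_mul_const, hw1, one_mul]
  have hmain : Q ≤ Real.exp Real.pi * ∑ g ∈ Icc 1 N, ∑ d ∈ g.divisors,
        (mob d * (Y2 K N M g d (bg A a g) Eb2 - Y1 K N M g d (bg A a g) Eb1) + R * Sg g) := by
    rw [hQi, ← vF]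
    refine integral_mono (hwi.mul_const _) iF fun s => ?_
    by_cases hs : w0 s = 0
    · simp [hs]
    · have := hwI s hs
      exact mul_le_mul_of_nonneg_left (pw s this.1 this.2) (hw0 s)
  refine hmain.trans (mul_le_mul_of_nonneg_left ?_ (Real.exp_pos _).le)
  have hterm : ∀ g ∈ Icc 1 N, ∑ d ∈ g.divisors,
        (mob d * (Y2 K N M g d (bg A a g) Eb2 - Y1 K N M g d (bg A a g) Eb1) + R * Sg g) ≤ Tm * (R + U1 + U2) * Sg g := by
    intro g hg
    have : ∀ d ∈ g.divisors, mob d * (Y2 K N M g d (bg A a g) Eb2 - Y1 K N M g d (bg A a g) Eb1) + R * Sg g ≤ (R + U1 + U2) * Sg g := by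
      intro d hd
      have u1 := hU1 g hg d hd
      have u2 := hU2 g hg d hd
      have u3 : mob d * (Y2 K N M g d (bg A a g) Eb2 - Y1 K N M g d (bg A a g) Eb1) ≤ (U1 + U2) * Sg g := by
        refine (le_abs_self _).trans ?_
        rw [abs_mul]
        refine (mul_le_of_le_one_left (abs_nonneg _) (mob_abs d)).trans ((abs_sub _ _).trans ?_)
        rw [add_mul]; linarith
      nlinarith
    refine (Finset.sum_le_sum this).trans ?_
    rw [Finset.sum_const, nsmul_eq_mul, mul_assoc]
    obtain ⟨p1, p2⟩ := mem_Icc.mp hg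
    exact mul_le_mul_of_nonneg_right (hTm g p1 p2) (mul_nonneg (by positivity) (hSg0 g))
  refine (Finset.sum_le_sum hterm).trans ?_
  rw [← Finset.mul_sum]
  refine (mul_le_mul_of_nonneg_left (sum_bg hA hTm) (by positivity)).trans (le_of_eq (by ring))

lemma LS_zero (N : ℕ) {B : ℝ} (hB : 0 ≤ B) : LS 0 N B := by
  intro a
  have : sq 0 = ∅ := by simp [sq]
  rw [this]; simp
  exact mul_nonneg hB (Finset.sum_nonneg fun _ _ => sq_nonneg _)

set_option maxHeartbeats 1000000 in
theorem Rec {η ξ ε1 : ℝ} (h0 : 0 < η) (h1 : η < 1 / 2) (hξ : 1 ≤ ξ) (hε1 : 0 < ε1) : ∃ C : ℝ, 0 ≤ C ∧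
    ∀ (M N K : ℕ) (D Tm : ℝ) (A : Finset ℕ) (γ : ℂ), 1 ≤ M → 1 ≤ N → 0 ≤ D → 1 ≤ Tm → A ⊆ osq N →
    (∀ n ∈ A, Gs n 1 = γ * (Real.sqrt n : ℂ)) → (∀ n ∈ A, N ≤ 2 * n) →
    (N : ℝ) ^ 2 * ((M : ℝ) * N) ^ ε1 ≤ (K + 1) * M → K ≤ (M * N) ^ 3 →
    (∀ J N', 1 ≤ J → J ≤ K → N' ≤ N → LS J N' (D * (N' + (J : ℝ) ^ ξ))) →
    (∀ n, 1 ≤ n → n ≤ N → (n.divisors.card : ℝ) ≤ Tm) →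
    LSs (sq M) A (C * Tm ^ 5 * ((M : ℝ) * N) ^ (7 * η) * (M + D * (M + N + (1 + (M : ℝ) / N) * (K : ℝ) ^ ξ))) := by
  obtain ⟨C0, hC0, hexp⟩ := exp_decay hε1
  obtain ⟨C1, hC1, hT1⟩ := Bil_T1 h0 h1
  obtain ⟨C2, hC2, hT2⟩ := Bil_T2 h0 h1 hξ
  refine ⟨1 + Real.exp Real.pi * (3 + 9 * C0 + C1 + C2), by positivity, ?_⟩
  intro M N K D Tm A γ hM hN hD hTm1 hA hγ hA2 hK hK3 hLS hTm a
  have hMR : (1 : ℝ) ≤ M := by exact_mod_cast hM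
  have hNR : (1 : ℝ) ≤ N := by exact_mod_cast hN
  have hMN : (1 : ℝ) ≤ M * N := by nlinarith
  set X : ℝ := (M : ℝ) * N with hX
  set W : ℝ := X ^ (7 * η) with hW
  have hW1 : 1 ≤ W := Real.one_le_rpow hMN (by linarith)
  have hMW : (M : ℝ) ^ η ≤ W := by
    calc (M : ℝ) ^ η ≤ X ^ η := Real.rpow_le_rpow (by positivity) (by nlinarith) h0.le
      _ ≤ W := Real.rpow_le_rpow_of_exponent_le hMN (by linarith)
  set k : ℝ := (K : ℝ) ^ ξ with hk
  have hk0 : 0 ≤ k := by positivity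
  have hZ : (1 : ℝ) ≤ X ^ ε1 := Real.one_le_rpow hMN hε1.le
  have hZK : X ^ ε1 ≤ (K + 1) * ((M : ℝ) / N ^ 2) := by
    rw [← mul_div_assoc, le_div_iff₀ (by positivity)]; linarith
  have hLSK : ∀ N', N' ≤ N → LS K N' (D * (N + k)) := by
    intro N' hN'
    rcases Nat.eq_zero_or_pos K with h | h
    · have e : LS 0 N' (D * (N + k)) := LS_zero N' (by positivity)
      rwa [← h] at e
    · refine LSs.mono (hLS K N' h le_rfl hN') (Finset.Subset.refl _) (Finset.Subset.refl _) ?_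
      have : (N' : ℝ) ≤ N := by exact_mod_cast hN'
      exact mul_le_mul_of_nonneg_left (by linarith) hD
  have hN2 : N ^ 2 ≤ (K + 1) * M := by
    have : (N : ℝ) ^ 2 ≤ (K + 1) * M := by
      refine le_trans ?_ hK
      exact le_mul_of_one_le_right (by positivity) hZ
    exact_mod_cast this
  have hdivs : ∀ g, 1 ≤ g → ∀ n ∈ osq (N / g), (n.divisors.card : ℝ) ≤ Tm := by
    intro g hg n hn
    obtain ⟨p1, p2, -, -⟩ := mem_osq.mp hn
    exact hTm n p1 (p2.trans (Nat.div_le_self _ _))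
  have hQ := Q_int (K := K) (A := A) (Tm := Tm) (R := (3 + 9 * C0) * M) (U1 := C1 * (M : ℝ) ^ η * (D * (N + k)) * Tm ^ 3)
    (U2 := C2 * W * D * Tm ^ 3 * (M + (M / N) * k)) a hM hN hA hγ hZ hZK (by linarith) hTm ?_ (by positivity) (by positivity) ?_ ?_
  · have hsmall : ∑ m ∈ (sq M).filter (fun m => ¬ K < m), (∑ n ∈ A, a n * jj m n) ^ 2 ≤ D * (N + k) * ∑ n ∈ A, a n ^ 2 := by
      refine LSs.mono (hLSK N le_rfl) ?_ hA le_rfl a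
      intro m hm
      obtain ⟨h1, h2⟩ := Finset.mem_filter.mp hm
      obtain ⟨p1, -, p3⟩ := mem_sq.mp h1
      exact mem_sq.mpr ⟨p1, by omega, p3⟩
    rw [← Finset.sum_filter_add_sum_filter_not (sq M) (fun m => K < m)]
    refine (add_le_add hQ hsmall).trans ?_
    set S := ∑ n ∈ A, a n ^ 2 with hS
    have hS0 : 0 ≤ S := Finset.sum_nonneg fun _ _ => sq_nonneg _
    rw [← mul_assoc, ← add_mul]
    refine mul_le_mul_of_nonneg_right ?_ hS0
    have hTm0 : 0 ≤ Tm := by linarith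
    have hT5 : 1 ≤ Tm ^ 5 := one_le_pow₀ hTm1
    have hT2' : Tm ^ 2 ≤ Tm ^ 5 := pow_le_pow_right₀ hTm1 (by norm_num)
    set V : ℝ := M + D * (M + N + (1 + (M : ℝ) / N) * k) with hV
    have hMN0 : 0 ≤ (M : ℝ) / N := by positivity
    have hV1 : D * (N + k) ≤ V := by
      have : 0 ≤ D * (M + (M : ℝ) / N * k) := by positivity
      rw [hV]; nlinarith
    have hV2 : D * (M + (M : ℝ) / N * k) ≤ V := by
      have : 0 ≤ D * (N + k) := by positivity
      rw [hV]; nlinarith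
    have hV3 : (M : ℝ) ≤ V := by
      have : 0 ≤ D * (M + N + (1 + (M : ℝ) / N) * k) := by positivity
      rw [hV]; linarith
    have hV0 : 0 ≤ V := by linarith
    have hTW : 1 ≤ Tm ^ 5 * W := one_le_mul_of_one_le_of_one_le hT5 hW1
    have b1 : D * (N + k) ≤ Tm ^ 5 * W * V := hV1.trans (le_mul_of_one_le_left hV0 hTW)
    have b2 : Tm ^ 2 * M ≤ Tm ^ 5 * W * V :=
      mul_le_mul (hT2'.trans (le_mul_of_one_le_right (by positivity) hW1)) hV3 (by positivity) (by positivity)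
    have b3 : Tm ^ 5 * (M : ℝ) ^ η * (D * (N + k)) ≤ Tm ^ 5 * W * V :=
      mul_le_mul (mul_le_mul_of_nonneg_left hMW (by positivity)) hV1 (by positivity) (by positivity)
    have b4 : Tm ^ 5 * W * (D * (M + (M : ℝ) / N * k)) ≤ Tm ^ 5 * W * V := mul_le_mul_of_nonneg_left hV2 (by positivity)
    calc Real.exp Real.pi * (Tm ^ 2 * ((3 + 9 * C0) * M + C1 * (M : ℝ) ^ η * (D * (N + k)) * Tm ^ 3 + C2 * W * D * Tm ^ 3 * (M + M / N * k))) + D * (N + k)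
        = Real.exp Real.pi * ((3 + 9 * C0) * (Tm ^ 2 * M) + C1 * (Tm ^ 5 * (M : ℝ) ^ η * (D * (N + k))) +
            C2 * (Tm ^ 5 * W * (D * (M + (M : ℝ) / N * k)))) + D * (N + k) := by ring
      _ ≤ Real.exp Real.pi * ((3 + 9 * C0) * (Tm ^ 5 * W * V) + C1 * (Tm ^ 5 * W * V) + C2 * (Tm ^ 5 * W * V)) + Tm ^ 5 * W * V := by
          gcongr
      _ = _ := by ring
  · have hm3 := hexp X hMN
    have : ((M : ℝ) + 2 * N ^ 2) * N ≤ 3 * X ^ 3 := by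
      have c1 : (M : ℝ) * N ≤ X ^ 3 := le_self_pow₀ hMN (by norm_num)
      have c2 : (N : ℝ) ^ 3 ≤ X ^ 3 := pow_le_pow_left₀ (by positivity) (by nlinarith) 3
      nlinarith
    have e0 := (Real.exp_pos (-X ^ ε1 / 2)).le
    have c3 : Real.exp (-X ^ ε1 / 2) * (((M : ℝ) + 2 * N ^ 2) * N) ≤ 3 * C0 := by
      calc _ ≤ Real.exp (-X ^ ε1 / 2) * (3 * X ^ 3) := mul_le_mul_of_nonneg_left this e0
        _ = 3 * (Real.exp (-X ^ ε1 / 2) * X ^ 3) := by ring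
        _ ≤ _ := by linarith
    have c4 : C0 ≤ C0 * M := le_mul_of_one_le_right hC0 hMR
    have c5 : 3 * (Real.exp (-X ^ ε1 / 2) * ((M : ℝ) + 2 * N ^ 2)) * N = 3 * (Real.exp (-X ^ ε1 / 2) * (((M : ℝ) + 2 * N ^ 2) * N)) := by ring
    rw [c5]
    linarith
  · intro g hg d hd
    have hg1 := (mem_Icc.mp hg).1
    unfold Y1
    rw [BilR_abs]
    exact hT1 M K (N / g) d Tm (D * (N + k)) _ hM (Nat.pos_of_mem_divisors hd) (by positivity) (hLSK _ (Nat.div_le_self _ _)) (hdivs g hg1)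
  · intro g hg d hd
    obtain ⟨hg1, hg2⟩ := mem_Icc.mp hg
    unfold Y2
    rw [BilR_abs]
    refine hT2 M N K g d Tm D _ hM hg1 hg2 (Nat.dvd_of_mem_divisors hd) hD (by linarith) hN2 hK3
      (fun J a b => hLS J _ a b (Nat.div_le_self _ _)) (hdivs g hg1) ?_
    intro n hn
    unfold bg at hn
    by_cases hc : g * n ∈ A
    · exact hA2 _ hc
    · rw [if_neg hc] at hn; exact absurd rfl hn

end HB

namespace HB

lemma div_bound {ε : ℝ} (hε : 0 < ε) : ∃ C : ℝ, 1 ≤ C ∧ ∀ n : ℕ, 1 ≤ n → (n.divisors.card : ℝ) ≤ C * (n : ℝ) ^ ε := by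
  obtain ⟨C0, hC0, hlin⟩ := lin_le hε
  have hC1 : 1 ≤ C0 := by simpa using hlin 0
  obtain ⟨B, hB⟩ := exists_nat_ge ((2 : ℝ) ^ (1 / ε))
  refine ⟨C0 ^ B, one_le_pow₀ hC1, fun n hn => ?_⟩
  have hn0 : n ≠ 0 := by omega
  rw [Nat.card_divisors hn0]
  push_cast
  have hprod : (n : ℝ) ^ ε = ∏ p ∈ n.primeFactors, (((p : ℝ) ^ (n.factorization p)) ^ ε) := by
    rw [Real.finsetProd_rpow _ _ (fun _ _ => by positivity)]
    congr 1
    have := Nat.prod_factorization_pow_eq_self hn0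
    conv_lhs => rw [← this]
    rw [Finsupp.prod]
    push_cast
    rfl
  have hc : ∀ p ∈ n.primeFactors, ((n.factorization p : ℝ) + 1) ≤ (if p < B then C0 else 1) * (((p : ℝ) ^ (n.factorization p)) ^ ε) := by
    intro p hp
    have hp2 : (2 : ℝ) ≤ p := by exact_mod_cast (Nat.prime_of_mem_primeFactors hp).two_le
    set k := n.factorization p
    split_ifs with h
    · refine (hlin k).trans ?_
      gcongr
    · rw [one_mul]
      have h1 : (2 : ℝ) ≤ (p : ℝ) ^ ε := by
        have : (2 : ℝ) ^ (1 / ε) ≤ p := hB.trans (by exact_mod_cast not_lt.mp h)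
        calc (2 : ℝ) = ((2 : ℝ) ^ (1 / ε)) ^ ε := by rw [← Real.rpow_mul (by norm_num), one_div_mul_cancel hε.ne', Real.rpow_one]
          _ ≤ _ := Real.rpow_le_rpow (by positivity) this hε.le
      have h2 : ((p : ℝ) ^ k) ^ ε = ((p : ℝ) ^ ε) ^ k := by
        rw [← Real.rpow_natCast, ← Real.rpow_natCast, ← Real.rpow_mul (by positivity), ← Real.rpow_mul (by positivity), mul_comm]
      rw [h2]
      calc (k : ℝ) + 1 ≤ 2 ^ k := by
            have := Nat.lt_two_pow_self (n := k)
            exact_mod_cast this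
        _ ≤ _ := pow_le_pow_left₀ (by norm_num) h1 k
  refine (Finset.prod_le_prod (fun _ _ => by positivity) hc).trans ?_
  rw [Finset.prod_mul_distrib, ← hprod]
  refine mul_le_mul_of_nonneg_right ?_ (by positivity)
  rw [← Finset.prod_filter, Finset.prod_const]
  apply pow_le_pow_right₀ hC1
  have : n.primeFactors.filter (· < B) ⊆ range B := by
    intro p hp; simpa using (Finset.mem_filter.mp hp).2
  simpa using Finset.card_le_card this

lemma gam_four {n : ℕ} (ho : Odd n) (hs : Squarefree n) :
    Gs n 1 / (Real.sqrt n : ℂ) ∈ ({1, -1, Complex.I, -Complex.I} : Finset ℂ) := by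
  have h := (Gs_sqf ho hs).2
  have hn : (0 : ℝ) < n := by exact_mod_cast ho.pos
  have hs2 : (Real.sqrt n : ℂ) ^ 2 = n := by
    rw [← Complex.ofReal_pow, Real.sq_sqrt hn.le]; simp
  have hnC : (n : ℂ) ≠ 0 := by exact_mod_cast hn.ne'
  have h2 : (Gs n 1 / (Real.sqrt n : ℂ)) ^ 2 = jacobiSym (-1) n := by
    rw [div_pow, hs2, h]; field_simp
  have hj : jacobiSym (-1) n = 1 ∨ jacobiSym (-1) n = -1 := by
    apply jacobiSym.eq_one_or_neg_one; simp
  simp only [Finset.mem_insert, Finset.mem_singleton]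
  rcases hj with hj | hj
  · rw [hj] at h2
    have h3 : (Gs n 1 / (Real.sqrt n : ℂ)) ^ 2 = 1 ^ 2 := by rw [h2]; simp
    rcases sq_eq_sq_iff_eq_or_eq_neg.mp h3 with h | h <;> simp [h]
  · rw [hj] at h2
    have h3 : (Gs n 1 / (Real.sqrt n : ℂ)) ^ 2 = Complex.I ^ 2 := by rw [h2, Complex.I_sq]; simp
    rcases sq_eq_sq_iff_eq_or_eq_neg.mp h3 with h | h <;> simp [h]

lemma class_red {M N : ℕ} {B : ℝ} (hN : 1 ≤ N)
    (h : ∀ N0, 1 ≤ N0 → N0 ≤ N → ∀ (A : Finset ℕ) (γ : ℂ), A ⊆ osq N0 → (∀ n ∈ A, Gs n 1 = γ * (Real.sqrt n : ℂ)) →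
      (∀ n ∈ A, N0 ≤ 2 * n) → LSs (sq M) A B) (hB : 0 ≤ B) : LS M N (4 * (Nat.log 2 N + 1) * B) := by
  classical
  have key := LSs.partition (P := sq M) (A := osq N) (B := B) ((range (Nat.log 2 N + 1)) ×ˢ ({1, -1, Complex.I, -Complex.I} : Finset ℂ))
    (fun n => (Nat.log 2 n, Gs n 1 / (Real.sqrt n : ℂ))) ?_ ?_
  · refine LSs.mono key (Finset.Subset.refl _) (Finset.Subset.refl _) (mul_le_mul_of_nonneg_right ?_ hB)
    rw [Finset.card_product, Finset.card_range, mul_comm]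
    push_cast
    refine mul_le_mul_of_nonneg_right ?_ (by positivity)
    have : ({1, -1, Complex.I, -Complex.I} : Finset ℂ).card ≤ 4 := Finset.card_le_four
    exact_mod_cast this
  · intro n hn
    obtain ⟨p1, p2, p3, p4⟩ := mem_osq.mp hn
    refine Finset.mem_product.mpr ⟨?_, gam_four p3 p4⟩
    simp only [Finset.mem_range]
    have := Nat.log_mono_right (b := 2) p2
    omega
  · rintro ⟨i, γ⟩ -
    refine h (min N (2 ^ (i + 1))) (le_min hN (Nat.one_le_two_pow)) (min_le_left _ _) _ γ ?_ ?_ ?_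
    · intro n hn
      obtain ⟨hn1, hn2⟩ := Finset.mem_filter.mp hn
      obtain ⟨p1, p2, p3, p4⟩ := mem_osq.mp hn1
      obtain ⟨e1, e2⟩ := Prod.mk.inj hn2
      refine mem_osq.mpr ⟨p1, le_min p2 ?_, p3, p4⟩
      rw [← e1]; exact (Nat.lt_pow_succ_log_self (by norm_num) n).le
    · intro n hn
      obtain ⟨hn1, hn2⟩ := Finset.mem_filter.mp hn
      obtain ⟨p1, p2, p3, p4⟩ := mem_osq.mp hn1
      obtain ⟨e1, e2⟩ := Prod.mk.inj hn2
      have : (Real.sqrt n : ℂ) ≠ 0 := by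
        exact_mod_cast (Real.sqrt_pos.mpr (by exact_mod_cast p1 : (0 : ℝ) < n)).ne'
      rw [← e2]; field_simp
    · intro n hn
      obtain ⟨hn1, hn2⟩ := Finset.mem_filter.mp hn
      obtain ⟨p1, p2, p3, p4⟩ := mem_osq.mp hn1
      obtain ⟨e1, e2⟩ := Prod.mk.inj hn2
      refine (min_le_right _ _).trans ?_
      rw [pow_succ, mul_comm, ← e1]
      exact Nat.mul_le_mul_left 2 (Nat.pow_log_le_self 2 (by omega))

theorem Rec2 {ξ ε1 ε : ℝ} (hξ : 1 ≤ ξ) (hε1 : 0 < ε1) (hε : 0 < ε) : ∃ C : ℝ, 0 ≤ C ∧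
    ∀ (M N : ℕ) (D B : ℝ), 1 ≤ M → 1 ≤ N → 0 ≤ D → 0 ≤ B → 
    (∀ N0, 1 ≤ N0 → N0 ≤ N → ∃ K : ℕ, (N0 : ℝ) ^ 2 * ((M : ℝ) * N0) ^ ε1 ≤ (K + 1) * M ∧ K ≤ (M * N0) ^ 3 ∧
      (∀ J N', 1 ≤ J → J ≤ K → N' ≤ N0 → LS J N' (D * (N' + (J : ℝ) ^ ξ))) ∧
      M + D * (M + N0 + (1 + (M : ℝ) / N0) * (K : ℝ) ^ ξ) ≤ B) →
    LS M N (C * ((M : ℝ) * N) ^ ε * B) := by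
  set η := min (ε / 13) (1 / 4) with hη
  have hη0 : 0 < η := lt_min (by linarith) (by norm_num)
  have hη1 : η < 1 / 2 := lt_of_le_of_lt (min_le_right _ _) (by norm_num)
  have hηε : 13 * η ≤ ε := by have := min_le_left (ε / 13) (1 / 4); linarith
  obtain ⟨C, hC, hrec⟩ := Rec hη0 hη1 hξ hε1
  obtain ⟨Cd, hCd, hdiv⟩ := div_bound hη0
  obtain ⟨Cl, hCl, hlin⟩ := lin_le hη0
  refine ⟨4 * Cl * (C * Cd ^ 5), by positivity, ?_⟩
  intro M N D B hM hN hD hB hyp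
  have hMR : (1 : ℝ) ≤ M := by exact_mod_cast hM
  have hNR : (1 : ℝ) ≤ N := by exact_mod_cast hN
  set X : ℝ := (M : ℝ) * N with hX
  have hX1 : 1 ≤ X := by nlinarith
  have hX0 : 0 < X := by linarith
  have hNX : (N : ℝ) ≤ X := by nlinarith
  have hNη : (N : ℝ) ^ η ≤ X ^ η := Real.rpow_le_rpow (by positivity) hNX hη0.le
  have h1 : LS M N (4 * (Nat.log 2 N + 1) * (C * (Cd * X ^ η) ^ 5 * X ^ (7 * η) * B)) := by
    refine class_red hN ?_ (by positivity)
    intro N0 hN0 hN0N A γ hA hγ hA2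
    obtain ⟨K, hK1, hK2, hK3, hK4⟩ := hyp N0 hN0 hN0N
    have hN0R : (N0 : ℝ) ≤ N := by exact_mod_cast hN0N
    have hTm1 : 1 ≤ Cd * X ^ η := one_le_mul_of_one_le_of_one_le hCd (Real.one_le_rpow hX1 hη0.le)
    have := hrec M N0 K D (Cd * X ^ η) A γ hM hN0 hD hTm1 hA hγ hA2 hK1 hK2 hK3 ?_
    · refine LSs.mono this (Finset.Subset.refl _) (Finset.Subset.refl _) ?_
      have hm : ((M : ℝ) * N0) ^ (7 * η) ≤ X ^ (7 * η) := Real.rpow_le_rpow (by positivity) (by rw [hX]; gcongr) (by linarith)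
      gcongr
    · intro n hn1 hn2
      refine (hdiv n hn1).trans (mul_le_mul_of_nonneg_left ?_ (by linarith))
      refine Real.rpow_le_rpow (by positivity) ?_ hη0.le
      have : (n : ℝ) ≤ N0 := by exact_mod_cast hn2
      linarith
  refine LSs.mono h1 (Finset.Subset.refl _) (Finset.Subset.refl _) ?_
  have hlog : ((Nat.log 2 N : ℝ) + 1) ≤ Cl * X ^ η := by
    refine (hlin (Nat.log 2 N)).trans (mul_le_mul_of_nonneg_left (le_trans ?_ hNη) hCl.le)
    refine Real.rpow_le_rpow (by positivity) ?_ hη0.le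
    exact_mod_cast Nat.pow_log_le_self 2 (by omega)
  have hpow : X ^ η * (X ^ η) ^ 5 * X ^ (7 * η) ≤ X ^ ε := by
    rw [← Real.rpow_natCast, ← Real.rpow_mul hX0.le, ← Real.rpow_add hX0, ← Real.rpow_add hX0]
    apply Real.rpow_le_rpow_of_exponent_le hX1
    push_cast; linarith
  calc 4 * ((Nat.log 2 N : ℝ) + 1) * (C * (Cd * X ^ η) ^ 5 * X ^ (7 * η) * B) ≤ 4 * (Cl * X ^ η) * (C * (Cd * X ^ η) ^ 5 * X ^ (7 * η) * B) := by
        gcongr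
    _ = 4 * Cl * (C * Cd ^ 5) * (X ^ η * (X ^ η) ^ 5 * X ^ (7 * η)) * B := by ring
    _ ≤ _ := by gcongr

end HB

namespace HB

def Hh (ξ : ℝ) : Prop := ∀ ε : ℝ, 0 < ε → ∃ C : ℝ, 0 ≤ C ∧ ∀ M N : ℕ, 1 ≤ M → 1 ≤ N → (N : ℝ) ^ ξ ≤ M →
  LS M N (C * ((M : ℝ) * N) ^ ε * M)

lemma Hh_dual {ξ : ℝ} (h1 : 1 ≤ ξ) (h3 : ξ ≤ 3) (h : Hh ξ) : ∀ ε : ℝ, 0 < ε → ∃ C : ℝ, 0 ≤ C ∧ ∀ J N : ℕ, 1 ≤ J → 1 ≤ N →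
    LS J N (C * ((J : ℝ) * N) ^ ε * (N + (J : ℝ) ^ ξ)) := by
  intro ε hε
  obtain ⟨C, hC, hh⟩ := h (ε / 4) (by linarith)
  refine ⟨4 * C * (2 * 2 ^ (ε / 4)), by positivity, fun J N hJ hN => ?_⟩
  have hJR : (1 : ℝ) ≤ J := by exact_mod_cast hJ
  have hNR : (1 : ℝ) ≤ N := by exact_mod_cast hN
  have hX1 : (1 : ℝ) ≤ J * N := by nlinarith
  have hc1 : (1 : ℝ) ≤ 2 ^ (ε / 4) := Real.one_le_rpow (by norm_num) (by linarith)
  have hJξ : (1 : ℝ) ≤ (J : ℝ) ^ ξ := Real.one_le_rpow hJR (by linarith)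
  by_cases hc : (J : ℝ) ^ ξ ≤ N
  · have := LS.recip (by positivity) (hh N J hN hJ hc)
    refine LSs.mono this (Finset.Subset.refl _) (Finset.Subset.refl _) ?_
    have a1 : ((N : ℝ) * J) ^ (ε / 4) ≤ ((J : ℝ) * N) ^ ε := by
      rw [mul_comm]; exact Real.rpow_le_rpow_of_exponent_le hX1 (by linarith)
    calc 4 * (C * ((N : ℝ) * J) ^ (ε / 4) * N) ≤ 4 * (C * ((J : ℝ) * N) ^ ε * (N + (J : ℝ) ^ ξ)) := by
          gcongr; linarith
      _ = 4 * C * 1 * ((J : ℝ) * N) ^ ε * (N + (J : ℝ) ^ ξ) := by ring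
      _ ≤ _ := by gcongr; linarith
  · push Not at hc
    set M' := ⌈(J : ℝ) ^ ξ⌉₊ with hM'
    have hle : (J : ℝ) ^ ξ ≤ M' := Nat.le_ceil _
    have hNM : N ≤ M' := by
      have : (N : ℝ) ≤ M' := hc.le.trans hle
      exact_mod_cast this
    have hM2 : (M' : ℝ) ≤ 2 * (J : ℝ) ^ ξ := by
      have := Nat.ceil_lt_add_one (by positivity : 0 ≤ (J : ℝ) ^ ξ)
      rw [← hM'] at this; linarith
    have := LS.recip (by positivity) (hh M' J (hN.trans hNM) hJ hle)
    refine LSs.mono this (Finset.Subset.refl _) (osq_mono hNM) ?_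
    have hJ3 : (J : ℝ) ^ ξ ≤ (J : ℝ) ^ 3 := by
      rw [← Real.rpow_natCast]; exact Real.rpow_le_rpow_of_exponent_le hJR (by simpa using h3)
    have a1 : ((M' : ℝ) * J) ^ (ε / 4) ≤ 2 ^ (ε / 4) * ((J : ℝ) * N) ^ ε := by
      calc ((M' : ℝ) * J) ^ (ε / 4) ≤ (2 * (J : ℝ) ^ 4) ^ (ε / 4) := by
            refine Real.rpow_le_rpow (by positivity) ?_ (by linarith)
            nlinarith
        _ = 2 ^ (ε / 4) * (J : ℝ) ^ ε := by
            rw [Real.mul_rpow (by norm_num) (by positivity), ← Real.rpow_natCast, ← Real.rpow_mul (by positivity)]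
            congr 2; push_cast; ring
        _ ≤ _ := by
            refine mul_le_mul_of_nonneg_left (Real.rpow_le_rpow (by positivity) (by nlinarith) hε.le) (by positivity)
    calc 4 * (C * ((M' : ℝ) * J) ^ (ε / 4) * M') ≤ 4 * (C * (2 ^ (ε / 4) * ((J : ℝ) * N) ^ ε) * (2 * (N + (J : ℝ) ^ ξ))) := by
          gcongr; linarith
      _ = _ := by ring

lemma Hh_base : Hh 3 := by
  intro ε hε
  obtain ⟨C, hC, hr⟩ := Rec2 (ξ := 1) (ε1 := 1 / 4) (ε := ε) le_rfl (by norm_num) hε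
  refine ⟨C, hC, fun M N hM hN hMN => ?_⟩
  have hMR : (1 : ℝ) ≤ M := by exact_mod_cast hM
  refine hr M N 0 M hM hN le_rfl (by positivity) ?_
  intro N0 h1 h2
  refine ⟨0, ?_, by simp, ?_, by simp⟩
  · have hN0 : (N0 : ℝ) ≤ N := by exact_mod_cast h2
    have hN3 : (N : ℝ) ^ 3 ≤ M := by exact_mod_cast hMN
    have h03 : (N0 : ℝ) ^ 3 ≤ M := le_trans (pow_le_pow_left₀ (by positivity) hN0 3) hN3
    simp only [Nat.cast_zero, zero_add, one_mul]
    refine le_of_pow_le_pow_left₀ (n := 4) (by norm_num) (by positivity) ?_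
    have e : (((M : ℝ) * N0) ^ (1 / 4 : ℝ)) ^ 4 = M * N0 := by
      rw [← Real.rpow_natCast, ← Real.rpow_mul (by positivity)]; norm_num
    rw [mul_pow, e]
    have : ((N0 : ℝ) ^ 3) ^ 3 ≤ (M : ℝ) ^ 3 := pow_le_pow_left₀ (by positivity) h03 3
    calc ((N0 : ℝ) ^ 2) ^ 4 * (M * N0) = ((N0 : ℝ) ^ 3) ^ 3 * M := by ring
      _ ≤ (M : ℝ) ^ 3 * M := by gcongr
      _ = _ := by ring
  · intro J N' a b; omega

lemma LS_zero2 (M : ℕ) {B : ℝ} : LS M 0 B := by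
  intro a
  have : osq 0 = ∅ := by simp [osq]
  rw [this]; simp

lemma Hh_step {ξ : ℝ} (h1 : 1 ≤ ξ) (h3 : ξ ≤ 3) (h : Hh ξ) : Hh (2 - 1 / ξ) := by
  intro ε hε
  have hξ0 : 0 < ξ := by linarith
  set ε1 := min (ε / 9) 1 with hε1
  have hε1p : 0 < ε1 := lt_min (by linarith) one_pos
  have hε1l : ε1 ≤ 1 := min_le_right _ _
  have hε1e : 9 * ε1 ≤ ε := by have := min_le_left (ε / 9) 1; linarith
  obtain ⟨C, hC, hr⟩ := Rec2 (ξ := ξ) (ε1 := ε1) (ε := ε / 3) h1 hε1p (by linarith)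
  obtain ⟨C2, hC2, hd⟩ := Hh_dual h1 h3 h (ε / 12) (by linarith)
  refine ⟨C * (1 + 4 * C2), by positivity, fun M N hM hN hMN => ?_⟩
  have hMR : (1 : ℝ) ≤ M := by exact_mod_cast hM
  have hNR : (1 : ℝ) ≤ N := by exact_mod_cast hN
  set X : ℝ := (M : ℝ) * N with hX
  have hX1 : 1 ≤ X := by nlinarith
  have hX0 : 0 < X := by linarith
  have hξi : 1 / ξ ≤ 1 := by rw [div_le_one hξ0]; exact h1
  have hNM : (N : ℝ) ≤ M := by
    refine le_trans ?_ hMN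
    conv_lhs => rw [← Real.rpow_one (N : ℝ)]
    exact Real.rpow_le_rpow_of_exponent_le hNR (by linarith)
  have hXe : 1 ≤ X ^ (ε / 3) := Real.one_le_rpow hX1 (by linarith)
  have key : LS M N (C * X ^ (ε / 3) * (M + C2 * X ^ (ε / 3) * (4 * M * X ^ (ε / 3)))) := by
    refine hr M N (C2 * X ^ (ε / 3)) _ hM hN (by positivity) (by positivity) ?_
    intro N0 hN0 hN0N
    have hN0R : (N0 : ℝ) ≤ N := by exact_mod_cast hN0N
    have hN01 : (1 : ℝ) ≤ N0 := by exact_mod_cast hN0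
    set X0 : ℝ := (M : ℝ) * N0 with hX0'
    have hX01 : 1 ≤ X0 := by nlinarith
    have hX0X : X0 ≤ X := by rw [hX, hX0']; gcongr
    have hM0 : (N0 : ℝ) ^ (2 - 1 / ξ) ≤ M :=
      (Real.rpow_le_rpow (by positivity) hN0R (by linarith)).trans hMN
    have hX0e : X0 ^ ε1 ≤ X0 := by
      conv_rhs => rw [← Real.rpow_one X0]
      exact Real.rpow_le_rpow_of_exponent_le hX01 hε1l
    set K := ⌊(N0 : ℝ) ^ 2 * X0 ^ ε1 / M⌋₊ with hK
    have hKle : (K : ℝ) ≤ (N0 : ℝ) ^ 2 * X0 ^ ε1 / M := Nat.floor_le (by positivity)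
    have hKlt := Nat.lt_floor_add_one ((N0 : ℝ) ^ 2 * X0 ^ ε1 / M)
    rw [← hK] at hKlt
    have hN0X : (N0 : ℝ) ≤ X0 := by nlinarith
    have hK3 : (K : ℝ) ≤ X0 ^ 3 := by
      refine hKle.trans ((div_le_self (by positivity) hMR).trans ?_)
      calc (N0 : ℝ) ^ 2 * X0 ^ ε1 ≤ X0 ^ 2 * X0 := by gcongr
        _ = X0 ^ 3 := by ring
    refine ⟨K, ?_, ?_, ?_, ?_⟩
    · rw [div_lt_iff₀ (by positivity)] at hKlt
      exact hKlt.le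
    · have := hK3; rw [hX0'] at this; exact_mod_cast this
    · intro J N' hJ hJK hN'
      rcases Nat.eq_zero_or_pos N' with h0 | h0
      · rw [h0]; exact LS_zero2 J
      refine LSs.mono (hd J N' hJ h0) (Finset.Subset.refl _) (Finset.Subset.refl _) ?_
      have hJR : (J : ℝ) ≤ X0 ^ 3 := le_trans (by exact_mod_cast hJK) hK3
      have hN'R : (N' : ℝ) ≤ X0 := le_trans (by exact_mod_cast hN') hN0X
      have : ((J : ℝ) * N') ^ (ε / 12) ≤ X ^ (ε / 3) := by
        calc ((J : ℝ) * N') ^ (ε / 12) ≤ (X ^ 4) ^ (ε / 12) := by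
              refine Real.rpow_le_rpow (by positivity) ?_ (by linarith)
              calc (J : ℝ) * N' ≤ X0 ^ 3 * X0 := by gcongr
                _ = X0 ^ 4 := by ring
                _ ≤ X ^ 4 := by gcongr
          _ = X ^ (ε / 3) := by
              rw [← Real.rpow_natCast, ← Real.rpow_mul hX0.le]
              congr 1; push_cast; ring
      gcongr
    · have hKξ : (K : ℝ) ^ ξ ≤ N0 * X ^ (ε / 3) := by
        have c1 : (K : ℝ) ^ ξ ≤ ((N0 : ℝ) ^ (1 / ξ) * X0 ^ ε1) ^ ξ := by
          refine Real.rpow_le_rpow (by positivity) (hKle.trans ?_) hξ0.le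
          rw [div_le_iff₀ (by positivity)]
          calc (N0 : ℝ) ^ 2 * X0 ^ ε1 = (N0 : ℝ) ^ (1 / ξ) * (N0 : ℝ) ^ (2 - 1 / ξ) * X0 ^ ε1 := by
                rw [← Real.rpow_add (by positivity), ← Real.rpow_natCast]
                congr 2; push_cast; ring
            _ ≤ (N0 : ℝ) ^ (1 / ξ) * M * X0 ^ ε1 := by gcongr
            _ = _ := by ring
        refine c1.trans ?_
        rw [Real.mul_rpow (by positivity) (by positivity), ← Real.rpow_mul (by positivity), one_div_mul_cancel hξ0.ne', Real.rpow_one,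
          ← Real.rpow_mul (by positivity)]
        refine mul_le_mul_of_nonneg_left ?_ (by positivity)
        calc X0 ^ (ε1 * ξ) ≤ X ^ (ε1 * ξ) := Real.rpow_le_rpow (by positivity) hX0X (by positivity)
          _ ≤ _ := Real.rpow_le_rpow_of_exponent_le hX1 (by nlinarith)
      have hN0M : (N0 : ℝ) ≤ M := hN0R.trans hNM
      have : (M : ℝ) + N0 + (1 + (M : ℝ) / N0) * (K : ℝ) ^ ξ ≤ 4 * M * X ^ (ε / 3) := by
        calc (M : ℝ) + N0 + (1 + (M : ℝ) / N0) * (K : ℝ) ^ ξ ≤ M + N0 + (1 + (M : ℝ) / N0) * (N0 * X ^ (ε / 3)) := by gcongr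
          _ = M + N0 + (N0 + M) * X ^ (ε / 3) := by field_simp
          _ ≤ _ := by nlinarith
      gcongr
  refine LSs.mono key (Finset.Subset.refl _) (Finset.Subset.refl _) ?_
  have e3 : X ^ ε = X ^ (ε / 3) * X ^ (ε / 3) * X ^ (ε / 3) := by
    rw [← Real.rpow_add hX0, ← Real.rpow_add hX0]; congr 1; ring
  rw [e3]
  set w := X ^ (ε / 3)
  have hw2 : 1 ≤ w * w := by nlinarith
  calc C * w * (M + C2 * w * (4 * M * w)) = C * w * M * (1 + 4 * C2 * (w * w)) := by ring
    _ ≤ C * w * M * (w * w + 4 * C2 * (w * w)) := by gcongr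
    _ = _ := by ring

lemma Hh_all (k : ℕ) : Hh (1 + 2 / (2 * k + 1)) := by
  induction k with
  | zero => have := Hh_base; norm_num; exact this
  | succ k ih =>
    have hk : (0 : ℝ) ≤ k := by positivity
    have := Hh_step (by have : (0 : ℝ) ≤ 2 / (2 * k + 1) := by positivity
                        linarith) (by
        have : (2 : ℝ) / (2 * k + 1) ≤ 2 := div_le_self (by norm_num) (by linarith)
        linarith) ih
    convert this using 1
    push_cast
    field_simp
    ring

theorem HBsieve {ε : ℝ} (hε : 0 < ε) : ∃ C : ℝ, 0 ≤ C ∧ ∀ J N : ℕ, 1 ≤ J → 1 ≤ N →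
    LS J N (C * ((J : ℝ) * N) ^ ε * (N + J)) := by
  obtain ⟨k, hk⟩ := exists_nat_ge (4 / ε)
  have hk0 : (0 : ℝ) ≤ k := by positivity
  have hδ : (2 : ℝ) / (2 * k + 1) ≤ ε / 2 := by
    rw [div_le_iff₀ hε] at hk
    rw [div_le_iff₀ (by positivity)]; nlinarith
  obtain ⟨C, hC, h⟩ := Hh_dual (by have : (0 : ℝ) ≤ 2 / (2 * k + 1) := by positivity
                                   linarith) (by
        have : (2 : ℝ) / (2 * k + 1) ≤ 2 := div_le_self (by norm_num) (by linarith)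
        linarith) (Hh_all k) (ε / 2) (by linarith)
  refine ⟨C, hC, fun J N hJ hN => LSs.mono (h J N hJ hN) (Finset.Subset.refl _) (Finset.Subset.refl _) ?_⟩
  have hJR : (1 : ℝ) ≤ J := by exact_mod_cast hJ
  have hNR : (1 : ℝ) ≤ N := by exact_mod_cast hN
  set X : ℝ := (J : ℝ) * N with hX
  have hX1 : 1 ≤ X := by nlinarith
  have hw : 1 ≤ X ^ (ε / 2) := Real.one_le_rpow hX1 (by linarith)
  have e : X ^ ε = X ^ (ε / 2) * X ^ (ε / 2) := by rw [← Real.rpow_add (by linarith)]; congr 1; ring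
  have hJ2 : (J : ℝ) ^ (1 + 2 / (2 * (k : ℝ) + 1)) ≤ J * X ^ (ε / 2) := by
    rw [Real.rpow_add (by linarith), Real.rpow_one]
    refine mul_le_mul_of_nonneg_left ?_ (by positivity)
    calc (J : ℝ) ^ (2 / (2 * (k : ℝ) + 1)) ≤ (J : ℝ) ^ (ε / 2) := Real.rpow_le_rpow_of_exponent_le hJR hδ
      _ ≤ _ := Real.rpow_le_rpow (by positivity) (by nlinarith) (by linarith)
  rw [e]
  calc C * X ^ (ε / 2) * (N + (J : ℝ) ^ (1 + 2 / (2 * (k : ℝ) + 1))) ≤ C * X ^ (ε / 2) * (X ^ (ε / 2) * (N + J)) := by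
        refine mul_le_mul_of_nonneg_left ?_ (by positivity)
        nlinarith
    _ = _ := by ring

end HB

namespace HB

lemma cCoef_le {ℓ u : ℕ} (hu : 1 ≤ u) : cCoef ℓ u ≤ u.divisors.card ^ 3 := by
  unfold cCoef
  have : (Finset.Icc 1 ℓ ×ˢ Finset.Icc 1 ℓ ×ˢ Finset.Icc 1 ℓ).filter (fun t => t.1 * t.2.1 * t.2.2 = u) ⊆
      u.divisors ×ˢ u.divisors ×ˢ u.divisors := by
    intro t ht
    have h := (Finset.mem_filter.mp ht).2
    simp only [Finset.mem_product, Nat.mem_divisors]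
    have hu0 : u ≠ 0 := by omega
    refine ⟨⟨⟨t.2.1 * t.2.2, by rw [← h]; ring⟩, hu0⟩, ⟨⟨t.1 * t.2.2, by rw [← h]; ring⟩, hu0⟩, ⟨⟨t.1 * t.2.1, by rw [← h]; ring⟩, hu0⟩⟩
  refine (Finset.card_le_card this).trans (le_of_eq ?_)
  rw [Finset.card_product, Finset.card_product]; ring

lemma S_cube (ℓ p : ℕ) : ((S ℓ p : ℤ) : ℝ) ^ 3 = ∑ u ∈ Icc 1 (ℓ ^ 3), (cCoef ℓ u : ℝ) * jj u p := by
  have e1 : ((S ℓ p : ℤ) : ℝ) = ∑ n ∈ Icc 1 ℓ, jj n p := by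
    unfold S jj; push_cast; rfl
  have e2 : (∑ n ∈ Icc 1 ℓ, jj n p) ^ 3 = ∑ t ∈ Icc 1 ℓ ×ˢ Icc 1 ℓ ×ˢ Icc 1 ℓ, jj (t.1 * t.2.1 * t.2.2) p := by
    rw [Finset.sum_product, pow_succ', pow_two, Finset.sum_mul]
    refine Finset.sum_congr rfl fun a _ => ?_
    rw [Finset.sum_product, Finset.sum_mul_sum, Finset.mul_sum]
    refine Finset.sum_congr rfl fun b _ => ?_
    rw [Finset.mul_sum]
    refine Finset.sum_congr rfl fun c _ => ?_
    simp only [jj_mul_left]; ring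
  rw [e1, e2, ← Finset.sum_fiberwise_of_maps_to (t := Icc 1 (ℓ ^ 3)) (g := fun t : ℕ × ℕ × ℕ => t.1 * t.2.1 * t.2.2)]
  · refine Finset.sum_congr rfl fun u _ => ?_
    unfold cCoef
    rw [Finset.sum_congr rfl (g := fun _ => jj u p), Finset.sum_const, nsmul_eq_mul]
    intro t ht
    rw [(Finset.mem_filter.mp ht).2]
  · intro t ht
    simp only [Finset.mem_product, Finset.mem_Icc] at ht ⊢
    obtain ⟨⟨a1, a2⟩, ⟨b1, b2⟩, c1, c2⟩ := ht
    refine ⟨Nat.succ_le_of_lt (by positivity), ?_⟩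
    calc t.1 * t.2.1 * t.2.2 ≤ ℓ * ℓ * ℓ := by gcongr
      _ = ℓ ^ 3 := by ring

lemma sqf_reorg (L : ℕ) (f : ℕ → ℝ) : ∑ u ∈ Icc 1 L, f u = ∑ v ∈ Icc 1 L, ∑ j ∈ sq (L / v ^ 2), f (j * v ^ 2) := by
  rw [Finset.sum_sigma']
  symm
  refine Finset.sum_bij (fun (q : (_ : ℕ) × ℕ) _ => q.2 * q.1 ^ 2) ?_ ?_ ?_ ?_
  · rintro ⟨v, j⟩ h
    simp only [Finset.mem_sigma, Finset.mem_Icc, mem_sq] at h ⊢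
    obtain ⟨⟨v1, v2⟩, j1, j2, j3⟩ := h
    refine ⟨Nat.succ_le_of_lt (by positivity), ?_⟩
    exact (Nat.le_div_iff_mul_le (by positivity)).mp j2
  · rintro ⟨v, j⟩ h ⟨v', j'⟩ h' e
    simp only [Finset.mem_sigma, Finset.mem_Icc, mem_sq] at h h' e
    obtain ⟨⟨v1, v2⟩, j1, j2, j3⟩ := h
    obtain ⟨⟨v1', v2'⟩, j1', j2', j3'⟩ := h'
    have ej : j = j' := sqf_unique j3 j3' (by omega) (by omega) e
    subst ej
    have : v ^ 2 = v' ^ 2 := Nat.eq_of_mul_eq_mul_left (by omega) e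
    have : v = v' := by
      exact (Nat.pow_left_injective (by norm_num : 2 ≠ 0)) this
    subst this; rfl
  · intro u hu
    obtain ⟨u1, u2⟩ := Finset.mem_Icc.mp hu
    obtain ⟨j, v, e, hj⟩ := Nat.sq_mul_squarefree u
    have hv : 1 ≤ v := by
      rcases Nat.eq_zero_or_pos v with h | h
      · subst h; simp at e; omega
      · exact h
    have hj1 : 1 ≤ j := Nat.pos_of_ne_zero hj.ne_zero
    have hvu : v ≤ u := by rw [← e]; nlinarith [Nat.mul_le_mul hv hv, Nat.mul_le_mul (Nat.mul_le_mul hv le_rfl : 1 * v ≤ v * v) hj1]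
    refine ⟨⟨v, j⟩, ?_, by rw [← e]; ring⟩
    simp only [Finset.mem_sigma, Finset.mem_Icc, mem_sq]
    refine ⟨⟨hv, hvu.trans u2⟩, hj1, ?_, hj⟩
    rw [Nat.le_div_iff_mul_le (by positivity)]
    calc j * v ^ 2 = u := by rw [← e]; ring
      _ ≤ L := u2
  · rintro ⟨v, j⟩ _; rfl

lemma harm_bound {η : ℝ} (hη : 0 < η) {L : ℕ} (hL : 1 ≤ L) : ∑ v ∈ Icc 1 L, (v : ℝ)⁻¹ ≤ (1 + 1 / η) * (L : ℝ) ^ η := by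
  have h := harmonic_le_one_add_log L
  rw [harmonic_eq_sum_Icc] at h
  push_cast at h
  refine h.trans ?_
  have hLR : (1 : ℝ) ≤ L := by exact_mod_cast hL
  have h2 := Real.log_le_rpow_div (by linarith : (0 : ℝ) ≤ L) hη
  have h3 : 1 ≤ (L : ℝ) ^ η := Real.one_le_rpow hLR hη.le
  rw [add_mul, one_mul, one_div_mul_eq_div]
  linarith

lemma fin_core {B cm x : ℝ} {L N : ℕ} {P : Finset ℕ} {c : ℕ → ℝ} (hB : 0 ≤ B)
    (hc : ∀ u ∈ Icc 1 L, |c u| ≤ cm) (hP : P ⊆ osq N) (hLS : ∀ J, 1 ≤ J → J ≤ L → LS J N B) :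
    ∑ p ∈ P, (∑ u ∈ Icc 1 L, c u * jj u p) ^ 2 ≤ (∑ v ∈ Icc 1 L, (v : ℝ)⁻¹) ^ 2 * (B * (L * cm ^ 2)) := by
  set H := ∑ v ∈ Icc 1 L, (v : ℝ)⁻¹ with hH
  have hH0 : 0 ≤ H := Finset.sum_nonneg fun _ _ => by positivity
  set Zv : ℕ → ℕ → ℝ := fun v p => ∑ j ∈ sq (L / v ^ 2), c (j * v ^ 2) * jj j p with hZ
  have hp : ∀ p ∈ P, (∑ u ∈ Icc 1 L, c u * jj u p) ^ 2 ≤ H * ∑ v ∈ Icc 1 L, v * Zv v p ^ 2 := by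
    intro p _
    rw [sqf_reorg L (fun u => c u * jj u p)]
    have e1 : ∀ v ∈ Icc 1 L, ∑ j ∈ sq (L / v ^ 2), c (j * v ^ 2) * jj (j * v ^ 2) p =
        Real.sqrt ((v : ℝ)⁻¹) * (Real.sqrt v * (jj v p ^ 2 * Zv v p)) := by
      intro v hv
      have hv0 : (0 : ℝ) < v := by exact_mod_cast (mem_Icc.mp hv).1
      rw [← mul_assoc, ← Real.sqrt_mul (by positivity), inv_mul_cancel₀ hv0.ne', Real.sqrt_one, one_mul, hZ, Finset.mul_sum]
      refine Finset.sum_congr rfl fun j _ => ?_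
      rw [jj_mul_left, pow_two v, jj_mul_left]; ring
    rw [Finset.sum_congr rfl e1]
    refine (Finset.sum_mul_sq_le_sq_mul_sq _ _ _).trans ?_
    have e2 : ∑ v ∈ Icc 1 L, Real.sqrt ((v : ℝ)⁻¹) ^ 2 = H :=
      Finset.sum_congr rfl fun v _ => Real.sq_sqrt (by positivity)
    rw [e2]
    refine mul_le_mul_of_nonneg_left (Finset.sum_le_sum fun v _ => ?_) hH0
    rw [mul_pow, Real.sq_sqrt (by positivity), mul_pow]
    refine mul_le_mul_of_nonneg_left (mul_le_of_le_one_left (sq_nonneg _) ?_) (by positivity)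
    have := jj_abs v p
    have h1 : jj v p ^ 2 ≤ 1 := by rw [← sq_abs]; exact pow_le_one₀ (abs_nonneg _) this
    exact pow_le_one₀ (sq_nonneg _) h1
  have hv : ∀ v ∈ Icc 1 L, v * ∑ p ∈ P, Zv v p ^ 2 ≤ (v : ℝ)⁻¹ * (B * (L * cm ^ 2)) := by
    intro v hv
    have hv1 := (mem_Icc.mp hv).1
    have hv0 : (0 : ℝ) < v := by exact_mod_cast hv1
    have hd : ∑ p ∈ P, Zv v p ^ 2 ≤ B * ((L : ℝ) / v ^ 2 * cm ^ 2) := by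
      rcases Nat.eq_zero_or_pos (L / v ^ 2) with h0 | h0
      · have : ∀ p, Zv v p = 0 := by
          intro p; simp only [hZ, h0]; simp [sq]
        simp only [this]; simp; positivity
      · have h2 := dual hB (hLS (L / v ^ 2) h0 (Nat.div_le_self _ _)) (fun j => c (j * v ^ 2))
        refine (Finset.sum_le_sum_of_subset_of_nonneg hP (fun _ _ _ => sq_nonneg _)).trans (h2.trans ?_)
        refine mul_le_mul_of_nonneg_left ?_ hB
        have h3 : ∀ j ∈ sq (L / v ^ 2), c (j * v ^ 2) ^ 2 ≤ cm ^ 2 := by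
          intro j hj
          obtain ⟨j1, j2, -⟩ := mem_sq.mp hj
          rw [← sq_abs]
          refine pow_le_pow_left₀ (abs_nonneg _) (hc _ (mem_Icc.mpr ⟨Nat.succ_le_of_lt (by positivity), ?_⟩)) 2
          exact (Nat.le_div_iff_mul_le (by positivity)).mp j2
        refine (Finset.sum_le_sum h3).trans ?_
        rw [Finset.sum_const, nsmul_eq_mul]
        refine mul_le_mul_of_nonneg_right ?_ (sq_nonneg _)
        have h4 : (sq (L / v ^ 2)).card ≤ L / v ^ 2 := by
          refine (Finset.card_filter_le _ _).trans ?_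
          simp
        calc ((sq (L / v ^ 2)).card : ℝ) ≤ ((L / v ^ 2 : ℕ) : ℝ) := by exact_mod_cast h4
          _ ≤ (L : ℝ) / ((v ^ 2 : ℕ) : ℝ) := Nat.cast_div_le
          _ = _ := by push_cast; rfl
    refine (mul_le_mul_of_nonneg_left hd hv0.le).trans (le_of_eq ?_)
    field_simp
  calc ∑ p ∈ P, (∑ u ∈ Icc 1 L, c u * jj u p) ^ 2 ≤ ∑ p ∈ P, H * ∑ v ∈ Icc 1 L, v * Zv v p ^ 2 := Finset.sum_le_sum hp
    _ = H * ∑ v ∈ Icc 1 L, v * ∑ p ∈ P, Zv v p ^ 2 := by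
        rw [← Finset.mul_sum, Finset.sum_comm]; simp_rw [Finset.mul_sum]
    _ ≤ H * ∑ v ∈ Icc 1 L, (v : ℝ)⁻¹ * (B * (L * cm ^ 2)) := mul_le_mul_of_nonneg_left (Finset.sum_le_sum hv) hH0
    _ = _ := by rw [← Finset.sum_mul, ← hH]; ring

end HB

/-- For fixed `ρ > 0` and `δ ∈ (0,1)`: for all `x ≥ 2` and integers `ℓ ≥ 2`,
`∑_{p ≤ x} |S_ℓ(p)|⁶ ≪_{ρ,δ} (x ℓ³)^ρ (x + ℓ³) ℓ^(3+δ)`. -/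
theorem stmt14 (ρ δ : ℝ) (hρ : 0 < ρ) (hδ : 0 < δ) (hδ1 : δ < 1) :
    ∃ C : ℝ, 0 < C ∧ ∀ (x : ℝ) (ℓ : ℕ), 2 ≤ x → 2 ≤ ℓ →
      ∑ p ∈ oddPrimesUpTo x, |(S ℓ p : ℝ)| ^ 6
        ≤ C * (x * (ℓ : ℝ) ^ 3) ^ ρ * (x + (ℓ : ℝ) ^ 3) * (ℓ : ℝ) ^ ((3 : ℝ) + δ) := by
  set η := δ / 24 with hη
  have hη0 : 0 < η := by positivity
  obtain ⟨C, hC, hLS⟩ := HB.HBsieve hρ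
  obtain ⟨Cd, hCd, hdiv⟩ := HB.div_bound hη0
  refine ⟨(1 + 1 / η) ^ 2 * C * Cd ^ 6 + 1, by positivity, fun x ℓ hx hℓ => ?_⟩
  have hℓR : (2 : ℝ) ≤ ℓ := by exact_mod_cast hℓ
  set L := ℓ ^ 3 with hL
  have hLc : (L : ℝ) = (ℓ : ℝ) ^ 3 := by rw [hL]; push_cast; rfl
  have hL1 : 1 ≤ L := Nat.one_le_pow _ _ (by omega)
  have hLR : (1 : ℝ) ≤ L := by exact_mod_cast hL1
  set N := ⌊x⌋₊ with hN
  have hNx : (N : ℝ) ≤ x := Nat.floor_le (by linarith)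
  have hN1 : 1 ≤ N := Nat.le_floor (by push_cast; linarith)
  have hP : oddPrimesUpTo x ⊆ HB.osq N := by
    intro p hp
    obtain ⟨h1, h2, h3⟩ := Finset.mem_filter.mp hp
    rw [Finset.mem_range] at h1
    exact HB.mem_osq.mpr ⟨h2.one_le, by omega, h2.odd_of_ne_two h3, h2.squarefree⟩
  set B := C * (x * L) ^ ρ * (x + L) with hB
  have hx0 : 0 < x := by linarith
  have hB0 : 0 ≤ B := by positivity
  have h := HB.fin_core (x := x) (B := B) (cm := (Cd * (L : ℝ) ^ η) ^ 3) (L := L) (N := N) (P := oddPrimesUpTo x) (c := fun u => (cCoef ℓ u : ℝ))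
    hB0 ?_ hP ?_
  · have e : ∀ p, |(S ℓ p : ℝ)| ^ 6 = (∑ u ∈ Icc 1 L, (cCoef ℓ u : ℝ) * HB.jj u p) ^ 2 := by
      intro p
      rw [hL, ← HB.S_cube, ← pow_mul, Even.pow_abs (by decide)]
    simp_rw [e]
    refine h.trans ?_
    have hH := HB.harm_bound hη0 hL1
    have hH0 : (0 : ℝ) ≤ ∑ v ∈ Icc 1 L, (v : ℝ)⁻¹ := Finset.sum_nonneg fun _ _ => by positivity
    have hpow : ((L : ℝ) ^ η) ^ 8 * L = (ℓ : ℝ) ^ ((3 : ℝ) + δ) := by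
      rw [← Real.rpow_natCast, ← Real.rpow_mul (by positivity), hLc, ← Real.rpow_natCast (ℓ : ℝ) 3, ← Real.rpow_mul (by positivity),
        ← Real.rpow_add (by positivity)]
      congr 1
      rw [hη]; push_cast; ring
    calc (∑ v ∈ Icc 1 L, (v : ℝ)⁻¹) ^ 2 * (B * (L * ((Cd * (L : ℝ) ^ η) ^ 3) ^ 2))
        ≤ ((1 + 1 / η) * (L : ℝ) ^ η) ^ 2 * (B * (L * ((Cd * (L : ℝ) ^ η) ^ 3) ^ 2)) := by
          gcongr
      _ = (1 + 1 / η) ^ 2 * Cd ^ 6 * B * (((L : ℝ) ^ η) ^ 8 * L) := by ring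
      _ = ((1 + 1 / η) ^ 2 * C * Cd ^ 6) * (x * (ℓ : ℝ) ^ 3) ^ ρ * (x + (ℓ : ℝ) ^ 3) * (ℓ : ℝ) ^ ((3 : ℝ) + δ) := by
          rw [hpow, hB, hLc]; ring
      _ ≤ _ := by
          gcongr; linarith
  · intro u hu
    obtain ⟨u1, u2⟩ := mem_Icc.mp hu
    rw [abs_of_nonneg (by positivity)]
    calc (cCoef ℓ u : ℝ) ≤ (u.divisors.card : ℝ) ^ 3 := by exact_mod_cast HB.cCoef_le u1
      _ ≤ (Cd * (L : ℝ) ^ η) ^ 3 := by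
          refine pow_le_pow_left₀ (by positivity) ((hdiv u u1).trans ?_) 3
          have : (u : ℝ) ≤ L := by exact_mod_cast u2
          gcongr
  · intro J hJ hJL
    refine HB.LSs.mono (hLS J N hJ hN1) (Finset.Subset.refl _) (Finset.Subset.refl _) ?_
    have hJR : (J : ℝ) ≤ L := by exact_mod_cast hJL
    rw [hB, mul_comm (J : ℝ)]
    gcongr

end
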